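/- Let λ ∈ ℝ. The family G(λ) of all graphs whose smallest eigenvalue is at least −λ (with the convention that the graph with no vertices belongs to G(λ)) has a finite forbidden subgraph characterization if and only if λ < λ*. -/

import Mathlib

open Classical

/-- An eigenvalue of a real matrix indexed by a finite type. -/
def IsEigenvalue {V : Type*} [Fintype V] (A : Matrix V V ℝ) (μ : ℝ) : Prop :=
  ∃ v : V → ℝ, v ≠ 0 ∧ A.mulVec v = μ • v

/-- The adjacency matrix (over ℝ) of a simple graph. -/
noncomputable def adjMat {V : Type*} [Fintype V] (G : SimpleGraph V) : Matrix V V ℝ :=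
  fun i j => if G.Adj i j then 1 else 0

/-- A family of graphs (given as a predicate on graphs on `Fin n` for all `n`) has a finite
forbidden (induced) subgraph characterization. -/
def HasFiniteForbiddenCharacterization (P : ∀ n : ℕ, SimpleGraph (Fin n) → Prop) : Prop :=
  ∃ (k : ℕ) (N : Fin k → ℕ) (F : ∀ i : Fin k, SimpleGraph (Fin (N i))),
    ∀ (n : ℕ) (G : SimpleGraph (Fin n)),
      P n G ↔ ∀ i : Fin k, IsEmpty (F i ↪g G)

section Form

variable {V W : Type*} [Fintype V] [Fintype W]

/-- The quadratic form of `lam • 1 + A`, where `A` is the adjacency matrix of `G`. -/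
noncomputable def qf (G : SimpleGraph V) (lam : ℝ) (x : V → ℝ) : ℝ :=
  lam * ∑ v, x v ^ 2 + ∑ v, ∑ w, adjMat G v w * (x v * x w)

theorem qf_add_lam (G : SimpleGraph V) (lam e : ℝ) (x : V → ℝ) :
    qf G (lam + e) x = qf G lam x + e * ∑ v, x v ^ 2 := by
  unfold qf; ring

theorem qf_mono {G : SimpleGraph V} {lam mu : ℝ} (h : lam ≤ mu) (x : V → ℝ) :
    qf G lam x ≤ qf G mu x := by
  unfold qf
  have := mul_le_mul_of_nonneg_right h
    (Finset.sum_nonneg fun v (_ : v ∈ Finset.univ) => sq_nonneg (x v))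
  linarith

theorem qf_smul (G : SimpleGraph V) (lam c : ℝ) (x : V → ℝ) :
    qf G lam (fun v => c * x v) = c ^ 2 * qf G lam x := by
  unfold qf
  simp only [mul_add, Finset.mul_sum]
  congr 1
  · exact Finset.sum_congr rfl fun v _ => by ring
  · exact Finset.sum_congr rfl fun v _ => Finset.sum_congr rfl fun w _ => by ring

/-- Glue `G` and `H` by joining the vertex `r` of `G` to the vertices of `H` lying in `C`. -/
def attach (G : SimpleGraph V) (r : V) (H : SimpleGraph W) (C : Set W) : SimpleGraph (V ⊕ W) where
  Adj a b := match a, b with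
    | .inl v, .inl w => G.Adj v w
    | .inr v, .inr w => H.Adj v w
    | .inl v, .inr w => v = r ∧ w ∈ C
    | .inr w, .inl v => v = r ∧ w ∈ C
  symm := ⟨by rintro (a | a) (b | b) h <;> first | exact h.symm | exact h⟩
  loopless := ⟨by rintro (a | a) h <;> exact (SimpleGraph.irrefl _ h)⟩

theorem qf_attach (G : SimpleGraph V) (r : V) (H : SimpleGraph W) (C : Set W) (lam : ℝ)
    (x : V ⊕ W → ℝ) :
    qf (attach G r H C) lam x = qf G lam (fun v => x (.inl v)) + qf H lam (fun w => x (.inr w)) +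
      2 * x (.inl r) * ∑ w, if w ∈ C then x (.inr w) else 0 := by
  have a1 : ∀ v w, adjMat (attach G r H C) (.inl v) (.inl w) = adjMat G v w := fun _ _ => rfl
  have a2 : ∀ v w, adjMat (attach G r H C) (.inr v) (.inr w) = adjMat H v w := fun _ _ => rfl
  have a3 : ∀ v w, adjMat (attach G r H C) (.inl v) (.inr w) =
      if v = r then (if w ∈ C then 1 else 0) else 0 := fun v w => by
    rw [← ite_and]; unfold adjMat; congr
  have a4 : ∀ v w, adjMat (attach G r H C) (.inr w) (.inl v) =
      if v = r then (if w ∈ C then 1 else 0) else 0 := fun v w => by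
    rw [← ite_and]; unfold adjMat; congr
  have h1 : (∑ v : V, ∑ w : W, adjMat (attach G r H C) (.inl v) (.inr w) *
      (x (.inl v) * x (.inr w))) = x (.inl r) * ∑ w, if w ∈ C then x (.inr w) else 0 := by
    simp only [a3, ite_mul, one_mul, zero_mul]
    rw [Finset.sum_comm]
    simp only [Finset.sum_ite_eq', Finset.mem_univ, if_true, Finset.mul_sum, mul_ite, mul_zero]
  have h2 : (∑ w : W, ∑ v : V, adjMat (attach G r H C) (.inr w) (.inl v) *
      (x (.inr w) * x (.inl v))) = x (.inl r) * ∑ w, if w ∈ C then x (.inr w) else 0 := by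
    simp only [a4, ite_mul, one_mul, zero_mul]
    simp only [Finset.sum_ite_eq', Finset.mem_univ, if_true, Finset.mul_sum, mul_ite, zero_mul,
      mul_comm]
  unfold qf
  simp only [Fintype.sum_sum_type, a1, a2, Finset.sum_add_distrib, h1, h2]
  ring

theorem qf_top (lam : ℝ) (x : V → ℝ) :
    qf (⊤ : SimpleGraph V) lam x = (lam - 1) * ∑ v, x v ^ 2 + (∑ v, x v) ^ 2 := by
  have h : ∀ v w : V, adjMat (⊤ : SimpleGraph V) v w = 1 - if v = w then 1 else 0 := by
    intro v w
    by_cases hv : v = w <;> simp [adjMat, hv]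
  unfold qf
  simp only [h, sub_mul, one_mul, ite_mul, zero_mul, Finset.sum_sub_distrib, Finset.sum_ite_eq,
    Finset.mem_univ, if_true, ← Finset.mul_sum, ← Finset.sum_mul, ← pow_two]
  ring

/-- `m` is the minimum of the form of `G` at parameter `lam` over vectors equal to `1` at `r`. -/
structure RootMin (G : SimpleGraph V) (r : V) (lam m : ℝ) : Prop where
  low : ∀ x : V → ℝ, m * x r ^ 2 ≤ qf G lam x
  att : ∃ x : V → ℝ, x r = 1 ∧ qf G lam x = m

theorem RootMin.exists_val {G : SimpleGraph V} {r : V} {lam m : ℝ} (h : RootMin G r lam m) (c : ℝ) :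
    ∃ x : V → ℝ, x r = c ∧ qf G lam x = m * c ^ 2 := by
  obtain ⟨x, hx, hq⟩ := h.att
  exact ⟨fun v => c * x v, by simp [hx], by rw [qf_smul, hq]; ring⟩

theorem RootMin.single (lam : ℝ) : RootMin (⊥ : SimpleGraph Unit) () lam lam :=
  ⟨fun x => by simp [qf, adjMat], fun _ => 1, rfl, by simp [qf, adjMat]⟩

theorem RootMin.join {G : SimpleGraph V} {r : V} {H : SimpleGraph W} {s : W} {lam m k : ℝ}
    (hG : RootMin G r lam m) (hH : RootMin H s lam k) (hk : 0 < k) :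
    RootMin (attach G r H {s}) (.inl r) lam (m - 1 / k) := by
  constructor
  · intro x
    have h1 := hG.low fun v => x (.inl v)
    have h2 := hH.low fun w => x (.inr w)
    have h3 : 0 ≤ k * (x (.inr s) + x (.inl r) / k) ^ 2 := by positivity
    have h4 : k * (x (.inr s) + x (.inl r) / k) ^ 2 =
        k * x (.inr s) ^ 2 + 2 * x (.inl r) * x (.inr s) + 1 / k * x (.inl r) ^ 2 := by
      field_simp
      ring
    rw [qf_attach]
    simp only [Set.mem_singleton_iff, Finset.sum_ite_eq', Finset.mem_univ, if_true]
    linarith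
  · obtain ⟨x, hx, hq⟩ := hG.att
    obtain ⟨y, hy, hp⟩ := hH.exists_val (-1 / k)
    refine ⟨Sum.elim x y, by simpa using hx, ?_⟩
    rw [qf_attach]
    simp only [Set.mem_singleton_iff, Finset.sum_ite_eq', Finset.mem_univ, if_true, Sum.elim_inl,
      Sum.elim_inr, hx, hy]
    rw [hq, hp]
    field_simp
    ring

end Form

section Clique

variable {V : Type*} [Fintype V]

/-- Add a new root and `n` further vertices, pairwise adjacent and all adjacent to the old root. -/
def cliqueExt (G : SimpleGraph V) (r : V) (n : ℕ) : SimpleGraph (V ⊕ Option (Fin n)) :=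
  attach G r ⊤ Set.univ

theorem qf_cliqueExt (G : SimpleGraph V) (r : V) (n : ℕ) (lam : ℝ) (x : V ⊕ Option (Fin n) → ℝ) :
    qf (cliqueExt G r n) lam x = qf G lam (fun v => x (.inl v)) + lam * x (.inr none) ^ 2 +
      2 * x (.inr none) * x (.inl r) + ((lam - 1) * ∑ i, x (.inr (some i)) ^ 2 +
        (∑ i, x (.inr (some i))) ^ 2 +
        2 * (∑ i, x (.inr (some i))) * (x (.inr none) + x (.inl r))) := by
  unfold cliqueExt
  rw [qf_attach, qf_top]
  simp only [Fintype.sum_option, Set.mem_univ, if_true]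
  ring

theorem clique_low {n : ℕ} {lam : ℝ} (hl : 1 < lam) (y : Fin n → ℝ) (b : ℝ) :
    -(n / (lam - 1 + n)) * b ^ 2 ≤
      (lam - 1) * ∑ i, y i ^ 2 + (∑ i, y i) ^ 2 + 2 * (∑ i, y i) * b := by
  have hp : 0 < lam - 1 + n := by have := Nat.cast_nonneg (α := ℝ) n; linarith
  set d := b / (lam - 1 + n) with hd
  have hb : b = d * (lam - 1 + n) := by rw [hd]; field_simp
  have h1 : 0 ≤ ∑ i, (y i + d) ^ 2 := Finset.sum_nonneg fun i _ => sq_nonneg _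
  have h2 : ∑ i, (y i + d) ^ 2 = ∑ i, y i ^ 2 + 2 * d * ∑ i, y i + n * d ^ 2 := by
    simp only [add_sq, Finset.sum_add_distrib, Finset.mul_sum, Finset.sum_const, Finset.card_univ,
      Fintype.card_fin, nsmul_eq_mul]
    congr 2
    exact Finset.sum_congr rfl fun i _ => by ring
  have h3 := mul_nonneg (sub_nonneg.2 hl.le) h1
  have h4 := sq_nonneg (∑ i, y i + n * d)
  rw [h2] at h3
  have h5 : -(n / (lam - 1 + n)) * b ^ 2 = -(n * (lam - 1 + n) * d ^ 2) := by
    rw [hb]; field_simp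
  rw [h5, hb]
  nlinarith

theorem clique_att {n : ℕ} {lam : ℝ} (hl : 1 < lam) (b : ℝ) :
    ∃ d : ℝ, (lam - 1) * ∑ _i : Fin n, d ^ 2 + (∑ _i : Fin n, d) ^ 2 + 2 * (∑ _i : Fin n, d) * b =
      -(n / (lam - 1 + n)) * b ^ 2 := by
  have hp : 0 < lam - 1 + n := by have := Nat.cast_nonneg (α := ℝ) n; linarith
  refine ⟨-b / (lam - 1 + n), ?_⟩
  simp only [Finset.sum_const, Finset.card_univ, Fintype.card_fin, nsmul_eq_mul]
  field_simp
  ring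

theorem RootMin.cliqueExt {G : SimpleGraph V} {r : V} {lam m : ℝ} (h : RootMin G r lam m)
    (hl : 1 < lam) (n : ℕ) (hm : n / (lam - 1 + n) < m) :
    RootMin (cliqueExt G r n) (.inr none) lam
      (lam - n / (lam - 1 + n) - (1 - n / (lam - 1 + n)) ^ 2 / (m - n / (lam - 1 + n))) := by
  set c := n / (lam - 1 + n) with hc
  have hmc : 0 < m - c := sub_pos.2 hm
  constructor
  · intro x
    rw [qf_cliqueExt]
    have h1 := h.low fun v => x (.inl v)
    have h2 := clique_low hl (fun i => x (.inr (some i))) (x (.inr none) + x (.inl r))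
    rw [← hc] at h2
    set a := x (.inr none)
    set b := x (.inl r)
    have h3 : 0 ≤ (m - c) * (b + (1 - c) * a / (m - c)) ^ 2 := by positivity
    have h4 : (m - c) * (b + (1 - c) * a / (m - c)) ^ 2 =
        (m - c) * b ^ 2 + 2 * (1 - c) * a * b + (1 - c) ^ 2 / (m - c) * a ^ 2 := by
      field_simp
      ring
    nlinarith
  · set b := -(1 - c) / (m - c) with hb
    obtain ⟨x, hx, hq⟩ := h.exists_val b
    obtain ⟨d, hd⟩ := clique_att (n := n) hl (1 + b)
    rw [← hc] at hd
    refine ⟨Sum.elim x fun o => o.elim 1 fun _ => d, rfl, ?_⟩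
    rw [qf_cliqueExt]
    simp only [Sum.elim_inl, Sum.elim_inr, Option.elim, hx]
    rw [hd, hq, hb]
    field_simp
    ring

theorem exists_qf_cliqueExt_neg {G : SimpleGraph V} {r : V} {lam m : ℝ} (h : RootMin G r lam m)
    (hl : 1 < lam) (n : ℕ) (hm : m < n / (lam - 1 + n)) :
    ∃ x, qf (cliqueExt G r n) lam x < 0 := by
  obtain ⟨x, hx, hq⟩ := h.att
  obtain ⟨d, hd⟩ := clique_att (n := n) hl 1
  refine ⟨Sum.elim x fun o => o.elim 0 fun _ => d, ?_⟩
  rw [qf_cliqueExt]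
  simp only [Sum.elim_inl, Sum.elim_inr, Option.elim, hx, zero_add]
  rw [hd, hq]
  linarith

end Clique

/-- The value of `RootMin` after a clique extension. -/
noncomputable def cliqueVal (lam : ℝ) (n : ℕ) (m : ℝ) : ℝ :=
  lam - n / (lam - 1 + n) - (1 - n / (lam - 1 + n)) ^ 2 / (m - n / (lam - 1 + n))

theorem cliqueVal_eq {lam m v : ℝ} {n : ℕ} (hl : 1 < lam) (hm : m < 1) (hv : 0 < v)
    (h : v = 1 / (1 - m) - 1 - n / (lam - 1)) :
    n / (lam - 1 + n) < m ∧ cliqueVal lam n m = lam - 1 - 1 / v := by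
  have h1 : 0 < 1 - m := by linarith
  have hp : 0 < lam - 1 := by linarith
  have hq : 0 < lam - 1 + n := by have := Nat.cast_nonneg (α := ℝ) n; linarith
  have hk : m * (lam - 1 + n) - n = (lam - 1) * (1 - m) * v := by
    rw [h]; field_simp; ring
  have hpos : 0 < m * (lam - 1 + n) - n := by rw [hk]; positivity
  refine ⟨by rw [div_lt_iff₀ hq]; linarith, ?_⟩
  have e1 : m - n / (lam - 1 + n) = (lam - 1) * (1 - m) * v / (lam - 1 + n) := by
    rw [← hk]; field_simp
  have e2 : 1 - n / (lam - 1 + n) = (lam - 1) / (lam - 1 + n) := by field_simp; ring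
  have e3 : n / (lam - 1 + n) = 1 - (lam - 1) / (lam - 1 + n) := by field_simp; ring
  have e4 : lam - 1 + n = (lam - 1) * (1 - (1 - m) * v) / (1 - m) := by
    rw [h]; field_simp; ring
  have e5 : 0 < 1 - (1 - m) * v := by
    have : 0 < (lam - 1) * (1 - (1 - m) * v) := by
      rw [e4, lt_div_iff₀ h1] at hq; linarith
    exact pos_of_mul_pos_right this hp.le
  unfold cliqueVal
  rw [e1, e2, e3, e4]
  field_simp
  ring

theorem cliqueVal_mono {lam m mu M : ℝ} {n : ℕ} (hl : 1 < lam) (hlm : lam ≤ mu) (hmM : m ≤ M)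
    (hM : M < 1) (hv : 0 < 1 / (1 - m) - 1 - n / (lam - 1)) :
    n / (mu - 1 + n) < M ∧ cliqueVal lam n m + (mu - lam) + (M - m) ≤ cliqueVal mu n M := by
  have h1 : 0 < 1 - m := by linarith
  have h2 : 0 < 1 - M := by linarith
  have hn := Nat.cast_nonneg (α := ℝ) n
  set v := 1 / (1 - m) - 1 - n / (lam - 1) with hvd
  set w := 1 / (1 - M) - 1 - n / (mu - 1) with hwd
  have hd : n / (mu - 1) ≤ n / (lam - 1) := by gcongr
  have hd0 : (n : ℝ) / (mu - 1) ≥ 0 := by apply div_nonneg hn; linarith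
  have hmv : 1 / (1 - m) ≤ 1 / (1 - M) := by gcongr
  have hw : 0 < w := by linarith
  have hdiff : 1 / (1 - M) - 1 / (1 - m) ≤ w - v := by linarith
  obtain ⟨-, e1⟩ := cliqueVal_eq hl (by linarith) hv hvd
  obtain ⟨e3, e2⟩ := cliqueVal_eq (n := n) (hl.trans_le hlm) hM hw hwd
  refine ⟨e3, ?_⟩
  rw [e1, e2]
  have hvle : v * (1 - m) ≤ 1 := by
    have : v ≤ 1 / (1 - m) := by
      have : (n : ℝ) / (lam - 1) ≥ 0 := by apply div_nonneg hn; linarith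
      linarith
    rwa [le_div_iff₀ h1] at this
  have hwle : w * (1 - M) ≤ 1 := by
    have : w ≤ 1 / (1 - M) := by linarith
    rwa [le_div_iff₀ h2] at this
  have e4 : 1 / (1 - M) - 1 / (1 - m) = (M - m) / ((1 - M) * (1 - m)) := by field_simp; ring
  have e5 : 1 / v - 1 / w = (w - v) / (v * w) := by field_simp
  have h6 : M - m ≤ 1 / v - 1 / w := by
    rw [e5, le_div_iff₀ (by positivity)]
    rw [e4, div_le_iff₀ (by positivity)] at hdiff
    have h7 : (v * (1 - m)) * (w * (1 - M)) ≤ 1 := mul_le_one₀ hvle (by positivity) hwle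
    have h8 := mul_le_mul_of_nonneg_left h7 (sub_nonneg.2 hmM)
    have h9 := mul_le_mul_of_nonneg_right hdiff (mul_pos hv hw).le
    have h10 : (M - m) * (v * w) * ((1 - M) * (1 - m)) ≤ (w - v) * ((1 - M) * (1 - m)) := by
      have : 0 ≤ w - v := by
        have : 0 ≤ (M - m) / ((1 - M) * (1 - m)) := div_nonneg (sub_nonneg.2 hmM) (by positivity)
        linarith
      nlinarith
    exact le_of_mul_le_mul_right h10 (by positivity)
  linarith

/-- Some rooted graph has root minima `m` and `M` at the parameters `lam` and `mu`. -/
def TwoMin (lam mu m M : ℝ) : Prop :=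
  ∃ (V : Type) (_ : Fintype V) (G : SimpleGraph V) (r : V), RootMin G r lam m ∧ RootMin G r mu M

namespace TwoMin

variable {lam mu m M k K : ℝ}

theorem single (lam mu : ℝ) : TwoMin lam mu lam mu :=
  ⟨Unit, inferInstance, ⊥, (), RootMin.single lam, RootMin.single mu⟩

theorem join (h : TwoMin lam mu m M) (h' : TwoMin lam mu k K) (hk : 0 < k) (hK : 0 < K) :
    TwoMin lam mu (m - 1 / k) (M - 1 / K) := by
  obtain ⟨V, _, G, r, h1, h2⟩ := h
  obtain ⟨W, _, H, s, h3, h4⟩ := h'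
  exact ⟨V ⊕ W, inferInstance, _, _, h1.join h3 hk, h2.join h4 hK⟩

theorem clique (h : TwoMin lam mu m M) (hl : 1 < lam) (hu : 1 < mu) (n : ℕ)
    (hm : n / (lam - 1 + n) < m) (hM : n / (mu - 1 + n) < M) :
    TwoMin lam mu (cliqueVal lam n m) (cliqueVal mu n M) := by
  obtain ⟨V, _, G, r, h1, h2⟩ := h
  exact ⟨_, inferInstance, _, _, h1.cliqueExt hl n hm, h2.cliqueExt hu n hM⟩

theorem pendants (h : TwoMin lam mu m M) (hl : 0 < lam) (hu : 0 < mu) (j : ℕ) :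
    TwoMin lam mu (m - j / lam) (M - j / mu) := by
  induction j with
  | zero => simpa using h
  | succ j ih =>
    convert ih.join (single lam mu) hl hu using 1 <;> push_cast <;> ring

theorem separate (h : TwoMin lam mu m M) (hl : 1 < lam) (hu : 1 < mu) (hm : m < 1) (hM : 1 ≤ M) :
    ∃ (V : Type) (_ : Fintype V) (G : SimpleGraph V),
      (∃ x, qf G lam x < 0) ∧ ∀ x, 0 ≤ qf G mu x := by
  obtain ⟨V, _, G, r, h1, h2⟩ := h
  obtain ⟨n, hn⟩ := exists_nat_gt (m * (lam - 1) / (1 - m))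
  have hn0 := Nat.cast_nonneg (α := ℝ) n
  have hc : m < n / (lam - 1 + n) := by
    rw [div_lt_iff₀ (by linarith)] at hn
    rw [lt_div_iff₀ (by linarith)]
    linarith
  have hC : n / (mu - 1 + n) < 1 := by
    rw [div_lt_one (by linarith)]
    linarith
  refine ⟨_, inferInstance, cliqueExt G r n, exists_qf_cliqueExt_neg h1 hl n hc, fun x => ?_⟩
  refine le_trans (mul_nonneg ?_ (sq_nonneg _)) ((h2.cliqueExt hu n (hC.trans_le hM)).low x)
  set C : ℝ := n / (mu - 1 + n)
  have : (1 - C) ^ 2 / (M - C) ≤ 1 - C := by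
    rw [div_le_iff₀ (by linarith)]
    nlinarith
  linarith

theorem clique_step {s : ℝ} (hs : 1 < s) (hs2 : s ≤ 1.76) (hlam : lam = s + 1 / s)
    (h : TwoMin lam mu m M) (hmu : lam ≤ mu) (hm : 1 / s ≤ m) (hmM : m ≤ M) (hM : M < 1) :
    ∃ m' M', TwoMin lam mu m' M' ∧ 1 / s ≤ m' ∧ m' < 1 ∧ m' + (mu - lam) + (M - m) ≤ M' := by
  have hs0 : 0 < s := by linarith
  have hs1 : 0 < s - 1 := by linarith
  have e1 : lam - 2 = (s - 1) ^ 2 / s := by rw [hlam]; field_simp; ring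
  have hl2 : 0 < lam - 2 := by rw [e1]; positivity
  have hl : 1 < lam := by linarith
  set y := 1 / (1 - m) with hy
  have hm1 : 0 < 1 - m := by linarith
  have hylow : 1 / (s - 1) ≤ y - 1 := by
    have : y - 1 = m / (1 - m) := by rw [hy]; field_simp; ring
    rw [this, div_le_div_iff₀ hs1 hm1]
    rw [div_le_iff₀ hs0] at hm
    linarith
  set n := ⌊(y - 1 - 1 / (s - 1)) * (lam - 1)⌋₊ with hn
  have hn1 : (n : ℝ) ≤ (y - 1 - 1 / (s - 1)) * (lam - 1) :=
    Nat.floor_le (mul_nonneg (by linarith) (by linarith))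
  have hn2 : (y - 1 - 1 / (s - 1)) * (lam - 1) < n + 1 := Nat.lt_floor_add_one _
  set v := y - 1 - n / (lam - 1) with hv
  have hnl : (n : ℝ) / (lam - 1) ≤ y - 1 - 1 / (s - 1) := by
    rwa [div_le_iff₀ (by linarith)]
  have hnu : y - 1 - 1 / (s - 1) < n / (lam - 1) + 1 / (lam - 1) := by
    rw [← add_div, lt_div_iff₀ (by linarith)]; exact hn2
  have hvs : 1 / (s - 1) ≤ v := by linarith
  have hv0 : 0 < v := lt_of_lt_of_le (by positivity) hvs
  have hvu : v < 1 / (lam - 2) := by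
    have h1 : 1 / (lam - 2) = 1 / (s - 1) + 1 / (s - 1) ^ 2 := by
      rw [e1]; field_simp; ring
    have h2 : 1 / (lam - 1) ≤ 1 / (s - 1) ^ 2 := by
      apply one_div_le_one_div_of_le (by positivity)
      have : 0 < 1 / s := by positivity
      rw [hlam]
      nlinarith
    linarith
  obtain ⟨c1, c2⟩ := cliqueVal_eq hl (by linarith) hv0 hv
  obtain ⟨c3, c4⟩ := cliqueVal_mono hl hmu hmM hM hv0
  refine ⟨_, _, h.clique hl (hl.trans_le hmu) n c1 c3, ?_, ?_, c4⟩
  · rw [c2]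
    have : 1 / v ≤ s - 1 := by
      rw [div_le_iff₀ hv0]
      rw [div_le_iff₀ hs1] at hvs
      linarith
    linarith
  · rw [c2]
    have : lam - 2 < 1 / v := by
      rw [lt_div_iff₀ hv0]
      rw [lt_div_iff₀ hl2] at hvu
      linarith
    linarith

theorem exists_pendants {s x : ℝ} (hs : 1.76 ≤ s) (hlam : lam = s + 1 / s) (hx : 1 / s ≤ x) :
    ∃ j : ℕ, 1 / s ≤ x - j / lam ∧ x - j / lam < 1 := by
  have hs0 : 0 < s := by linarith
  have hl : 0 < lam := by rw [hlam]; positivity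
  refine ⟨⌊(x - 1 / s) * lam⌋₊, ?_, ?_⟩
  · have := Nat.floor_le (mul_nonneg (sub_nonneg.2 hx) hl.le)
    rw [← div_le_iff₀ hl] at this
    linarith
  · have := Nat.lt_floor_add_one ((x - 1 / s) * lam)
    rw [← lt_div_iff₀ hl, add_div] at this
    have h2 : 1 / s + 1 / lam ≤ 1 := by
      have : 1 / lam = s / (s ^ 2 + 1) := by rw [hlam]; field_simp
      rw [this, div_add_div _ _ (by positivity) (by positivity), div_le_one (by positivity)]
      nlinarith [mul_nonneg (sub_nonneg.2 hs) (sub_nonneg.2 hs),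
          mul_nonneg (mul_nonneg (sub_nonneg.2 hs) (sub_nonneg.2 hs)) hs0.le]
    linarith

theorem pendant_step {s : ℝ} (hs : 1.76 ≤ s) (hlam : lam = s + 1 / s)
    (h : TwoMin lam mu m M) (hmu : lam ≤ mu) (hm : 1 / s ≤ m) (hmM : m ≤ M) (hM : M < 1) :
    ∃ m' M', TwoMin lam mu m' M' ∧ 1 / s ≤ m' ∧ m' < 1 ∧ m' + (mu - lam) + (M - m) ≤ M' := by
  have hs0 : 0 < s := by linarith
  have hl : 0 < lam := by rw [hlam]; positivity
  have hm0 : 0 < m := lt_of_lt_of_le (by positivity) hm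
  have hM0 : 0 < M := by linarith
  have h1 : 1 / m ≤ s := by
    rw [div_le_iff₀ hm0]; rw [div_le_iff₀ hs0] at hm; linarith
  obtain ⟨j, hj1, hj2⟩ := exists_pendants (x := lam - 1 / m) hs hlam (by linarith)
  refine ⟨_, _, ((single lam mu).join h hm0 hM0).pendants hl (by linarith) j, hj1, hj2, ?_⟩
  have h2 : (j : ℝ) / mu ≤ j / lam := by gcongr
  have h3 : M - m ≤ 1 / m - 1 / M := by
    have : 1 / m - 1 / M = (M - m) / (m * M) := by field_simp
    rw [this, le_div_iff₀ (by positivity)]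
    have : m * M ≤ 1 := mul_le_one₀ (by linarith) hM0.le hM.le
    nlinarith
  linarith

end TwoMin

namespace TwoMin

variable {lam mu m M : ℝ}

theorem le (h : TwoMin lam mu m M) (hmu : lam ≤ mu) : m ≤ M := by
  obtain ⟨V, _, G, r, h1, h2⟩ := h
  obtain ⟨x, hx, hq⟩ := h2.att
  have := h1.low x
  rw [hx] at this
  linarith [qf_mono (G := G) hmu x]

theorem add_one_div_le {a b : ℝ} (ha : 1 ≤ a) (hab : a ≤ b) : a + 1 / a ≤ b + 1 / b := by
  have h : b + 1 / b - (a + 1 / a) = (b - a) * (a * b - 1) / (a * b) := by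
    have : 0 < a := by linarith
    have : 0 < b := by linarith
    field_simp; ring
  have : 0 ≤ (b - a) * (a * b - 1) / (a * b) :=
    div_nonneg (mul_nonneg (by linarith) (by nlinarith)) (by nlinarith)
  linarith

theorem exists_start {s : ℝ} (hs : 1 < s) (hs6 : s ^ 2 + 1 ≤ s ^ 6) (hlam : lam = s + 1 / s)
    (hmu : lam ≤ mu) : ∃ m M, TwoMin lam mu m M ∧ 1 / s ≤ m ∧ m < 1 := by
  have hs0 : 0 < s := by linarith
  have hl : 1 < lam := by
    have : 0 < 1 / s := by positivity
    linarith
  have hl0 : 0 < lam := by linarith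
  have hu0 : 0 < mu := by linarith
  have h1 := single lam mu
  have hpos : ∀ x : ℝ, 1 < x → 0 < x - 1 / x := fun x hx => by
    have : 1 / x < 1 := by rw [div_lt_one (by linarith)]; exact hx
    linarith
  have hl' := hpos lam hl
  have hu' := hpos mu (hl.trans_le hmu)
  have h2 := h1.join h1 hl0 hu0
  have e1 : 1 / lam = s / (s ^ 2 + 1) := by rw [hlam]; field_simp
  have e2 : 1 / (lam - 1 / lam) = s * (s ^ 2 + 1) / (s ^ 4 + s ^ 2 + 1) := by
    rw [e1, hlam]
    have : s + 1 / s - s / (s ^ 2 + 1) = (s ^ 4 + s ^ 2 + 1) / (s * (s ^ 2 + 1)) := by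
      field_simp; ring
    rw [this, one_div_div]
  have hs3 : (0 : ℝ) < s ^ 4 + s ^ 2 + 1 := by positivity
  have hs4 : (0 : ℝ) < s ^ 2 + 1 := by positivity
  have up : ∀ b c : ℝ, s ≤ b → 1 < c → b + 1 / b ≤ c →
      lam ≤ c ∧ 1 / c ≤ 1 / lam ∧ 1 / (c - 1 / c) ≤ 1 / (lam - 1 / lam) := fun b c hb hc h => by
    have h3 : lam ≤ c := by rw [hlam]; exact (add_one_div_le hs.le hb).trans h
    have h4 : 1 / c ≤ 1 / lam := one_div_le_one_div_of_le hl0 h3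
    exact ⟨h3, h4, one_div_le_one_div_of_le hl' (by linarith)⟩
  have lo : ∀ b c : ℝ, 1 ≤ b → b ≤ s → 1 < c → c ≤ b + 1 / b →
      1 / lam ≤ 1 / c ∧ 1 / (lam - 1 / lam) ≤ 1 / (c - 1 / c) := fun b c hb1 hb hc h => by
    have h3 : c ≤ lam := by rw [hlam]; exact h.trans (add_one_div_le hb1 hb)
    have h4 : 1 / lam ≤ 1 / c := one_div_le_one_div_of_le (by linarith) h3
    exact ⟨h4, one_div_le_one_div_of_le (hpos c hc) (by linarith)⟩
  by_cases c1 : s ≤ 1.32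
  · refine ⟨_, _, h2.join h2 hl' hu', ?_, ?_⟩
    · rw [e2, e1, hlam, ← sub_nonneg]
      have : s + 1 / s - s / (s ^ 2 + 1) - s * (s ^ 2 + 1) / (s ^ 4 + s ^ 2 + 1) - 1 / s =
          s * (s ^ 6 - s ^ 2 - 1) / ((s ^ 2 + 1) * (s ^ 4 + s ^ 2 + 1)) := by
        field_simp; ring
      rw [this]
      apply div_nonneg (mul_nonneg hs0.le (by linarith)) (by positivity)
    · obtain ⟨u1, u2, u3⟩ := up 1.32 2.0776 (by assumption) (by norm_num) (by norm_num)
      norm_num at u2 u3 ⊢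
      linarith
  by_cases c2 : s ≤ 1.45
  · refine ⟨_, _, (h1.join h2 hl' hu').join h2 hl' hu', ?_, ?_⟩
    · obtain ⟨l1, l2⟩ := lo 1.32 2.0775 (by norm_num) (by linarith) (by norm_num) (by norm_num)
      norm_num at l1 l2 ⊢
      norm_num at hlam
      linarith
    · obtain ⟨u1, u2, u3⟩ := up 1.45 2.1397 (by assumption) (by norm_num) (by norm_num)
      norm_num at u2 u3 ⊢
      linarith
  by_cases c3 : s ≤ 1.7
  · refine ⟨_, _, h1.pendants hl0 hu0 3, ?_, ?_⟩
    · obtain ⟨l1, l2⟩ := lo 1.45 2.1396 (by norm_num) (by linarith) (by norm_num) (by norm_num)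
      norm_num at l1 l2 ⊢
      rw [div_eq_mul_inv]
      norm_num at hlam
      linarith
    · obtain ⟨u1, u2, u3⟩ := up 1.7 2.2883 (by assumption) (by norm_num) (by norm_num)
      norm_num at u2 u3 ⊢
      rw [div_eq_mul_inv]
      linarith
  by_cases c4 : s ≤ 1.76
  · refine ⟨_, _, (h1.join h2 hl' hu').pendants hl0 hu0 2, ?_, ?_⟩
    · obtain ⟨l1, l2⟩ := lo 1.7 2.2882 (by norm_num) (by linarith) (by norm_num) (by norm_num)
      norm_num at l1 l2 ⊢
      rw [div_eq_mul_inv]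
      norm_num at hlam
      linarith
    · obtain ⟨u1, u2, u3⟩ := up 1.76 2.3282 (by assumption) (by norm_num) (by norm_num)
      norm_num at u2 u3 ⊢
      rw [div_eq_mul_inv]
      linarith
  obtain ⟨j, hj1, hj2⟩ := exists_pendants (x := lam) (by linarith) hlam (by linarith)
  exact ⟨_, _, h1.pendants hl0 hu0 j, hj1, hj2⟩

end TwoMin

theorem exists_separating {s lam mu : ℝ} (hs : 1 < s) (hs6 : s ^ 2 + 1 ≤ s ^ 6)
    (hlam : lam = s + 1 / s) (hmu : lam < mu) :
    ∃ (V : Type) (_ : Fintype V) (G : SimpleGraph V),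
      (∃ x, qf G lam x < 0) ∧ ∀ x, 0 ≤ qf G mu x := by
  by_contra hcon
  have hl : 1 < lam := by
    have : 0 < 1 / s := by positivity
    linarith
  have key : ∀ k : ℕ, ∃ m M, TwoMin lam mu m M ∧ 1 / s ≤ m ∧ m < 1 ∧ M < 1 ∧
      m + k * (mu - lam) ≤ M := by
    intro k
    induction k with
    | zero =>
      obtain ⟨m, M, h, h1, h2⟩ := TwoMin.exists_start hs hs6 hlam hmu.le
      refine ⟨m, M, h, h1, h2, ?_, by simpa using h.le hmu.le⟩
      by_contra hM
      exact hcon (h.separate hl (hl.trans hmu) h2 (not_lt.1 hM))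
    | succ k ih =>
      obtain ⟨m, M, h, h1, h2, h3, h4⟩ := ih
      obtain ⟨m', M', h', h1', h2', h4'⟩ : ∃ m' M', TwoMin lam mu m' M' ∧ 1 / s ≤ m' ∧ m' < 1 ∧
          m' + (mu - lam) + (M - m) ≤ M' := by
        rcases le_total s 1.76 with hc | hc
        · exact h.clique_step hs hc hlam hmu.le h1 (h.le hmu.le) h3
        · exact h.pendant_step hc hlam hmu.le h1 (h.le hmu.le) h3
      refine ⟨m', M', h', h1', h2', ?_, by push_cast; linarith⟩
      by_contra hM
      exact hcon (h'.separate hl (hl.trans hmu) h2' (not_lt.1 hM))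
  obtain ⟨k, hk⟩ := exists_nat_gt (1 / (mu - lam))
  rw [div_lt_iff₀ (sub_pos.2 hmu)] at hk
  obtain ⟨m, M, -, h1, h2, h3, h4⟩ := key k
  have : 0 < 1 / s := by positivity
  linarith

section Bridge

set_option linter.unusedSectionVars false

variable {V W : Type*} [Fintype V] [Fintype W]

theorem qf_eq_dotProduct (G : SimpleGraph V) (lam : ℝ) (x : V → ℝ) :
    qf G lam x = x ⬝ᵥ (lam • (1 : Matrix V V ℝ) + adjMat G).mulVec x := by
  simp only [Matrix.add_mulVec, Matrix.smul_mulVec, Matrix.one_mulVec, dotProduct_add,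
    dotProduct_smul, smul_eq_mul]
  unfold qf
  simp only [dotProduct, Matrix.mulVec, Finset.mul_sum, pow_two]
  congr 1
  exact Finset.sum_congr rfl fun v _ => Finset.sum_congr rfl fun w _ => by ring

theorem isHermitian_adjMat (G : SimpleGraph V) : (adjMat G).IsHermitian := by
  ext i j
  simp [adjMat, Matrix.conjTranspose_apply, G.adj_comm]

theorem forall_eigenvalue_iff (G : SimpleGraph V) (lam : ℝ) :
    (∀ μ : ℝ, IsEigenvalue (adjMat G) μ → -lam ≤ μ) ↔ ∀ x, 0 ≤ qf G lam x := by
  have hH : (lam • (1 : Matrix V V ℝ) + adjMat G).IsHermitian :=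
    Matrix.IsHermitian.add (by ext i j; simp [Matrix.one_apply, eq_comm]) (isHermitian_adjMat G)
  constructor
  · intro h x
    have hp : (lam • (1 : Matrix V V ℝ) + adjMat G).PosSemidef := by
      refine hH.posSemidef_iff_eigenvalues_nonneg.2 fun i => ?_
      have hv := hH.mulVec_eigenvectorBasis i
      have := h (hH.eigenvalues i - lam) ⟨(hH.eigenvectorBasis i).ofLp, ?_, ?_⟩
      · simpa using this
      · intro h0
        have := (hH.eigenvectorBasis).orthonormal.ne_zero i
        exact this (by ext j; exact congrFun h0 j)
      · rw [Matrix.add_mulVec, Matrix.smul_mulVec, Matrix.one_mulVec] at hv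
        rw [sub_smul, ← hv]
        simp
    rw [qf_eq_dotProduct]
    simpa using hp.dotProduct_mulVec_nonneg x
  · rintro h μ ⟨v, hv, hA⟩
    have := h v
    rw [qf_eq_dotProduct, Matrix.add_mulVec, Matrix.smul_mulVec, Matrix.one_mulVec, hA, ← add_smul,
      dotProduct_smul, smul_eq_mul] at this
    have hpos : 0 < v ⬝ᵥ v := by
      have h0 : v ⬝ᵥ v ≠ 0 := fun h0 => hv (dotProduct_self_eq_zero.1 h0)
      exact lt_of_le_of_ne (Finset.sum_nonneg fun i _ => mul_self_nonneg _) h0.symm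
    nlinarith

/-- Push a vector forward along an embedding, extending by zero. -/
noncomputable def pushVec (f : V ↪ W) (x : V → ℝ) : W → ℝ :=
  fun w => ∑ v, if f v = w then x v else 0

theorem pushVec_apply (f : V ↪ W) (x : V → ℝ) (v : V) : pushVec f x (f v) = x v := by
  simp [pushVec, f.injective.eq_iff]

theorem pushVec_eq_zero (f : V ↪ W) (x : V → ℝ) {w : W} (hw : w ∉ Set.range f) :
    pushVec f x w = 0 :=
  Finset.sum_eq_zero fun v _ => if_neg fun h => hw ⟨v, h⟩

theorem sum_of_forall_notMem_range (f : V ↪ W) (g : W → ℝ) (h : ∀ w ∉ Set.range f, g w = 0) :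
    ∑ w, g w = ∑ v, g (f v) := by
  rw [← Finset.sum_map Finset.univ f g]
  refine (Finset.sum_subset (Finset.subset_univ _) fun w _ hw => h w fun ⟨v, hv⟩ => hw ?_).symm
  exact Finset.mem_map.2 ⟨v, Finset.mem_univ _, hv⟩

theorem qf_of_embedding {G : SimpleGraph V} {H : SimpleGraph W} (f : G ↪g H) (lam : ℝ) (y : W → ℝ)
    (hy : ∀ w ∉ Set.range f, y w = 0) : qf H lam y = qf G lam fun v => y (f v) := by
  unfold qf
  have e : ∀ g : W → ℝ, (∀ w ∉ Set.range f, g w = 0) → ∑ w, g w = ∑ v, g (f v) :=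
    sum_of_forall_notMem_range f.toEmbedding
  rw [e (fun w => y w ^ 2) fun w hw => by simp [hy w hw],
    e (fun w => ∑ u, adjMat H w u * (y w * y u)) fun w hw => by simp [hy w hw]]
  congr 1
  refine Finset.sum_congr rfl fun v _ => ?_
  rw [e (fun u => adjMat H (f v) u * (y (f v) * y u)) fun w hw => by simp [hy w hw]]
  refine Finset.sum_congr rfl fun u _ => ?_
  simp [adjMat]

theorem qf_pushVec {G : SimpleGraph V} {H : SimpleGraph W} (f : G ↪g H) (lam : ℝ) (x : V → ℝ) :
    qf H lam (pushVec f.toEmbedding x) = qf G lam x := by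
  rw [qf_of_embedding f lam _ fun w hw => pushVec_eq_zero _ _ hw]
  congr 1
  ext v
  exact pushVec_apply f.toEmbedding x v

theorem qf_nonneg_of_embedding {G : SimpleGraph V} {H : SimpleGraph W} (f : G ↪g H) {lam : ℝ}
    (h : ∀ x, 0 ≤ qf H lam x) (x : V → ℝ) : 0 ≤ qf G lam x :=
  qf_pushVec f lam x ▸ h _

end Bridge

theorem not_hasFiniteForbiddenCharacterization {s lam : ℝ} (hs : 1 < s) (hs6 : s ^ 2 + 1 ≤ s ^ 6)
    (hlam : lam = s + 1 / s) :
    ¬ HasFiniteForbiddenCharacterization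
      (fun _ G => ∀ μ : ℝ, IsEigenvalue (adjMat G) μ → -lam ≤ μ) := by
  rintro ⟨k, N, F, hF⟩
  simp only [forall_eigenvalue_iff] at hF
  have hneg : ∀ i, ∃ x, qf (F i) lam x < 0 := fun i => by
    by_contra! h
    exact ((hF _ (F i)).1 h i).elim SimpleGraph.Embedding.refl
  have heps : ∀ i, ∃ e > 0, ∀ d ≤ e, ∃ x, qf (F i) (lam + d) x < 0 := fun i => by
    obtain ⟨x, hx⟩ := hneg i
    have hS : 0 ≤ ∑ v, x v ^ 2 := Finset.sum_nonneg fun v _ => sq_nonneg (x v)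
    refine ⟨-qf (F i) lam x / (2 * (∑ v, x v ^ 2 + 1)), by
      apply div_pos <;> linarith, fun d hd => ⟨x, ?_⟩⟩
    rw [qf_add_lam]
    rw [le_div_iff₀ (by linarith)] at hd
    nlinarith
  choose e he0 he using heps
  obtain ⟨d, hd0, hd⟩ : ∃ d > 0, ∀ i, d ≤ e i := by
    rcases isEmpty_or_nonempty (Fin k) with h | h
    · exact ⟨1, one_pos, fun i => h.elim i⟩
    · obtain ⟨i, hi⟩ := Finite.exists_min e
      exact ⟨e i, he0 i, hi⟩
  obtain ⟨V, _, G, ⟨x, hx⟩, hG⟩ := exists_separating (mu := lam + d) hs hs6 hlam (by linarith)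
  let E := Fintype.equivFin V
  let ψ : G ≃g G.map E.toEmbedding := SimpleGraph.Iso.map E G
  have hbad : ¬ ∀ y, 0 ≤ qf (G.map E.toEmbedding) lam y := fun h =>
    absurd (qf_nonneg_of_embedding ψ.toEmbedding h x) (not_le.2 hx)
  rw [hF] at hbad
  push Not at hbad
  obtain ⟨i, ⟨f⟩⟩ := hbad
  obtain ⟨y, hy⟩ := he i d (hd i)
  exact absurd (qf_nonneg_of_embedding (f.trans ψ.symm.toEmbedding) hG y) (not_le.2 hy)

/-- A bound on the size of minimal non-members yields a finite characterization. -/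
theorem hasFiniteForbiddenCharacterization_of_bound {lam : ℝ} (N : ℕ)
    (h : ∀ (n : ℕ) (G : SimpleGraph (Fin n)), (∃ x, qf G lam x < 0) →
      ∃ x, qf G lam x < 0 ∧ (Finset.univ.filter fun v => x v ≠ 0).card ≤ N) :
    HasFiniteForbiddenCharacterization
      (fun _ G => ∀ μ : ℝ, IsEigenvalue (adjMat G) μ → -lam ≤ μ) := by
  let T := Σ m : Fin (N + 1), {H : SimpleGraph (Fin m) // ∃ x, qf H lam x < 0}
  let E := Fintype.equivFin T
  refine ⟨Fintype.card T, fun i => (E.symm i).1, fun i => (E.symm i).2.1, fun n G => ?_⟩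
  simp only [forall_eigenvalue_iff]
  constructor
  · intro hG i
    refine ⟨fun f => ?_⟩
    obtain ⟨x, hx⟩ := (E.symm i).2.2
    exact absurd (qf_nonneg_of_embedding f hG x) (not_le.2 hx)
  · intro hG
    by_contra! hcon
    obtain ⟨x, hx, hcard⟩ := h n G hcon
    set S := Finset.univ.filter fun v => x v ≠ 0 with hS
    let g : Fin S.card ↪ Fin n := S.orderEmbOfFin rfl |>.toEmbedding
    let f : G.comap g ↪g G := SimpleGraph.Embedding.comap g G
    have hneg : qf (G.comap g) lam (fun v => x (g v)) < 0 := by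
      have := qf_of_embedding f lam x fun w hw => ?_
      · exact this ▸ hx
      · by_contra h0
        refine hw ?_
        have : w ∈ Set.range (S.orderEmbOfFin rfl) := by
          rw [Finset.range_orderEmbOfFin]
          simpa [hS] using h0
        exact this
    have key : ∀ t : T, IsEmpty (t.2.1 ↪g G) := fun t => by
      have := hG (E t)
      rwa [E.symm_apply_apply] at this
    exact (key ⟨⟨S.card, by omega⟩, ⟨G.comap g, _, hneg⟩⟩).elim f

section Obstructions

variable {V : Type} (G : SimpleGraph V)

/-- Obstructions inside `W` for a pair of units whose neighbourhoods are `D` and `E`. -/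
inductive PairCore (D E W : Set V) : Prop
  | c5 (y w : V) (hy : y ∈ W) (hw : w ∈ W) (yD : y ∈ D) (yE : y ∈ E) (wD : w ∈ D) (wE : w ∉ E)
      (wy : ¬ G.Adj w y)
  | c68 (y z : V) (hy : y ∈ W) (hz : z ∈ W) (yD : y ∈ D) (yE : y ∈ E) (zD : z ∈ D) (zE : z ∈ E)
      (yz : y ≠ z)
  | c7 (y w : V) (hy : y ∈ W) (hw : w ∈ W) (yD : y ∈ D) (yE : y ∈ E) (wD : w ∉ D) (wE : w ∉ E)
      (wy : G.Adj w y)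
  | c10 (y z w : V) (hy : y ∈ W) (hz : z ∈ W) (hw : w ∈ W) (yD : y ∈ D) (yE : y ∉ E) (zD : z ∉ D)
      (zE : z ∈ E) (wD : w ∉ D) (wE : w ∉ E) (yz : G.Adj y z) (wz : G.Adj w z) (wy : ¬ G.Adj w y)
  | c11 (y z x : V) (hy : y ∈ W) (hz : z ∈ W) (hx : x ∈ W) (yD : y ∈ D) (yE : y ∉ E) (zD : z ∉ D)
      (zE : z ∈ E) (xD : x ∉ D) (xE : x ∈ E) (yz : G.Adj y z) (xy : G.Adj x y) (xz : G.Adj x z)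
  | c12 (a b p q : V) (ha : a ∈ W) (hb : b ∈ W) (hp : p ∈ W) (hq : q ∈ W) (aD : a ∈ D) (aE : a ∉ E)
      (bD : b ∉ D) (bE : b ∈ E) (pD : p ∉ D) (pE : p ∉ E) (qD : q ∉ D) (qE : q ∉ E)
      (ab : ¬ G.Adj a b) (pa : G.Adj p a) (pb : G.Adj p b) (qa : G.Adj q a) (qb : G.Adj q b)
      (pq : G.Adj p q)
  | c13 (a b p w : V) (ha : a ∈ W) (hb : b ∈ W) (hp : p ∈ W) (hw : w ∈ W) (aD : a ∈ D) (aE : a ∉ E)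
      (bD : b ∉ D) (bE : b ∈ E) (pD : p ∉ D) (pE : p ∉ E) (wD : w ∉ D) (wE : w ∉ E)
      (ab : ¬ G.Adj a b) (pa : G.Adj p a) (pb : G.Adj p b) (wp : G.Adj w p)
      (wa : ¬ G.Adj w a) (wb : ¬ G.Adj w b)

/-- Obstructions inside `W` for a root whose neighbourhood is `R`. -/
inductive RootCore (R W : Set V) : Prop
  | c1 (a b c : V) (ha : a ∈ W) (hb : b ∈ W) (hc : c ∈ W) (aR : a ∈ R) (bR : b ∈ R) (cR : c ∉ R)
      (ab : ¬ G.Adj a b) (ca : G.Adj c a) (cb : ¬ G.Adj c b)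
  | c2 (a b c : V) (ha : a ∈ W) (hb : b ∈ W) (hc : c ∈ W) (aR : a ∈ R) (bR : b ∈ R) (cR : c ∉ R)
      (ne : a ≠ b) (ab : ¬ G.Adj a b) (ca : G.Adj c a) (cb : G.Adj c b)
  | c3 (a b c : V) (ha : a ∈ W) (hb : b ∈ W) (hc : c ∈ W) (aR : a ∈ R) (bR : b ∈ R) (cR : c ∈ R)
      (nab : a ≠ b) (nac : a ≠ c) (nbc : b ≠ c)
      (ab : ¬ G.Adj a b) (ac : ¬ G.Adj a c) (bc : ¬ G.Adj b c)
  | c4 (a b c : V) (ha : a ∈ W) (hb : b ∈ W) (hc : c ∈ W) (aR : a ∈ R) (bR : b ∈ R) (cR : c ∈ R)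
      (ab : ¬ G.Adj a b) (ac : ¬ G.Adj a c) (bc : G.Adj b c)
  | pair (a b : V) (ha : a ∈ W) (hb : b ∈ W) (aR : a ∈ R) (bR : b ∈ R) (ab : G.Adj a b)
      (h : PairCore G {x | G.Adj a x} {x | G.Adj b x} (W \ R))
  | triple (a b c y : V) (ha : a ∈ W) (hb : b ∈ W) (hc : c ∈ W) (hy : y ∈ W) (aR : a ∈ R)
      (bR : b ∈ R) (cR : c ∈ R) (yR : y ∉ R) (ab : G.Adj a b) (ac : G.Adj a c) (bc : G.Adj b c)
      (ay : G.Adj a y) (yb : G.Adj b y) (yc : G.Adj c y)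

/-- Obstructions reached from the root by a path of `n` vertices. -/
inductive RBad : ℕ → Set V → Set V → Prop
  | core {R W : Set V} (h : RootCore G R W) : RBad 0 R W
  | shift {n : ℕ} {R W : Set V} (a : V) (ha : a ∈ W) (aR : a ∈ R)
      (h : RBad n {x | G.Adj a x} (W \ R)) : RBad (n + 1) R W

variable {G} {D E R W Z : Set V}

theorem PairCore.mono (h : PairCore G D E W) (hWZ : W ⊆ Z) : PairCore G D E Z := by
  cases h
  case c5 y w hy hw yD yE wD wE wy => exact .c5 y w (hWZ hy) (hWZ hw) yD yE wD wE wy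
  case c68 y z hy hz yD yE zD zE yz => exact .c68 y z (hWZ hy) (hWZ hz) yD yE zD zE yz
  case c7 y w hy hw yD yE wD wE wy => exact .c7 y w (hWZ hy) (hWZ hw) yD yE wD wE wy
  case c10 y z w hy hz hw yD yE zD zE wD wE yz wz wy =>
    exact .c10 y z w (hWZ hy) (hWZ hz) (hWZ hw) yD yE zD zE wD wE yz wz wy
  case c11 y z x hy hz hx yD yE zD zE xD xE yz xy xz =>
    exact .c11 y z x (hWZ hy) (hWZ hz) (hWZ hx) yD yE zD zE xD xE yz xy xz
  case c12 a b p q ha hb hp hq aD aE bD bE pD pE qD qE ab pa pb qa qb pq =>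
    exact .c12 a b p q (hWZ ha) (hWZ hb) (hWZ hp) (hWZ hq) aD aE bD bE pD pE qD qE ab pa pb qa qb pq
  case c13 a b p w ha hb hp hw aD aE bD bE pD pE wD wE ab pa pb wp wa wb =>
    exact .c13 a b p w (hWZ ha) (hWZ hb) (hWZ hp) (hWZ hw) aD aE bD bE pD pE wD wE ab pa pb wp wa wb

theorem PairCore.exists_small (h : PairCore G D E W) :
    ∃ X ⊆ W, X.Finite ∧ X.ncard ≤ 4 ∧ PairCore G D E X := by
  have fin : ∀ a b c d : V, ({a, b, c, d} : Set V).Finite := fun a b c d => Set.toFinite _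
  have card : ∀ a b c d : V, ({a, b, c, d} : Set V).ncard ≤ 4 := fun a b c d =>
    (Set.ncard_insert_le _ _).trans <| Nat.succ_le_succ <| (Set.ncard_insert_le _ _).trans <|
      Nat.succ_le_succ <| (Set.ncard_insert_le _ _).trans <| by simp
  cases h
  case c5 y w hy hw yD yE wD wE wy =>
    refine ⟨{y, w, y, w}, ?_, fin .., card .., .c5 y w ?_ ?_ yD yE wD wE wy⟩ <;> grind
  case c68 y z hy hz yD yE zD zE yz =>
    refine ⟨{y, z, y, z}, ?_, fin .., card .., .c68 y z ?_ ?_ yD yE zD zE yz⟩ <;> grind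
  case c7 y w hy hw yD yE wD wE wy =>
    refine ⟨{y, w, y, w}, ?_, fin .., card .., .c7 y w ?_ ?_ yD yE wD wE wy⟩ <;> grind
  case c10 y z w hy hz hw yD yE zD zE wD wE yz wz wy =>
    refine ⟨{y, z, w, y}, ?_, fin .., card .., .c10 y z w ?_ ?_ ?_ yD yE zD zE wD wE yz wz wy⟩ <;>
      grind
  case c11 y z x hy hz hx yD yE zD zE xD xE yz xy xz =>
    refine ⟨{y, z, x, y}, ?_, fin .., card .., .c11 y z x ?_ ?_ ?_ yD yE zD zE xD xE yz xy xz⟩ <;>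
      grind
  case c12 a b p q ha hb hp hq aD aE bD bE pD pE qD qE ab pa pb qa qb pq =>
    refine ⟨{a, b, p, q}, ?_, fin .., card .., .c12 a b p q ?_ ?_ ?_ ?_ aD aE bD bE pD pE qD qE ab
      pa pb qa qb pq⟩ <;> grind
  case c13 a b p w ha hb hp hw aD aE bD bE pD pE wD wE ab pa pb wp wa wb =>
    refine ⟨{a, b, p, w}, ?_, fin .., card .., .c13 a b p w ?_ ?_ ?_ ?_ aD aE bD bE pD pE wD wE ab
      pa pb wp wa wb⟩ <;> grind

theorem RootCore.mono (h : RootCore G R W) (hWZ : W ⊆ Z) : RootCore G R Z := by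
  cases h
  case c1 a b c ha hb hc aR bR cR ab ca cb =>
    exact .c1 a b c (hWZ ha) (hWZ hb) (hWZ hc) aR bR cR ab ca cb
  case c2 a b c ha hb hc aR bR cR ne ab ca cb =>
    exact .c2 a b c (hWZ ha) (hWZ hb) (hWZ hc) aR bR cR ne ab ca cb
  case c3 a b c ha hb hc aR bR cR n1 n2 n3 ab ca cb =>
    exact .c3 a b c (hWZ ha) (hWZ hb) (hWZ hc) aR bR cR n1 n2 n3 ab ca cb
  case c4 a b c ha hb hc aR bR cR ab ca cb =>
    exact .c4 a b c (hWZ ha) (hWZ hb) (hWZ hc) aR bR cR ab ca cb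
  case pair a b ha hb aR bR ab h =>
    exact .pair a b (hWZ ha) (hWZ hb) aR bR ab (h.mono (Set.sdiff_subset_sdiff_left hWZ))
  case triple a b c y ha hb hc hy aR bR cR yR ab ac bc ay yb yc =>
    exact .triple a b c y (hWZ ha) (hWZ hb) (hWZ hc) (hWZ hy) aR bR cR yR ab ac bc ay yb yc

theorem RootCore.exists_small (h : RootCore G R W) :
    ∃ X ⊆ W, X.Finite ∧ X.ncard ≤ 6 ∧ RootCore G R X := by
  have fin : ∀ a b c d : V, ({a, b, c, d} : Set V).Finite := fun a b c d => Set.toFinite _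
  have card : ∀ a b c d : V, ({a, b, c, d} : Set V).ncard ≤ 6 := fun a b c d =>
    (Set.ncard_insert_le _ _).trans <| Nat.succ_le_succ <| (Set.ncard_insert_le _ _).trans <|
      Nat.succ_le_succ <| (Set.ncard_insert_le _ _).trans <| by simp
  cases h
  case c1 a b c ha hb hc aR bR cR ab ca cb =>
    refine ⟨{a, b, c, a}, ?_, fin .., card .., .c1 a b c ?_ ?_ ?_ aR bR cR ab ca cb⟩ <;> grind
  case c2 a b c ha hb hc aR bR cR ne ab ca cb =>
    refine ⟨{a, b, c, a}, ?_, fin .., card .., .c2 a b c ?_ ?_ ?_ aR bR cR ne ab ca cb⟩ <;> grind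
  case c3 a b c ha hb hc aR bR cR n1 n2 n3 ab ca cb =>
    refine ⟨{a, b, c, a}, ?_, fin .., card .., .c3 a b c ?_ ?_ ?_ aR bR cR n1 n2 n3 ab ca cb⟩ <;>
      grind
  case c4 a b c ha hb hc aR bR cR ab ca cb =>
    refine ⟨{a, b, c, a}, ?_, fin .., card .., .c4 a b c ?_ ?_ ?_ aR bR cR ab ca cb⟩ <;> grind
  case pair a b ha hb aR bR ab h =>
    obtain ⟨X, hX, hf, hc, h⟩ := h.exists_small
    refine ⟨insert a (insert b X), ?_, (hf.insert _).insert _, ?_, .pair a b ?_ ?_ aR bR ab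
      (h.mono ?_)⟩
    · grind
    · have := Set.ncard_insert_le a (insert b X)
      have := Set.ncard_insert_le b X
      omega
    all_goals grind
  case triple a b c y ha hb hc hy aR bR cR yR ab ac bc ay yb yc =>
    refine ⟨{a, b, c, y}, ?_, fin .., card .., .triple a b c y ?_ ?_ ?_ ?_ aR bR cR yR ab ac bc ay
      yb yc⟩ <;> grind

theorem RBad.mono {n : ℕ} (h : RBad G n R W) (hWZ : W ⊆ Z) : RBad G n R Z := by
  induction h generalizing Z with
  | core h => exact .core (h.mono hWZ)
  | shift a ha aR h ih => exact .shift a (hWZ ha) aR (ih (Set.sdiff_subset_sdiff_left hWZ))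

theorem RBad.exists_small {n : ℕ} (h : RBad G n R W) :
    ∃ X ⊆ W, X.Finite ∧ X.ncard ≤ n + 6 ∧ RBad G n R X := by
  induction h with
  | core h =>
    obtain ⟨X, hX, hf, hc, h⟩ := h.exists_small
    exact ⟨X, hX, hf, by omega, .core h⟩
  | @shift n R W a ha aR h ih =>
    obtain ⟨X, hX, hf, hc, h⟩ := ih
    refine ⟨insert a X, ?_, hf.insert _, ?_, .shift a (by simp) aR (h.mono ?_)⟩
    · grind
    · have := Set.ncard_insert_le a X
      omega
    · grind

/-- Long obstructions contain obstructions with any smaller number of path vertices. -/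
theorem RBad.truncate {n k : ℕ} (h : RBad G (n + k) R W) : ∃ R', ∃ W' ⊆ W, RBad G n R' W' := by
  induction k generalizing R W with
  | zero => exact ⟨R, W, subset_rfl, h⟩
  | succ k ih =>
    cases h with
    | shift a ha aR h =>
      obtain ⟨R', W', h1, h2⟩ := ih h
      exact ⟨R', W', h1.trans Set.sdiff_subset, h2⟩

theorem RootCore.closed (h : RootCore G R W) (h1 : R ∩ W ⊆ Z)
    (h2 : ∀ z ∈ Z, ∀ w ∈ W, G.Adj z w → w ∈ Z) : RootCore G R Z := by
  cases h
  case c1 a b c ha hb hc aR bR cR ab ca cb =>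
    exact .c1 a b c (h1 ⟨aR, ha⟩) (h1 ⟨bR, hb⟩) (h2 a (h1 ⟨aR, ha⟩) c hc ca.symm) aR bR cR ab ca cb
  case c2 a b c ha hb hc aR bR cR ne ab ca cb =>
    exact .c2 a b c (h1 ⟨aR, ha⟩) (h1 ⟨bR, hb⟩) (h2 a (h1 ⟨aR, ha⟩) c hc ca.symm) aR bR cR ne ab ca cb
  case c3 a b c ha hb hc aR bR cR n1 n2 n3 ab ca cb =>
    exact .c3 a b c (h1 ⟨aR, ha⟩) (h1 ⟨bR, hb⟩) (h1 ⟨cR, hc⟩) aR bR cR n1 n2 n3 ab ca cb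
  case c4 a b c ha hb hc aR bR cR ab ca cb =>
    exact .c4 a b c (h1 ⟨aR, ha⟩) (h1 ⟨bR, hb⟩) (h1 ⟨cR, hc⟩) aR bR cR ab ca cb
  case pair a b ha hb aR bR ab h =>
    have haZ := h1 ⟨aR, ha⟩
    have hbZ := h1 ⟨bR, hb⟩
    refine .pair a b haZ hbZ aR bR ab ?_
    have hA : ∀ w ∈ W \ R, G.Adj a w → w ∈ Z \ R := fun w hw h => ⟨h2 a haZ w hw.1 h, hw.2⟩
    have hB : ∀ w ∈ W \ R, G.Adj b w → w ∈ Z \ R := fun w hw h => ⟨h2 b hbZ w hw.1 h, hw.2⟩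
    have hC : ∀ z ∈ Z \ R, ∀ w ∈ W \ R, G.Adj w z → w ∈ Z \ R := fun z hz w hw h =>
      ⟨h2 z hz.1 w hw.1 h.symm, hw.2⟩
    cases h
    case c5 y w hy hw yD yE wD wE wy => exact .c5 y w (hA y hy yD) (hA w hw wD) yD yE wD wE wy
    case c68 y z hy hz yD yE zD zE yz => exact .c68 y z (hA y hy yD) (hA z hz zD) yD yE zD zE yz
    case c7 y w hy hw yD yE wD wE wy =>
      exact .c7 y w (hA y hy yD) (hC y (hA y hy yD) w hw wy) yD yE wD wE wy
    case c10 y z w hy hz hw yD yE zD zE wD wE yz wz wy =>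
      exact .c10 y z w (hA y hy yD) (hB z hz zE) (hC z (hB z hz zE) w hw wz) yD yE zD zE wD wE yz wz wy
    case c11 y z x hy hz hx yD yE zD zE xD xE yz xy xz =>
      exact .c11 y z x (hA y hy yD) (hB z hz zE) (hB x hx xE) yD yE zD zE xD xE yz xy xz
    case c12 a b p q ha hb hp hq aD aE bD bE pD pE qD qE ab pa pb qa qb pq =>
      exact .c12 a b p q (hA a ha aD) (hB b hb bE) (hC a (hA a ha aD) p hp pa)
        (hC a (hA a ha aD) q hq qa) aD aE bD bE pD pE qD qE ab pa pb qa qb pq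
    case c13 a b p w ha hb hp hw aD aE bD bE pD pE wD wE ab pa pb wp wa wb =>
      exact .c13 a b p w (hA a ha aD) (hB b hb bE) (hC a (hA a ha aD) p hp pa)
        (hC p (hC a (hA a ha aD) p hp pa) w hw wp) aD aE bD bE pD pE wD wE ab pa pb wp wa wb
  case triple a b c y ha hb hc hy aR bR cR yR ab ac bc ay yb yc =>
    exact .triple a b c y (h1 ⟨aR, ha⟩) (h1 ⟨bR, hb⟩) (h1 ⟨cR, hc⟩) (h2 a (h1 ⟨aR, ha⟩) y hy ay)
      aR bR cR yR ab ac bc ay yb yc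

/-- An obstruction is contained in the part of `W` reachable from the root. -/
theorem RBad.closed {n : ℕ} (h : RBad G n R W) (h1 : R ∩ W ⊆ Z)
    (h2 : ∀ z ∈ Z, ∀ w ∈ W, G.Adj z w → w ∈ Z) : RBad G n R Z := by
  induction h generalizing Z with
  | core h => exact .core (h.closed h1 h2)
  | @shift n R W a ha aR h ih =>
    have haZ := h1 ⟨aR, ha⟩
    exact .shift a haZ aR (ih (fun x hx => ⟨h2 a haZ x hx.2.1 hx.1, hx.2.2⟩)
      fun z hz w hw hzw => ⟨h2 z hz.1 w hw.1 hzw, hw.2⟩)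

end Obstructions

section Representation

variable {V ι : Type} (G : SimpleGraph V)

/-- No obstruction inside `W` for the units with neighbourhoods `D i`. -/
structure Clean (D : ι → Set V) (W : Set V) : Prop where
  root : ∀ i n, ¬ RBad G n (D i) W
  pair : ∀ i j, i ≠ j → ¬ PairCore G (D i) (D j) W
  triple : ∀ y ∈ W, ∀ i j k, y ∈ D i → y ∈ D j → y ∈ D k → i = j ∨ i = k ∨ j = k

/-- Every part of `W` is linked to some `D i`. -/
def Linked (D : ι → Set V) (W : Set V) : Prop :=
  ∀ S ⊆ W, S.Nonempty → (∀ x ∈ S, ∀ y ∈ W, G.Adj x y → y ∈ S) → ∃ x ∈ S, ∃ i, x ∈ D i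

/-- `W` has an integral representation in which the units are part of an orthonormal basis. -/
def Represented (D : ι → Set V) (W : Set V) : Prop :=
  ∃ (κ : Type) (_ : Fintype κ) (j : ι → κ) (ρ : V → κ → ℤ), Function.Injective j ∧
    (∀ x ∈ W, ∀ i, ρ x (j i) = if x ∈ D i then 1 else 0) ∧
    ∀ x ∈ W, ∀ y ∈ W,
      ∑ k, ρ x k * ρ y k = if x = y then 2 else if G.Adj x y then 1 else 0

/-- `x ∈ W` lies in exactly one of the sets `D i`. -/
def Single (D : ι → Set V) (W : Set V) (x : V) : Prop := x ∈ W ∧ ∃ i, x ∈ D i ∧ ∀ j, x ∈ D j → j = i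

/-- Two vertices have the same second coordinate up to sign. -/
def Twin (D : ι → Set V) (W : Set V) (x y : V) : Prop :=
  x = y ∨ Single D W x ∧ Single D W y ∧ ((∃ i, x ∈ D i ∧ y ∈ D i) ↔ ¬ G.Adj x y)

variable {G} {D : ι → Set V} {W : Set V} {x y z w : V}

theorem Clean.core (h : Clean G D W) (i : ι) : ¬ RootCore G (D i) W := fun h' =>
  h.root i 0 (.core h')

theorem Clean.double_adj (h : Clean G D W) {i j : ι} (hij : i ≠ j) (hy : y ∈ W) (yi : y ∈ D i)
    (yj : y ∈ D j) (hw : w ∈ W) (hyw : y ≠ w) :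
    (G.Adj y w ↔ (w ∈ D i ∨ w ∈ D j)) ∧ ¬ (w ∈ D i ∧ w ∈ D j) := by
  have h2 : ¬ (w ∈ D i ∧ w ∈ D j) := fun ⟨a, b⟩ => h.pair i j hij (.c68 y w hy hw yi yj a b hyw)
  refine ⟨⟨fun ha => ?_, fun ha => ?_⟩, h2⟩
  · by_contra! hn
    exact h.pair i j hij (.c7 y w hy hw yi yj hn.1 hn.2 ha.symm)
  · by_contra hn
    rcases ha with ha | ha
    · exact h.pair i j hij (.c5 y w hy hw yi yj ha (fun hb => h2 ⟨ha, hb⟩) fun h' => hn h'.symm)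
    · exact h.pair j i hij.symm (.c5 y w hy hw yj yi ha (fun hb => h2 ⟨hb, ha⟩) fun h' => hn h'.symm)

theorem Clean.petal_adj (h : Clean G D W) {i : ι} (hy : y ∈ W) (hz : z ∈ W) (hw : w ∈ W)
    (yi : y ∈ D i) (zi : z ∈ D i) (hyz : y ≠ z) (hn : ¬ G.Adj y z) (hwy : w ≠ y) (hwz : w ≠ z) :
    (G.Adj y w ↔ w ∈ D i) ∧ (G.Adj z w ↔ w ∈ D i) := by
  have hn' : ¬ G.Adj z y := fun h' => hn h'.symm
  have hc := h.core i
  by_cases wi : w ∈ D i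
  · by_cases a1 : G.Adj y w <;> by_cases a2 : G.Adj z w
    · simp [*]
    · exact absurd (.c4 z y w hz hy hw zi yi wi hn' a2 a1) hc
    · exact absurd (.c4 y z w hy hz hw yi zi wi hn a1 a2) hc
    · exact absurd (.c3 y z w hy hz hw yi zi wi hyz hwy.symm hwz.symm hn a1 a2) hc
  · by_cases a1 : G.Adj w y <;> by_cases a2 : G.Adj w z
    · exact absurd (.c2 y z w hy hz hw yi zi wi hyz hn a1 a2) hc
    · exact absurd (.c1 y z w hy hz hw yi zi wi hn a1 a2) hc
    · exact absurd (.c1 z y w hz hy hw zi yi wi hn' a2 a1) hc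
    · rw [G.adj_comm] at a1 a2
      simp [*]

theorem Clean.twin_trans_aux (h : Clean G D W) (hx : Single D W x) (hy : Single D W y)
    (hz : Single D W z) (hxy : x ≠ y) (hyz : y ≠ z) (hxz : x ≠ z) {i : ι} (xi : x ∈ D i)
    (yi : y ∈ D i) (hn : ¬ G.Adj x y) : ¬ Twin G D W y z := by
  rintro (h' | ⟨-, -, h'⟩)
  · exact hyz h'
  obtain ⟨h1, h2⟩ := h.petal_adj hx.1 hy.1 hz.1 xi yi hxy hn hxz.symm hyz.symm
  by_cases zi : z ∈ D i
  · exact h'.1 ⟨i, yi, zi⟩ (h2.2 zi)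
  · obtain ⟨j, yj, zj⟩ := h'.2 fun h' => zi (h2.1 h')
    obtain ⟨-, k, -, hk⟩ := hy
    rw [hk j yj, ← hk i yi] at zj
    exact zi zj

theorem Twin.symm (h : Twin G D W x y) : Twin G D W y x := by
  rcases h with h | ⟨hx, hy, h⟩
  · exact .inl h.symm
  · refine .inr ⟨hy, hx, ?_⟩
    rw [G.adj_comm, ← h]
    exact exists_congr fun i => and_comm

theorem Clean.outer_adj (h : Clean G D W) (hx : Single D W x) (hy : Single D W y) (hw : w ∈ W)
    (hxy : G.Adj x y) (hdis : ¬ ∃ i, x ∈ D i ∧ y ∈ D i)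
    (hxw : ¬ ∃ i, x ∈ D i ∧ w ∈ D i) (hyw : ¬ ∃ i, y ∈ D i ∧ w ∈ D i) (ha : G.Adj y w) :
    G.Adj x w := by
  by_contra hn
  obtain ⟨hx, i, xi, -⟩ := hx
  obtain ⟨hy, j, yj, -⟩ := hy
  have hij : i ≠ j := by
    rintro rfl
    exact hdis ⟨i, xi, yj⟩
  exact h.pair i j hij (.c10 x y w hx hy hw xi (fun h' => hdis ⟨j, h', yj⟩)
    (fun h' => hdis ⟨i, xi, h'⟩) yj (fun h' => hxw ⟨i, xi, h'⟩) (fun h' => hyw ⟨j, yj, h'⟩) hxy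
    ha.symm fun h' => hn h'.symm)

theorem Clean.twin_trans (h : Clean G D W) (h1 : Twin G D W x y) (h2 : Twin G D W y z) :
    Twin G D W x z := by
  by_cases hxy : x = y
  · exact hxy ▸ h2
  by_cases hyz : y = z
  · exact hyz ▸ h1
  by_cases hxz : x = z
  · exact .inl hxz
  have h1' := h1
  have h2' := h2
  obtain h1 | ⟨hx, hy, h1⟩ := h1
  · exact absurd h1 hxy
  obtain h2 | ⟨-, hz, h2⟩ := h2
  · exact absurd h2 hyz
  by_cases a1 : G.Adj x y
  swap
  · obtain ⟨i, xi, yi⟩ := h1.2 a1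
    exact absurd h2' (h.twin_trans_aux hx hy hz hxy hyz hxz xi yi a1)
  by_cases a2 : G.Adj y z
  swap
  · obtain ⟨i, yi, zi⟩ := h2.2 a2
    exact absurd h1'.symm (h.twin_trans_aux hz hy hx (Ne.symm hyz) (Ne.symm hxy) (Ne.symm hxz) zi yi
      fun h' => a2 h'.symm)
  have d1 : ¬ ∃ i, x ∈ D i ∧ y ∈ D i := fun h' => h1.1 h' a1
  have d2 : ¬ ∃ i, y ∈ D i ∧ z ∈ D i := fun h' => h2.1 h' a2
  have d3 : ¬ ∃ i, x ∈ D i ∧ z ∈ D i := by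
    rintro ⟨i, xi, zi⟩
    by_cases a3 : G.Adj x z
    · obtain ⟨-, j, yj, -⟩ := id hy
      have hij : j ≠ i := by
        rintro rfl
        exact d1 ⟨_, xi, yj⟩
      exact h.pair j i hij (.c11 y x z hy.1 hx.1 hz.1 yj (fun h' => d1 ⟨i, xi, h'⟩)
        (fun h' => d1 ⟨j, h', yj⟩) xi (fun h' => d2 ⟨j, yj, h'⟩) zi a1.symm a2.symm a3.symm)
    · have := (h.petal_adj hx.1 hz.1 hy.1 xi zi hxz a3 (Ne.symm hxy) hyz).1.1 a1
      exact d1 ⟨i, xi, this⟩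
  have a3 := h.outer_adj hx hy hz.1 a1 d1 d3 d2 a2
  exact .inr ⟨hx, hz, by simp [d3, a3]⟩

/-- Outer vertices do not distinguish twins. -/
theorem Clean.twin_adj (h : Clean G D W) (hxy : Twin G D W x y) (hw : w ∈ W)
    (hwD : ∀ i, w ∉ D i) : G.Adj x w ↔ G.Adj y w := by
  rcases hxy with rfl | ⟨hx, hy, hxy⟩
  · rfl
  by_cases hne : x = y
  · rw [hne]
  have hd : ∀ u, ¬ ∃ i, u ∈ D i ∧ w ∈ D i := fun u ⟨i, _, hi⟩ => hwD i hi
  by_cases a : G.Adj x y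
  · have d : ¬ ∃ i, x ∈ D i ∧ y ∈ D i := fun h' => hxy.1 h' a
    exact ⟨h.outer_adj hy hx hw a.symm (fun ⟨i, h1, h2⟩ => d ⟨i, h2, h1⟩) (hd y) (hd x),
      h.outer_adj hx hy hw a d (hd x) (hd y)⟩
  · obtain ⟨i, xi, yi⟩ := hxy.2 a
    have hwx : w ≠ x := fun h' => hwD i (h' ▸ xi)
    have hwy : w ≠ y := fun h' => hwD i (h' ▸ yi)
    obtain ⟨h1, h2⟩ := h.petal_adj hx.1 hy.1 hw xi yi hne a hwx hwy
    rw [h1, h2]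

theorem exists_other_of_not_single (hx : x ∈ W) {i : ι} (xi : x ∈ D i)
    (hs : ¬ Single D W x) : ∃ j, j ≠ i ∧ x ∈ D j := by
  by_contra! hn
  exact hs ⟨hx, i, xi, fun j hj => by_contra fun hji => hn j hji hj⟩

theorem Clean.no_pairCore (h : Clean G D W) {u v : V} (ha : u ∈ W) (hb : v ∈ W) {i j : ι}
    (hij : i ≠ j) (ai : u ∈ D i) (aj : u ∉ D j) (bj : v ∈ D j) (bi : v ∉ D i)
    (nadj : ¬ G.Adj u v) :
    ¬ PairCore G {x | G.Adj u x} {x | G.Adj v x} {x | x ∈ W ∧ ∀ i, x ∉ D i} := by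
  intro hc
  have nadj' : ¬ G.Adj v u := fun h' => nadj h'.symm
  cases hc
  case c5 y w hy hw yD yE wD wE wy =>
    exact h.root i 1 (.shift u ha ai (.core (.c1 y w v ⟨hy.1, hy.2 i⟩ ⟨hw.1, hw.2 i⟩ ⟨hb, bi⟩ yD wD
      nadj (fun h' => wy h'.symm) yE wE)))
  case c68 y z hy hz yD yE zD zE yz =>
    by_cases adj : G.Adj y z
    · exact h.pair i j hij (.c12 u v y z ha hb hy.1 hz.1 ai aj bi bj (hy.2 i) (hy.2 j) (hz.2 i)
        (hz.2 j) nadj yD.symm yE.symm zD.symm zE.symm adj)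
    · exact h.root i 1 (.shift u ha ai (.core (.c2 y z v ⟨hy.1, hy.2 i⟩ ⟨hz.1, hz.2 i⟩ ⟨hb, bi⟩ yD zD
        nadj yz adj yE zE)))
  case c7 y w hy hw yD yE wD wE wy =>
    exact h.pair i j hij (.c13 u v y w ha hb hy.1 hw.1 ai aj bi bj (hy.2 i) (hy.2 j) (hw.2 i)
        (hw.2 j) nadj yD.symm yE.symm wy (fun h' => wD h'.symm) fun h' => wE h'.symm)
  case c10 y z w hy hz hw yD yE zD zE wD wE yz wz wy =>
    exact h.root j 2 (.shift v hb bj (.shift z ⟨hz.1, hz.2 j⟩ zE (.core (.c1 y w u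
      ⟨⟨hy.1, hy.2 j⟩, yE⟩ ⟨⟨hw.1, hw.2 j⟩, wE⟩ ⟨⟨ha, aj⟩, nadj'⟩ yz.symm wz.symm
      (fun h' => zD h'.symm) (fun h' => wy h'.symm) yD wD))))
  case c11 y z x hy hz hx yD yE zD zE xD xE yz xy xz =>
    exact h.root j 1 (.shift v hb bj (.core (.pair z x ⟨hz.1, hz.2 j⟩ ⟨hx.1, hx.2 j⟩ zE xE xz.symm
      (.c7 y u ⟨⟨hy.1, hy.2 j⟩, yE⟩ ⟨⟨ha, aj⟩, nadj'⟩ yz.symm xy (fun h' => zD h'.symm)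
        (fun h' => xD h'.symm) yD))))
  case c12 a b p q ha' hb' hp hq aD aE bD bE pD pE qD qE ab pa pb qa qb pq =>
    exact h.root j 2 (.shift v hb bj (.shift b ⟨hb'.1, hb'.2 j⟩ bE (.core (.pair p q
      ⟨⟨hp.1, hp.2 j⟩, pE⟩ ⟨⟨hq.1, hq.2 j⟩, qE⟩ pb.symm qb.symm pq
      (.c7 a u ⟨⟨⟨ha'.1, ha'.2 j⟩, aE⟩, fun h' => ab h'.symm⟩ ⟨⟨⟨ha, aj⟩, nadj'⟩, fun h' => bD h'.symm⟩
        pa qa (fun h' => pD h'.symm) (fun h' => qD h'.symm) aD)))))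
  case c13 a b p w ha' hb' hp hw aD aE bD bE pD pE wD wE ab pa pb wp wa wb =>
    exact h.root j 3 (.shift v hb bj (.shift b ⟨hb'.1, hb'.2 j⟩ bE (.shift p ⟨⟨hp.1, hp.2 j⟩, pE⟩
      pb.symm (.core (.c1 a w u ⟨⟨⟨ha'.1, ha'.2 j⟩, aE⟩, fun h' => ab h'.symm⟩
        ⟨⟨⟨hw.1, hw.2 j⟩, wE⟩, fun h' => wb h'.symm⟩ ⟨⟨⟨ha, aj⟩, nadj'⟩, fun h' => bD h'.symm⟩
        pa wp.symm (fun h' => pD h'.symm) (fun h' => wa h'.symm) aD wD)))))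

theorem Clean.next (h : Clean G D W) {ι' : Type} (u : ι' → V) (hS : ∀ i, Single D W (u i))
    (hT : ∀ i j, i ≠ j → ¬ Twin G D W (u i) (u j)) :
    Clean G (fun i => {x | G.Adj (u i) x}) {x | x ∈ W ∧ ∀ i, x ∉ D i} := by
  have hsub : ∀ i, {x | x ∈ W ∧ ∀ i, x ∉ D i} ⊆ W \ D i := fun i x hx => ⟨hx.1, hx.2 i⟩
  have hne : ∀ i j, i ≠ j → u i ≠ u j := fun i j hij h' => hT i j hij (.inl h')
  have hdich : ∀ a b, a ≠ b → (∃ i, u a ∈ D i ∧ u b ∈ D i ∧ G.Adj (u a) (u b)) ∨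
      ∃ i j, i ≠ j ∧ u a ∈ D i ∧ u b ∈ D j ∧ u a ∉ D j ∧ u b ∉ D i ∧ ¬ G.Adj (u a) (u b) := by
    intro a b hab
    have h1 := hT a b hab
    simp only [Twin, hne a b hab, hS a, hS b, true_and, false_or] at h1
    obtain ⟨-, i, ai, hi⟩ := hS a
    obtain ⟨-, j, bj, hj⟩ := hS b
    by_cases hij : i = j
    · subst hij
      left
      refine ⟨i, ai, bj, ?_⟩
      by_contra hn
      exact h1 ⟨fun _ => hn, fun _ => ⟨i, ai, bj⟩⟩
    · right
      have hd : ¬ ∃ k, u a ∈ D k ∧ u b ∈ D k := fun ⟨k, h2, h3⟩ => hij ((hi k h2).symm.trans (hj k h3))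
      refine ⟨i, j, hij, ai, bj, fun h' => hd ⟨j, h', bj⟩, fun h' => hd ⟨i, ai, h'⟩, fun hn => h1 ?_⟩
      simp [hd, hn]
  refine ⟨fun i n hb => ?_, fun a b hab hc => ?_, fun y hy a b c ya yb yc => ?_⟩
  · obtain ⟨hW, k, hk, -⟩ := hS i
    exact h.root k (n + 1) (.shift (u i) hW hk (hb.mono (hsub k)))
  · have ha := (hS a).1
    have hb := (hS b).1
    rcases hdich a b hab with ⟨i, ai, bi, adj⟩ | ⟨i, j, hij, ai, bj, aj, bi, nadj⟩
    · exact h.core i (.pair (u a) (u b) ha hb ai bi adj (hc.mono (hsub i)))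
    exact h.no_pairCore ha hb hij ai aj bj bi nadj hc
  · by_contra! hn
    obtain ⟨hab, hac, hbc⟩ := hn
    have aux : ∀ p q r, p ≠ q → p ≠ r → q ≠ r → G.Adj (u p) y → G.Adj (u q) y → G.Adj (u r) y →
        (∃ i, u p ∈ D i ∧ u q ∈ D i ∧ G.Adj (u p) (u q)) → False := by
      rintro p q r hpq hpr hqr yp yq yr ⟨i, pi, qi, pq⟩
      by_cases ri : u r ∈ D i
      · exact h.core i (.triple (u p) (u q) (u r) y (hS p).1 (hS q).1 (hS r).1 hy.1 pi qi ri (hy.2 i)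
          pq (by rcases hdich p r hpr with ⟨-, -, -, h'⟩ | ⟨k, l, hkl, h1, h2, h3, h4, -⟩
                 · exact h'
                 · exact absurd (((hS p).2.choose_spec.2 k h1).trans
                     ((hS p).2.choose_spec.2 i pi).symm) fun hk => h4 (hk ▸ ri))
          (by rcases hdich q r hqr with ⟨-, -, -, h'⟩ | ⟨k, l, hkl, h1, h2, h3, h4, -⟩
              · exact h'
              · exact absurd (((hS q).2.choose_spec.2 k h1).trans
                     ((hS q).2.choose_spec.2 i qi).symm) fun hk => h4 (hk ▸ ri)) yp yq yr)
      · have hn : ∀ s, s ≠ r → u s ∈ D i → ¬ G.Adj (u s) (u r) := fun s hs si => by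
          rcases hdich s r hs with ⟨k, h1, h2, -⟩ | ⟨k, l, hkl, h1, h2, h3, h4, h5⟩
          · have := ((hS s).2.choose_spec.2 k h1).trans ((hS s).2.choose_spec.2 i si).symm
            exact absurd (this ▸ h2) ri
          · exact h5
        exact h.core i (.pair (u p) (u q) (hS p).1 (hS q).1 pi qi pq (.c7 y (u r) ⟨hy.1, hy.2 i⟩
          ⟨(hS r).1, ri⟩ yp yq (hn p hpr pi) (hn q hqr qi) yr))
    rcases hdich a b hab with h1 | ⟨i, j, hij, ai, bj, aj, bi, nab⟩
    · exact aux a b c hab hac hbc ya yb yc h1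
    rcases hdich a c hac with h1 | ⟨i', k, hik, ai', ck, ak, ci', nac⟩
    · exact aux a c b hac hab (Ne.symm hbc) ya yc yb h1
    rcases hdich b c hbc with h1 | ⟨j', k', hjk, bj', ck', bk', cj', nbc⟩
    · exact aux b c a hbc (Ne.symm hab) (Ne.symm hac) yb yc ya h1
    have ei : i' = i := ((hS a).2.choose_spec.2 i' ai').trans ((hS a).2.choose_spec.2 i ai).symm
    have ej : j' = j := ((hS b).2.choose_spec.2 j' bj').trans ((hS b).2.choose_spec.2 j bj).symm
    subst ei ej
    exact h.pair _ _ hij (.c13 (u a) (u b) y (u c) (hS a).1 (hS b).1 hy.1 (hS c).1 ai aj bi bj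
      (hy.2 _) (hy.2 _) ci' cj' nab (SimpleGraph.Adj.symm ya) (SimpleGraph.Adj.symm yb) yc
      (fun h' => nac h'.symm) fun h' => nbc h'.symm)

end Representation

section Representation

variable {V : Type} {G : SimpleGraph V}

theorem Clean.linked_next [Finite V] {ι : Type} {D : ι → Set V} {W : Set V} (h : Clean G D W)
    (hl : Linked G D W) {ι' : Type} (u : ι' → V)
    (hu : ∀ y, Single D W y → ∃ i, Twin G D W (u i) y) :
    Linked G (fun i => {x | G.Adj (u i) x}) {x | x ∈ W ∧ ∀ i, x ∉ D i} := by
  intro S hS hne hcl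
  by_contra! hno
  obtain ⟨x, hx, i, hi⟩ := hl S (fun x hx => (hS hx).1) hne fun x hx y hy hxy => by
    by_cases hyD : ∀ i, y ∉ D i
    · exact hcl x hx y ⟨hy, hyD⟩ hxy
    push Not at hyD
    obtain ⟨i, yi⟩ := hyD
    exfalso
    by_cases hs : Single D W y
    · obtain ⟨k, hk⟩ := hu y hs
      exact hno x hx k ((h.twin_adj hk (hS hx).1 (hS hx).2).2 hxy.symm)
    · obtain ⟨j, hj, yj⟩ := exists_other_of_not_single hy yi hs
      have := ((h.double_adj hj hy yj yi (hS hx).1 hxy.ne').1.1 hxy.symm)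
      exact this.elim ((hS hx).2 j) ((hS hx).2 i)
  exact (hS hx).2 i hi

/-- One step of the construction: extending a representation of the outer vertices. -/
theorem Clean.represented_step [Finite V] {ι : Type} [Finite ι] {D : ι → Set V} {W : Set V}
    (h : Clean G D W) (rep : V → V) (hrep : ∀ y, Twin G D W (rep y) y)
    (hrep' : ∀ y z, Twin G D W y z → rep y = rep z)
    (hr : Represented G (fun i : {u // Single D W u ∧ rep u = u} => {x | G.Adj i.1 x})
      {x | x ∈ W ∧ ∀ i, x ∉ D i}) : Represented G D W := by
  obtain ⟨κ, hκ, j, ρ, hj, h1, h2⟩ := hr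
  have := Fintype.ofFinite ι
  have hs : ∀ y, Single D W y → Single D W (rep y) ∧ rep (rep y) = rep y := fun y hy => by
    refine ⟨?_, hrep' _ _ (hrep y)⟩
    rcases hrep y with h' | h'
    · rwa [h']
    · exact h'.1
  let ε : V → ℤ := fun y => if (∃ i, rep y ∈ D i ∧ y ∈ D i) ∧ rep y ≠ y then -1 else 1
  let b : V → κ → ℤ := fun y k => if h : Single D W y then
    if k = j ⟨rep y, hs y h⟩ then ε y else 0 else if ∃ i, y ∈ D i then 0 else ρ y k
  have bS : ∀ y (h : Single D W y) k, b y k = if k = j ⟨rep y, hs y h⟩ then ε y else 0 :=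
    fun y h k => by simp only [b, dif_pos h]
  have bD : ∀ y, ¬ Single D W y → (∃ i, y ∈ D i) → ∀ k, b y k = 0 := fun y h h' k => by
    simp only [b, dif_neg h, if_pos h']
  have bO : ∀ y, (∀ i, y ∉ D i) → ∀ k, b y k = ρ y k := fun y h k => by
    have h3 : ¬ Single D W y := fun ⟨_, i, hi, _⟩ => h i hi
    have h4 : ¬ ∃ i, y ∈ D i := fun ⟨i, hi⟩ => h i hi
    simp only [b, dif_neg h3, if_neg h4]
  have hε : ∀ y, Single D W y → ε y = 1 ∨ ε y = -1 ∧ ∃ i, rep y ∈ D i ∧ y ∈ D i ∧ rep y ≠ y ∧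
      ¬ G.Adj (rep y) y := fun y hy => by
    by_cases hc : (∃ i, rep y ∈ D i ∧ y ∈ D i) ∧ rep y ≠ y
    · right
      refine ⟨if_pos hc, ?_⟩
      obtain ⟨⟨i, h3, h4⟩, h5⟩ := hc
      refine ⟨i, h3, h4, h5, ?_⟩
      rcases hrep y with h' | h'
      · exact absurd h' h5
      · exact h'.2.2.1 ⟨i, h3, h4⟩
    · exact .inl (if_neg hc)
  have twin : ∀ y z, rep y = rep z → Twin G D W y z := fun y z hyz =>
    h.twin_trans (hrep y).symm (hyz ▸ hrep z)
  let A : V → V → ℤ := fun y z =>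
    ∑ i : ι, (if y ∈ D i then 1 else 0) * (if z ∈ D i then 1 else 0)
  have AS : ∀ y z i, y ∈ D i → (∀ k, y ∈ D k → k = i) → A y z = if z ∈ D i then 1 else 0 :=
    fun y z i yi hi => by
      simp only [A]
      rw [Finset.sum_eq_single i]
      · simp [yi]
      · intro k _ hk
        rw [if_neg fun h' => hk (hi k h'), zero_mul]
      · simp
  have AD : ∀ y z i k, i ≠ k → y ∈ D i → y ∈ D k → (∀ l, y ∈ D l → l = i ∨ l = k) →
      A y z = (if z ∈ D i then 1 else 0) + if z ∈ D k then 1 else 0 := fun y z i k hik yi yk hl => by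
    simp only [A]
    rw [Finset.sum_eq_add i k hik]
    · simp [yi, yk]
    · rintro l - ⟨h3, h4⟩
      rw [if_neg fun h' => (hl l h').elim h3 h4, zero_mul]
    · simp
    · simp
  have AO : ∀ y z, (∀ i, y ∉ D i) → A y z = 0 := fun y z hy =>
    Finset.sum_eq_zero fun i _ => by rw [if_neg (hy i), zero_mul]
  have Acomm : ∀ y z, A y z = A z y := fun y z => Finset.sum_congr rfl fun i _ => mul_comm _ _
  have double : ∀ y ∈ W, ∀ z ∈ W, ¬ Single D W y → (∃ i, y ∈ D i) →
      A y z + ∑ k, b y k * b z k = if y = z then 2 else if G.Adj y z then 1 else 0 := by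
    rintro y hy z hz hns ⟨i, yi⟩
    obtain ⟨k, hk, yk⟩ := exists_other_of_not_single hy yi hns
    rw [AD y z i k hk.symm yi yk fun l hl => by
      have := h.triple y hy i k l yi yk hl
      grind]
    simp only [bD y hns ⟨i, yi⟩, zero_mul, Finset.sum_const_zero, add_zero]
    by_cases hyz : y = z
    · subst hyz
      simp [yi, yk]
    · obtain ⟨h3, h4⟩ := h.double_adj hk.symm hy yi yk hz hyz
      grind
  have outer : ∀ y ∈ W, ∀ z ∈ W, Single D W y → (∀ i, z ∉ D i) →
      A y z + ∑ k, b y k * b z k = if y = z then 2 else if G.Adj y z then 1 else 0 := by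
    intro y hy z hz hs' hzD
    have hyz : y ≠ z := by
      rintro rfl
      obtain ⟨-, i, hi, -⟩ := hs'
      exact hzD i hi
    rw [Acomm, AO z y hzD]
    simp only [bS y hs', bO z hzD, ite_mul, zero_mul, Finset.sum_ite_eq', Finset.mem_univ, if_true,
      zero_add, if_neg hyz]
    rw [h1 z ⟨hz, hzD⟩]
    simp only [Set.mem_ofPred_eq, h.twin_adj (hrep y) hz hzD]
    rcases hε y hs' with h3 | ⟨h3, i, h4, h5, h6, h7⟩
    · rw [h3, one_mul]
    · have hzr : z ≠ rep y := by
        rintro rfl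
        exact hzD i h4
      have := (h.petal_adj (hs y hs').1.1 hy hz h4 h5 h6 h7 hzr hyz.symm).2
      simp [this, hzD i]
  have single : ∀ y ∈ W, ∀ z ∈ W, Single D W y → Single D W z →
      A y z + ∑ k, b y k * b z k = if y = z then 2 else if G.Adj y z then 1 else 0 := by
    intro y hy z hz ys zs
    have hb : ∑ k, b y k * b z k = if rep y = rep z then ε y * ε z else 0 := by
      simp only [bS y ys, bS z zs, ite_mul, zero_mul, Finset.sum_ite_eq', Finset.mem_univ, if_true,
        mul_ite, mul_zero, hj.eq_iff, Subtype.mk.injEq, eq_comm (a := rep z)]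
    obtain ⟨-, i, yi, hi⟩ := id ys
    rw [hb, AS y z i yi hi]
    by_cases hyz : y = z
    · subst hyz
      rcases hε y ys with h3 | ⟨h3, -⟩ <;> simp [yi, h3]
    have hcommon : (∃ k, y ∈ D k ∧ z ∈ D k) ↔ z ∈ D i :=
      ⟨fun ⟨k, h3, h4⟩ => hi k h3 ▸ h4, fun h' => ⟨i, yi, h'⟩⟩
    rw [if_neg hyz]
    by_cases ht : rep y = rep z
    swap
    · have h3 : ¬ Twin G D W y z := fun h' => ht (hrep' _ _ h')
      simp only [Twin, hyz, ys, zs, true_and, false_or, hcommon] at h3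
      grind
    have h3 := twin y z ht
    simp only [Twin, hyz, ys, zs, true_and, false_or, hcommon] at h3
    rw [if_pos ht]
    have neg : ∀ p q, p ≠ q → Single D W p → Single D W q → rep p = rep q → ε p = -1 →
        q = rep p ∧ ∃ k, p ∈ D k ∧ q ∈ D k := by
      intro p q hpq ps qs hr' hp
      rcases hε p ps with h4 | ⟨-, k, h4, h5, h6, h7⟩
      · rw [h4] at hp
        norm_num at hp
      · by_cases hq : rep p = q
        · exact ⟨hq.symm, k, h5, hq ▸ h4⟩
        · exact absurd (twin p q hr')
            (h.twin_trans_aux (hs p ps).1 ps qs h6 hpq hq h4 h5 h7)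
    by_cases zi : z ∈ D i
    · have hn := h3.1 zi
      have key : rep y = y ∨ rep y = z := by
        by_contra! hne
        exact h.twin_trans_aux zs ys (hs y ys).1 (Ne.symm hyz) hne.1.symm hne.2.symm zi yi
          (fun h' => hn h'.symm) (hrep y).symm
      have e1 : ε y * ε z = -1 := by
        rcases key with h4 | h4
        · have h5 : ε y = 1 := if_neg fun h' => h'.2 h4
          have h6 : ε z = -1 := if_pos ⟨⟨i, by rw [← ht, h4]; exact yi, zi⟩, by rw [← ht, h4]; exact hyz⟩
          rw [h5, h6]; rfl
        · have h5 : ε z = 1 := if_neg fun h' => h'.2 (by rw [← ht, h4])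
          have h6 : ε y = -1 := if_pos ⟨⟨i, by rw [h4]; exact zi, yi⟩, by rw [h4]; exact Ne.symm hyz⟩
          rw [h5, h6]; rfl
      rw [e1, if_pos zi, if_neg hn]; rfl
    · have ha : G.Adj y z := by_contra fun h' => zi (h3.2 h')
      have e1 : ε y = 1 := (hε y ys).resolve_right fun h' =>
        zi (hcommon.1 (neg y z hyz ys zs ht h'.1).2)
      have e2 : ε z = 1 := (hε z zs).resolve_right fun h' => by
        obtain ⟨k, h4, h5⟩ := (neg z y (Ne.symm hyz) zs ys ht.symm h'.1).2
        exact zi (hcommon.1 ⟨k, h5, h4⟩)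
      rw [e1, e2, if_neg zi, if_pos ha]; rfl
  have flip : ∀ y z, A y z + ∑ k, b y k * b z k = (if y = z then 2 else if G.Adj y z then 1 else 0) →
      A z y + ∑ k, b z k * b y k = if z = y then 2 else if G.Adj z y then 1 else 0 := by
    intro y z h'
    rw [Acomm z y, Finset.sum_congr rfl fun k _ => mul_comm (b z k) (b y k), h', G.adj_comm]
    simp only [eq_comm]
  refine ⟨ι ⊕ κ, inferInstance, Sum.inl, fun y => Sum.elim (fun i => if y ∈ D i then 1 else 0) (b y),
    Sum.inl_injective, fun x _ i => rfl, fun y hy z hz => ?_⟩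
  rw [Fintype.sum_sum_type]
  change A y z + ∑ k, b y k * b z k = _
  by_cases yD : ∃ i, y ∈ D i
  · by_cases ys : Single D W y
    · by_cases zD : ∃ i, z ∈ D i
      · by_cases zs : Single D W z
        · exact single y hy z hz ys zs
        · exact flip _ _ (double z hz y hy zs zD)
      · exact outer y hy z hz ys (by push Not at zD; exact zD)
    · exact double y hy z hz ys yD
  push Not at yD
  by_cases zD : ∃ i, z ∈ D i
  · by_cases zs : Single D W z
    · exact flip _ _ (outer z hz y hy zs yD)
    · exact flip _ _ (double z hz y hy zs zD)
  push Not at zD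
  rw [AO y z yD, zero_add]
  simp only [bO y yD, bO z zD]
  exact h2 y ⟨hy, yD⟩ z ⟨hz, zD⟩

theorem Clean.represented [Finite V] {ι : Type} [Finite ι] {D : ι → Set V} {W : Set V}
    (h : Clean G D W) (hl : Linked G D W) : Represented G D W := by
  induction hn : W.ncard using Nat.strong_induction_on generalizing ι W with
  | _ n ih =>
  obtain rfl | hne := W.eq_empty_or_nonempty
  · exact ⟨ι, Fintype.ofFinite ι, id, fun _ _ => 0, Function.injective_id, by simp, by simp⟩
  let s : Setoid V := ⟨Twin G D W, fun x => .inl rfl, Twin.symm, h.twin_trans⟩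
  let rep : V → V := fun y => (Quotient.mk s y).out
  have hrep : ∀ y, Twin G D W (rep y) y := fun y => Quotient.exact (Quotient.out_eq (Quotient.mk s y))
  have hrep' : ∀ y z, Twin G D W y z → rep y = rep z := fun y z h' =>
    congrArg Quotient.out (Quotient.sound (s := s) h')
  have hlt : ({x | x ∈ W ∧ ∀ i, x ∉ D i} : Set V).ncard < n := by
    obtain ⟨x, hx, i, hi⟩ := hl W subset_rfl hne fun _ _ y hy _ => hy
    rw [← hn]
    exact Set.ncard_lt_ncard ⟨fun x hx => hx.1, fun h' => (h' hx).2 i hi⟩ (Set.toFinite _)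
  refine h.represented_step rep hrep hrep' (ih _ hlt ?_ ?_ rfl)
  · refine h.next _ (fun i => i.2.1) fun i j hij ht => hij (Subtype.ext ?_)
    rw [← i.2.2, ← j.2.2]
    exact hrep' _ _ ht
  · refine h.linked_next hl _ fun y hy => ?_
    have h1 : Single D W (rep y) := by
      rcases hrep y with h' | h'
      · rwa [h']
      · exact h'.1
    exact ⟨⟨rep y, h1, hrep' _ _ (hrep y)⟩, hrep y⟩

end Representation

section Forms

variable {V : Type} [Fintype V] {G : SimpleGraph V}

/-- The sum of the values of a vector on `R`. -/
noncomputable def rootSum (R : Set V) (x : V → ℝ) : ℝ := ∑ v, if v ∈ R then x v else 0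

/-- A vector supported on `W` which is negative after adding a root with neighbourhood `R` whose
weight equals `s`. -/
def FormBad (G : SimpleGraph V) (s : ℝ) (R W : Set V) : Prop :=
  ∃ x : V → ℝ, (∀ v ∉ W, x v = 0) ∧ s * qf G (s + 1 / s) x < rootSum R x ^ 2

theorem injective_vecCons {α : Type} {k : ℕ} {a : α} {f : Fin k → α} :
    Function.Injective (Matrix.vecCons a f) ↔ (∀ i, a ≠ f i) ∧ Function.Injective f := by
  rw [Matrix.vecCons, Fin.cons_injective_iff]
  simp [Set.mem_range, eq_comm]

theorem formBad_of_core {s : ℝ} {R W : Set V} {k : ℕ} (hs : 0 < s) (f : Fin k → V)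
    (hf : Function.Injective f) (ξ : Fin k → ℝ) (hW : ∀ i, f i ∈ W)
    (h : (s ^ 2 + 1) * ∑ i, ξ i ^ 2 + s * ∑ i, ∑ j, (if G.Adj (f i) (f j) then ξ i * ξ j else 0) <
      (∑ i, if f i ∈ R then ξ i else 0) ^ 2) : FormBad G s R W := by
  let e : Fin k ↪ V := ⟨f, hf⟩
  refine ⟨pushVec e ξ, fun v hv => pushVec_eq_zero e ξ ?_, ?_⟩
  · rintro ⟨i, rfl⟩
    exact hv (hW i)
  have h1 : qf G (s + 1 / s) (pushVec e ξ) = qf (G.comap e) (s + 1 / s) ξ :=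
    qf_pushVec (SimpleGraph.Embedding.comap e G) _ ξ
  have h2 : rootSum R (pushVec e ξ) = ∑ i, if f i ∈ R then ξ i else 0 := by
    unfold rootSum
    rw [sum_of_forall_notMem_range e]
    · exact Finset.sum_congr rfl fun i _ => by rw [pushVec_apply]; rfl
    · intro w hw
      rw [pushVec_eq_zero e ξ hw, ite_self]
  rw [h1, h2]
  refine lt_of_eq_of_lt ?_ h
  unfold qf
  rw [mul_add, ← mul_assoc, mul_add, mul_one_div_cancel hs.ne', pow_two s]
  congr 2
  exact Finset.sum_congr rfl fun i _ => Finset.sum_congr rfl fun j _ => by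
    simp [adjMat, e]

theorem bounds_of_pow_lt {s : ℝ} (hs : 1 ≤ s) (hs6 : s ^ 6 < s ^ 2 + 1) :
    s ^ 2 ≤ 2.1511 * s - 1.1511 ∧ s < 1.1511 := by
  have h : s < 1.1511 := by
    by_contra! hn
    have h2 : 1.325 ≤ s ^ 2 := by nlinarith
    nlinarith [mul_nonneg (sub_nonneg.2 h2) (sq_nonneg (s ^ 2))]
  exact ⟨by nlinarith, h⟩

theorem not_adj_symm {V : Type} {G : SimpleGraph V} {u v : V} (h : ¬ G.Adj u v) :
    ¬ G.Adj v u := fun h' => h h'.symm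

theorem PairCore.formBad {s : ℝ} (hs : 1 ≤ s) (hs6 : s ^ 6 < s ^ 2 + 1) {R W : Set V} {a b : V}
    (ha : a ∈ W) (hb : b ∈ W) (aR : a ∈ R) (bR : b ∈ R) (ab : G.Adj a b)
    (h : PairCore G {x | G.Adj a x} {x | G.Adj b x} (W \ R)) : FormBad G s R W := by
  obtain ⟨hs2, hs1⟩ := bounds_of_pow_lt hs hs6
  have ba := ab.symm
  have hs0 : 0 < s := by linarith
  have hir : ∀ v, ¬ G.Adj v v := fun v => G.irrefl
  have h0 : Function.Injective (![] : Fin 0 → V) := Function.injective_of_subsingleton _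
  cases h
  case c5 y w hy hw yD yE wD wE wy =>
    obtain ⟨yW, yR⟩ := hy
    obtain ⟨wW, wR⟩ := hw
    simp only [Set.mem_ofPred_eq] at *
    refine formBad_of_core hs0 ![a, b, y, w] ?_ ![4, 2, -3, -2] ?_ ?_
    · simp only [injective_vecCons, Fin.forall_fin_succ]; simp; grind (splits := 40)
    · simp [Fin.forall_fin_succ, *]
    · simp [Fin.sum_univ_succ, *, yD.symm, yE.symm, wD.symm, not_adj_symm wE, not_adj_symm wy]
      nlinarith
  case c68 y z hy hz yD yE zD zE yz =>
    obtain ⟨yW, yR⟩ := hy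
    obtain ⟨zW, zR⟩ := hz
    simp only [Set.mem_ofPred_eq] at *
    by_cases adj : G.Adj y z
    · refine formBad_of_core hs0 ![a, b, y, z] ?_ ![3, 3, -2, -2] ?_ ?_
      · simp only [injective_vecCons, Fin.forall_fin_succ]; simp; grind (splits := 40)
      · simp [Fin.forall_fin_succ, *]
      · simp [Fin.sum_univ_succ, *, yD.symm, yE.symm, zD.symm, zE.symm, adj.symm]
        nlinarith
    · refine formBad_of_core hs0 ![a, b, y, z] ?_ ![1, 1, -1, -1] ?_ ?_
      · simp only [injective_vecCons, Fin.forall_fin_succ]; simp; grind (splits := 40)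
      · simp [Fin.forall_fin_succ, *]
      · simp [Fin.sum_univ_succ, *, yD.symm, yE.symm, zD.symm, zE.symm, not_adj_symm adj]
        nlinarith
  case c7 y w hy hw yD yE wD wE wy =>
    obtain ⟨yW, yR⟩ := hy
    obtain ⟨wW, wR⟩ := hw
    simp only [Set.mem_ofPred_eq] at *
    refine formBad_of_core hs0 ![a, b, y, w] ?_ ![3, 3, -4, 2] ?_ ?_
    · simp only [injective_vecCons, Fin.forall_fin_succ]; simp; grind (splits := 40)
    · simp [Fin.forall_fin_succ, *]
    · simp [Fin.sum_univ_succ, *, yD.symm, yE.symm, wy.symm, not_adj_symm wD, not_adj_symm wE]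
      nlinarith
  case c10 y z w hy hz hw yD yE zD zE wD wE yz wz wy =>
    obtain ⟨yW, yR⟩ := hy
    obtain ⟨zW, zR⟩ := hz
    obtain ⟨wW, wR⟩ := hw
    simp only [Set.mem_ofPred_eq] at *
    refine formBad_of_core hs0 ![a, b, y, z, w] ?_ ![-2, 2, 2, -2, 1] ?_ ?_
    · simp only [injective_vecCons, Fin.forall_fin_succ]; simp; grind (splits := 40)
    · simp [Fin.forall_fin_succ, *]
    · simp [Fin.sum_univ_succ, *, yD.symm, zE.symm, yz.symm, wz.symm, not_adj_symm yE,
        not_adj_symm zD, not_adj_symm wD, not_adj_symm wE, not_adj_symm wy]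
      nlinarith
  case c11 y z x hy hz hx yD yE zD zE xD xE yz xy xz =>
    obtain ⟨yW, yR⟩ := hy
    obtain ⟨zW, zR⟩ := hz
    obtain ⟨xW, xR⟩ := hx
    simp only [Set.mem_ofPred_eq] at *
    refine formBad_of_core hs0 ![a, b, y, z, x] ?_ ![-2, 2, 2, -1, -1] ?_ ?_
    · simp only [injective_vecCons, Fin.forall_fin_succ]; simp; grind (splits := 40)
    · simp [Fin.forall_fin_succ, *]
    · simp [Fin.sum_univ_succ, *, yD.symm, zE.symm, xE.symm, yz.symm, xy.symm, xz.symm,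
        not_adj_symm yE, not_adj_symm zD, not_adj_symm xD]
      nlinarith
  case c12 c d p q hc hd hp hq cD cE dD dE pD pE qD qE cd pc pd qc qd pq =>
    obtain ⟨cW, cR⟩ := hc
    obtain ⟨dW, dR⟩ := hd
    obtain ⟨pW, pR⟩ := hp
    obtain ⟨qW, qR⟩ := hq
    simp only [Set.mem_ofPred_eq] at *
    refine formBad_of_core hs0 ![a, b, c, d, p, q] ?_ ![2, 2, -3, -3, 2, 2] ?_ ?_
    · simp only [injective_vecCons, Fin.forall_fin_succ]; simp; grind (splits := 40)
    · simp [Fin.forall_fin_succ, *]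
    · simp [Fin.sum_univ_succ, *, cD.symm, dE.symm, pc.symm, pd.symm, qc.symm, qd.symm, pq.symm,
        not_adj_symm cE, not_adj_symm dD, not_adj_symm pD, not_adj_symm pE, not_adj_symm qD,
        not_adj_symm qE, not_adj_symm cd]
      nlinarith
  case c13 c d p w hc hd hp hw cD cE dD dE pD pE wD wE cd pc pd wp wc wd =>
    obtain ⟨cW, cR⟩ := hc
    obtain ⟨dW, dR⟩ := hd
    obtain ⟨pW, pR⟩ := hp
    obtain ⟨wW, wR⟩ := hw
    simp only [Set.mem_ofPred_eq] at *
    refine formBad_of_core hs0 ![a, b, c, d, p, w] ?_ ![2, 2, -3, -3, 4, -2] ?_ ?_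
    · simp only [injective_vecCons, Fin.forall_fin_succ]; simp; grind (splits := 40)
    · simp [Fin.forall_fin_succ, *]
    · simp [Fin.sum_univ_succ, *, cD.symm, dE.symm, pc.symm, pd.symm, wp.symm, not_adj_symm cE,
        not_adj_symm dD, not_adj_symm pD, not_adj_symm pE, not_adj_symm wD, not_adj_symm wE,
        not_adj_symm cd, not_adj_symm wc, not_adj_symm wd]
      nlinarith

theorem RootCore.formBad {s : ℝ} (hs : 1 ≤ s) (hs6 : s ^ 6 < s ^ 2 + 1) {R W : Set V}
    (h : RootCore G R W) : FormBad G s R W := by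
  obtain ⟨hs2, hs1⟩ := bounds_of_pow_lt hs hs6
  have hs0 : 0 < s := by linarith
  have hir : ∀ v, ¬ G.Adj v v := fun v => G.irrefl
  have h0 : Function.Injective (![] : Fin 0 → V) := Function.injective_of_subsingleton _
  cases h
  case c1 a b c ha hb hc aR bR cR ab ca cb =>
    refine formBad_of_core hs0 ![a, b, c] ?_ ![s ^ 2 * (s ^ 2 + 1), s ^ 2 + 1, -s ^ 3] ?_ ?_
    · simp only [injective_vecCons, Fin.forall_fin_succ]; simp; grind (splits := 40)
    · simp [Fin.forall_fin_succ, *]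
    · simp [Fin.sum_univ_succ, *, ca.symm, not_adj_symm ab, not_adj_symm cb]
      have h1 : s ^ 2 * (s ^ 2 + 1) * (s ^ 6 - (s ^ 2 + 1)) < 0 :=
        mul_neg_of_pos_of_neg (by positivity) (by linarith)
      nlinarith
  case c2 a b c ha hb hc aR bR cR ne ab ca cb =>
    refine formBad_of_core hs0 ![a, b, c] ?_ ![1, 1, -1] ?_ ?_
    · simp only [injective_vecCons, Fin.forall_fin_succ]; simp; grind (splits := 40)
    · simp [Fin.forall_fin_succ, *]
    · simp [Fin.sum_univ_succ, *, ca.symm, cb.symm, not_adj_symm ab]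
      nlinarith
  case c3 a b c ha hb hc aR bR cR nab nac nbc ab ac bc =>
    refine formBad_of_core hs0 ![a, b, c] ?_ ![1, 1, 1] ?_ ?_
    · simp only [injective_vecCons, Fin.forall_fin_succ]; simp; grind (splits := 40)
    · simp [Fin.forall_fin_succ, *]
    · simp [Fin.sum_univ_succ, *, not_adj_symm ab, not_adj_symm ac, not_adj_symm bc]
      nlinarith
  case c4 a b c ha hb hc aR bR cR ab ac bc =>
    have cb := bc.symm
    refine formBad_of_core hs0 ![a, b, c] ?_ ![3, 2, 2] ?_ ?_
    · simp only [injective_vecCons, Fin.forall_fin_succ]; simp; grind (splits := 40)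
    · simp [Fin.forall_fin_succ, *]
    · simp [Fin.sum_univ_succ, *, bc.symm, not_adj_symm ab, not_adj_symm ac]
      nlinarith
  case pair a b ha hb aR bR ab h => exact h.formBad hs hs6 ha hb aR bR ab
  case triple a b c y ha hb hc hy aR bR cR yR ab ac bc ay yb yc =>
    refine formBad_of_core hs0 ![a, b, c, y] ?_ ![2, 2, 2, -3] ?_ ?_
    · simp only [injective_vecCons, Fin.forall_fin_succ]; simp; grind (splits := 40)
    · simp [Fin.forall_fin_succ, *]
    · simp [Fin.sum_univ_succ, *, ab.symm, ac.symm, bc.symm, ay.symm, yb.symm, yc.symm]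
      nlinarith

end Forms

section Tails

variable {V : Type} [Fintype V] {G : SimpleGraph V}

/-- The form is negative on some vector supported on `W`. -/
def NegOn (G : SimpleGraph V) (lam : ℝ) (W : Set V) : Prop :=
  ∃ x : V → ℝ, (∀ v ∉ W, x v = 0) ∧ qf G lam x < 0

theorem NegOn.mono {lam : ℝ} {W Z : Set V} (h : NegOn G lam W) (hWZ : W ⊆ Z) : NegOn G lam Z := by
  obtain ⟨x, hx, hn⟩ := h
  exact ⟨x, fun v hv => hx v fun h => hv (hWZ h), hn⟩

theorem NegOn.of_le {lam mu : ℝ} {W : Set V} (h : NegOn G mu W) (hl : lam ≤ mu) : NegOn G lam W := by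
  obtain ⟨x, hx, hn⟩ := h
  exact ⟨x, hx, (qf_mono hl x).trans_lt hn⟩

theorem qf_add_smul (lam t : ℝ) (x z : V → ℝ) :
    qf G lam (fun v => x v + t * z v) = qf G lam x + t ^ 2 * qf G lam z +
      2 * t * ∑ v, x v * (lam * z v + rootSum {w | G.Adj v w} z) := by
  have h1 : ∀ v, rootSum {w | G.Adj v w} z = ∑ w, adjMat G v w * z w := fun v =>
    Finset.sum_congr rfl fun w _ => by simp [adjMat]
  have h2 : ∑ v, ∑ w, adjMat G v w * (z v * x w) = ∑ v, x v * ∑ w, adjMat G v w * z w := by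
    rw [Finset.sum_comm]
    refine Finset.sum_congr rfl fun v _ => ?_
    rw [Finset.mul_sum]
    refine Finset.sum_congr rfl fun w _ => ?_
    rw [show adjMat G w v = adjMat G v w by simp [adjMat, G.adj_comm]]
    ring
  have h3 : ∑ v, ∑ w, adjMat G v w * (x v * z w) = ∑ v, x v * ∑ w, adjMat G v w * z w :=
    Finset.sum_congr rfl fun v _ => by
      rw [Finset.mul_sum]
      exact Finset.sum_congr rfl fun w _ => by ring
  simp only [h1, mul_add, Finset.sum_add_distrib]
  rw [← h3]
  unfold qf
  have h4 : ∑ v, ∑ w, adjMat G v w * ((x v + t * z v) * (x w + t * z w)) =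
      ∑ v, ∑ w, adjMat G v w * (x v * x w) + t * ∑ v, ∑ w, adjMat G v w * (x v * z w) +
      t * ∑ v, ∑ w, adjMat G v w * (z v * x w) + t ^ 2 * ∑ v, ∑ w, adjMat G v w * (z v * z w) := by
    simp only [Finset.mul_sum, ← Finset.sum_add_distrib]
    exact Finset.sum_congr rfl fun v _ => Finset.sum_congr rfl fun w _ => by ring
  have h5 : ∑ v, (x v + t * z v) ^ 2 =
      ∑ v, x v ^ 2 + 2 * t * ∑ v, x v * z v + t ^ 2 * ∑ v, z v ^ 2 := by
    simp only [Finset.mul_sum, ← Finset.sum_add_distrib]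
    exact Finset.sum_congr rfl fun v _ => by ring
  have h6 : ∑ v, x v * (lam * z v) = lam * ∑ v, x v * z v := by
    rw [Finset.mul_sum]
    exact Finset.sum_congr rfl fun v _ => by ring
  rw [h4, h5, h6, h2, h3]
  ring

theorem rootSum_single (R : Set V) (a : V) (c : ℝ) :
    rootSum R (Pi.single a c) = if a ∈ R then c else 0 := by
  unfold rootSum
  rw [Finset.sum_eq_single a]
  · simp
  · intro v _ hv
    simp [hv]
  · simp

theorem rootSum_add_smul (R : Set V) (t : ℝ) (x z : V → ℝ) :
    rootSum R (fun v => x v + t * z v) = rootSum R x + t * rootSum R z := by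
  unfold rootSum
  rw [Finset.mul_sum, ← Finset.sum_add_distrib]
  exact Finset.sum_congr rfl fun v _ => by split_ifs <;> simp

theorem qf_single (lam c : ℝ) (a : V) : qf G lam (Pi.single a c) = lam * c ^ 2 := by
  unfold qf
  rw [Finset.sum_eq_single a, Finset.sum_eq_single a, Finset.sum_eq_single a]
  · simp [adjMat]
  · intro v _ hv
    simp [hv]
  · simp
  · intro v _ hv
    simp [hv]
  · simp
  · intro v _ hv
    simp [hv]
  · simp

theorem RBad.formBad {s : ℝ} (hs : 1 ≤ s) (hs6 : s ^ 6 < s ^ 2 + 1) {n : ℕ} {R W : Set V}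
    (h : RBad G n R W) : FormBad G s R W := by
  have hs0 : 0 < s := by linarith
  induction h with
  | core h => exact h.formBad hs hs6
  | @shift n R W a ha aR h ih =>
    obtain ⟨x, hx, hn⟩ := ih
    set σ := rootSum {w | G.Adj a w} x with hσ
    refine ⟨fun v => (Pi.single a (-σ / s) : V → ℝ) v + 1 * x v, fun v hv => ?_, ?_⟩
    · beta_reduce
      rw [hx v fun h => hv h.1, Pi.single_eq_of_ne (fun h : v = a => hv (h.symm ▸ ha))]
      simp
    · rw [qf_add_smul, rootSum_add_smul, rootSum_single, if_pos aR, qf_single]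
      have h1 : rootSum R x = 0 := Finset.sum_eq_zero fun v _ => by
        split_ifs with h
        · exact hx v fun h' => h'.2 h
        · rfl
      have h2 : ∑ v, (Pi.single a (-σ / s) : V → ℝ) v *
          ((s + 1 / s) * x v + rootSum {w | G.Adj v w} x) = -σ / s * σ := by
        rw [Finset.sum_eq_single a]
        · rw [Pi.single_eq_same, ← hσ, hx a fun h' => h'.2 aR]
          ring
        · intro v _ hv
          simp [hv]
        · simp
      rw [h1, h2]
      have h3 : s * ((s + 1 / s) * (-σ / s) ^ 2 + 1 ^ 2 * qf G (s + 1 / s) x + 2 * 1 * (-σ / s * σ))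
          = s * qf G (s + 1 / s) x - σ ^ 2 + (-σ / s) ^ 2 := by
        field_simp
        ring
      rw [h3]
      linarith

/-- A vector outside `W` which acts on `W` as a root with neighbourhood `R` of weight at most
`γ`. -/
def Tail (G : SimpleGraph V) (lam : ℝ) (T R W : Set V) (γ : ℝ) : Prop :=
  Disjoint T W ∧ ∃ z : V → ℝ, (∀ v ∉ T, z v = 0) ∧
    (∀ w ∈ W, rootSum {v | G.Adj w v} z = if w ∈ R then -1 else 0) ∧ qf G lam z ≤ γ

theorem FormBad.neg {s lam : ℝ} (hs : 0 < s) (hlam : lam ≤ s + 1 / s) {T R W : Set V}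
    (h : FormBad G s R W) (ht : Tail G lam T R W s) : NegOn G lam (T ∪ W) := by
  obtain ⟨x, hx, hn⟩ := h
  obtain ⟨hd, z, hz, hzW, hq⟩ := ht
  set σ := rootSum R x with hσ
  refine ⟨fun v => x v + σ / s * z v, fun v hv => ?_, ?_⟩
  · beta_reduce
    rw [hx v fun h => hv (.inr h), hz v fun h => hv (.inl h)]
    simp
  · have h1 : ∑ v, x v * (lam * z v + rootSum {w | G.Adj v w} z) = -σ := by
      rw [hσ, rootSum, ← Finset.sum_neg_distrib]
      refine Finset.sum_congr rfl fun v _ => ?_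
      by_cases hv : v ∈ W
      · rw [hz v fun h => hd.le_bot ⟨h, hv⟩, hzW v hv]
        split_ifs <;> simp
      · simp [hx v hv]
    rw [qf_add_smul, h1]
    have h2 := (qf_mono hlam x).trans_lt ((lt_div_iff₀' hs).2 hn)
    have h3 : (σ / s) ^ 2 * qf G lam z ≤ (σ / s) ^ 2 * s := mul_le_mul_of_nonneg_left hq (sq_nonneg _)
    have h4 : (σ / s) ^ 2 * s = σ ^ 2 / s := by field_simp
    have h5 : 2 * (σ / s) * -σ = - 2 * (σ ^ 2 / s) := by ring
    linarith

theorem Tail.extend {s δ : ℝ} (hs : 0 < s) (hδ : 0 ≤ δ) {T R W : Set V} {a : V} (ha : a ∈ W)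
    (aR : a ∈ R) (h : Tail G (s + 1 / s) T R W (s + δ)) :
    Tail G (s + 1 / s) (insert a T) {x | G.Adj a x} (W \ R) (s + δ / s ^ 2) := by
  obtain ⟨hd, z, hz, hzW, hq⟩ := h
  have hsd : 0 < s + δ := by linarith
  refine ⟨?_, fun v => (Pi.single a (-1) : V → ℝ) v + -1 / (s + δ) * z v, fun v hv => ?_,
    fun w hw => ?_, ?_⟩
  · rw [Set.disjoint_left] at hd ⊢
    rintro v (rfl | hv) ⟨h1, h2⟩
    · exact h2 aR
    · exact hd hv h1
  · beta_reduce
    rw [hz v fun h => hv (.inr h), Pi.single_eq_of_ne (fun h => hv (.inl h))]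
    simp
  · rw [rootSum_add_smul, rootSum_single, hzW w hw.1, if_neg hw.2]
    simp [G.adj_comm]
  · have h1 : ∑ v, (Pi.single a (-1) : V → ℝ) v *
        ((s + 1 / s) * z v + rootSum {w | G.Adj v w} z) = 1 := by
      rw [Finset.sum_eq_single a]
      · rw [Pi.single_eq_same, hzW a ha, if_pos aR, hz a fun h' => (Set.disjoint_left.1 hd h') ha]
        ring
      · intro v _ hv
        simp [hv]
      · simp
    rw [qf_add_smul, h1, qf_single]
    have h2 : (-1 / (s + δ)) ^ 2 * qf G (s + 1 / s) z ≤ (-1 / (s + δ)) ^ 2 * (s + δ) :=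
      mul_le_mul_of_nonneg_left hq (sq_nonneg _)
    have h3 : (-1 / (s + δ)) ^ 2 * (s + δ) = 1 / (s + δ) := by field_simp
    have h4 : 1 / s - 1 / (s + δ) ≤ δ / s ^ 2 := by
      rw [div_sub_div _ _ hs.ne' hsd.ne', div_le_div_iff₀ (by positivity) (by positivity)]
      nlinarith [mul_nonneg hδ (mul_nonneg hs.le hδ)]
    have h5 : 2 * (-1 / (s + δ)) * 1 = - 2 * (1 / (s + δ)) := by ring
    linarith

/-- A root whose weight is close enough to `s` is as good as one of weight `s'`. -/
theorem RBad.neg {s s' : ℝ} (hs : 1 < s) (hss : s < s') (hs6 : s' ^ 6 < s' ^ 2 + 1) {n : ℕ}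
    {T R W : Set V} (h : RBad G n R W) {δ : ℝ} (hδ : 0 ≤ δ) (hδ' : δ ≤ (s' - s) * (s ^ 2) ^ n)
    (ht : Tail G (s + 1 / s) T R W (s + δ)) : NegOn G (s + 1 / s) (T ∪ W) := by
  have hs0 : 0 < s := by linarith
  induction h generalizing T δ with
  | @core R W h =>
    have h1 : FormBad G s' R W := h.formBad (by linarith) hs6
    refine h1.neg (by linarith) ?_ ?_
    · have := TwoMin.add_one_div_le hs.le hss.le
      exact this
    · obtain ⟨hd, z, h1, h2, h3⟩ := ht
      refine ⟨hd, z, h1, h2, h3.trans ?_⟩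
      rw [pow_zero] at hδ'
      linarith
  | @shift n R W a ha aR h ih =>
    refine (ih (δ := δ / s ^ 2) (by positivity) ?_ (ht.extend hs0 hδ ha aR)).mono ?_
    · rw [div_le_iff₀ (by positivity)]
      calc δ ≤ _ := hδ'
        _ = _ := by rw [pow_succ]; ring
    · rintro v ((rfl | hv) | hv)
      · exact .inr ha
      · exact .inl hv
      · exact .inr hv.1

theorem Tail.single {s : ℝ} {a : V} {W : Set V} (ha : a ∉ W) :
    Tail G (s + 1 / s) {a} {x | G.Adj a x} W (s + 1 / s) := by
  refine ⟨Set.disjoint_singleton_left.2 ha, Pi.single a (-1), fun v hv => ?_, fun w hw => ?_, ?_⟩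
  · rw [Pi.single_eq_of_ne (fun h => hv h)]
  · rw [rootSum_single]
    simp [G.adj_comm]
  · rw [qf_single]
    linarith

theorem Tail.clique {s : ℝ} (hs : 1 < s) {K : Finset V} {R W : Set V} (hd : ∀ v ∈ K, v ∉ W)
    (hK : ∀ v ∈ K, ∀ w ∈ K, v ≠ w → G.Adj v w) (hR : ∀ w ∈ W, ∀ v ∈ K, G.Adj v w ↔ w ∈ R)
    (hc : s / (s - 1) ≤ (K.card : ℝ)) : Tail G (s + 1 / s) K R W s := by
  have hs1 : 0 < s - 1 := by linarith
  have hc0 : (0 : ℝ) < K.card := lt_of_lt_of_le (by positivity) hc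
  refine ⟨Set.disjoint_left.2 fun v h1 h2 => hd v h1 h2,
    fun v => if v ∈ K then -1 / (K.card : ℝ) else 0, fun v hv => if_neg hv, fun w hw => ?_, ?_⟩
  · unfold rootSum
    have h1 : ∀ v, (if v ∈ {v | G.Adj w v} then if v ∈ K then -1 / (K.card : ℝ) else 0 else 0) =
        if v ∈ K then (if w ∈ R then -1 / (K.card : ℝ) else 0) else 0 := fun v => by
      by_cases hv : v ∈ K
      · simp [hv, ← hR w hw v hv, G.adj_comm]
      · simp [hv]
    simp only [h1]
    rw [← Finset.sum_filter]
    simp only [Finset.filter_mem_eq_inter, Finset.univ_inter, Finset.sum_const, nsmul_eq_mul]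
    split_ifs
    · field_simp
    · simp
  · unfold qf
    have h1 : ∀ v, ∑ w, adjMat G v w * ((if v ∈ K then -1 / (K.card : ℝ) else 0) *
        (if w ∈ K then -1 / (K.card : ℝ) else 0)) =
        if v ∈ K then ((K.card : ℝ) - 1) / (K.card : ℝ) ^ 2 else 0 := fun v => by
      by_cases hv : v ∈ K
      · have h2 : ∀ w, adjMat G v w * ((if v ∈ K then -1 / (K.card : ℝ) else 0) *
            (if w ∈ K then -1 / (K.card : ℝ) else 0)) =
            if w ∈ K.erase v then 1 / (K.card : ℝ) ^ 2 else 0 := fun w => by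
          by_cases hw : w ∈ K
          · by_cases hvw : v = w
            · subst hvw
              simp [adjMat]
            · have := hK v hv w hw hvw
              simp [hv, hw, Ne.symm hvw, adjMat, this]
              field_simp
          · simp [hw]
        rw [Finset.sum_congr rfl fun w _ => h2 w, if_pos hv]
        rw [← Finset.sum_filter]
        simp only [Finset.filter_mem_eq_inter, Finset.univ_inter, Finset.sum_const, nsmul_eq_mul,
          Finset.card_erase_of_mem hv]
        rw [Nat.cast_sub (Finset.card_pos.2 ⟨v, hv⟩), Nat.cast_one]
        ring
      · simp [hv]
    simp only [h1, ite_pow]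
    rw [← Finset.sum_filter, Finset.sum_congr rfl (g := fun v => if v ∈ K then
      (-1 / (K.card : ℝ)) ^ 2 else 0) (by intro v _; simp), ← Finset.sum_filter]
    simp only [Finset.filter_mem_eq_inter, Finset.univ_inter, Finset.sum_const, nsmul_eq_mul]
    rw [div_le_iff₀ hs1] at hc
    have h3 : (s + 1 / s) * ((K.card : ℝ) * (-1 / (K.card : ℝ)) ^ 2) +
        (K.card : ℝ) * (((K.card : ℝ) - 1) / (K.card : ℝ) ^ 2) = (s + 1 / s - 1 + K.card) / K.card := by
      field_simp
      ring
    rw [h3, div_le_iff₀ hc0]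
    have h4 : 1 / s < 1 := by rw [div_lt_one] <;> linarith
    nlinarith

end Tails

section Growth

/-- Ramsey's theorem for graphs. -/
theorem exists_clique_or_indep (k m : ℕ) : ∃ N : ℕ, ∀ (V : Type) (G : SimpleGraph V) (S : Finset V),
    N ≤ S.card → (∃ K ⊆ S, K.card = k ∧ ∀ v ∈ K, ∀ w ∈ K, v ≠ w → G.Adj v w) ∨
      ∃ I ⊆ S, I.card = m ∧ ∀ v ∈ I, ∀ w ∈ I, v ≠ w → ¬ G.Adj v w := by
  induction k generalizing m with
  | zero => exact ⟨0, fun V G S _ => .inl ⟨∅, by simp⟩⟩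
  | succ k ihk =>
    induction m with
    | zero => exact ⟨0, fun V G S _ => .inr ⟨∅, by simp⟩⟩
    | succ m ihm =>
      obtain ⟨N₁, h₁⟩ := ihk (m + 1)
      obtain ⟨N₂, h₂⟩ := ihm
      refine ⟨N₁ + N₂ + 1, fun V G S hS => ?_⟩
      obtain ⟨v, hv⟩ : S.Nonempty := Finset.card_pos.1 (by omega)
      have hc := Finset.card_filter_add_card_filter_not (s := S.erase v) (fun w => G.Adj v w)
      rw [Finset.card_erase_of_mem hv] at hc
      by_cases hN : N₁ ≤ ((S.erase v).filter fun w => G.Adj v w).card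
      · rcases h₁ V G _ hN with ⟨K, hK, hKc, hKa⟩ | ⟨I, hI, hIc, hIa⟩
        · refine .inl ⟨insert v K, fun x hx => ?_, ?_, fun x hx y hy hxy => ?_⟩
          · rcases Finset.mem_insert.1 hx with rfl | hx
            · exact hv
            · exact (Finset.mem_erase.1 (Finset.mem_filter.1 (hK hx)).1).2
          · rw [Finset.card_insert_of_notMem fun h => by simpa using hK h, hKc]
          · have hadj : ∀ z ∈ K, G.Adj v z := fun z hz => (Finset.mem_filter.1 (hK hz)).2
            rcases Finset.mem_insert.1 hx with rfl | hx' <;> rcases Finset.mem_insert.1 hy with rfl | hy'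
            · exact absurd rfl hxy
            · exact hadj y hy'
            · exact (hadj x hx').symm
            · exact hKa x hx' y hy' hxy
        · exact .inr ⟨I, hI.trans ((Finset.filter_subset _ _).trans (Finset.erase_subset _ _)), hIc, hIa⟩
      · rcases h₂ V G ((S.erase v).filter fun w => ¬ G.Adj v w) (by omega) with
          ⟨K, hK, hKc, hKa⟩ | ⟨I, hI, hIc, hIa⟩
        · exact .inl ⟨K, hK.trans ((Finset.filter_subset _ _).trans (Finset.erase_subset _ _)), hKc, hKa⟩
        · refine .inr ⟨insert v I, fun x hx => ?_, ?_, fun x hx y hy hxy => ?_⟩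
          · rcases Finset.mem_insert.1 hx with rfl | hx
            · exact hv
            · exact (Finset.mem_erase.1 (Finset.mem_filter.1 (hI hx)).1).2
          · rw [Finset.card_insert_of_notMem fun h => by simpa using hI h, hIc]
          · have hadj : ∀ z ∈ I, ¬ G.Adj v z := fun z hz => (Finset.mem_filter.1 (hI hz)).2
            rcases Finset.mem_insert.1 hx with rfl | hx' <;> rcases Finset.mem_insert.1 hy with rfl | hy'
            · exact absurd rfl hxy
            · exact hadj y hy'
            · exact fun h => hadj x hx' h.symm
            · exact hIa x hx' y hy' hxy

variable {V : Type} [Fintype V] {G : SimpleGraph V}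

theorem card_dist_le {d : ℕ} (hG : G.Connected) (hd : ∀ v, (Finset.univ.filter (G.Adj v)).card ≤ d)
    (r : V) (i : ℕ) : (Finset.univ.filter fun v => G.dist r v ≤ i).card ≤ (d + 1) ^ i := by
  induction i with
  | zero =>
    rw [pow_zero, Finset.card_le_one]
    intro a ha b hb
    have h : ∀ c, G.dist r c ≤ 0 → r = c := fun c hc => hG.dist_eq_zero_iff.1 (Nat.le_zero.1 hc)
    simp only [Finset.mem_filter, Finset.mem_univ, true_and] at ha hb
    rw [← h a ha, ← h b hb]
  | succ i ih =>
    have hsub : (Finset.univ.filter fun v => G.dist r v ≤ i + 1) ⊆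
        (Finset.univ.filter fun v => G.dist r v ≤ i).biUnion
          fun v => insert v (Finset.univ.filter (G.Adj v)) := by
      intro v hv
      simp only [Finset.mem_filter, Finset.mem_univ, true_and] at hv
      simp only [Finset.mem_biUnion, Finset.mem_filter, Finset.mem_univ, true_and,
        Finset.mem_insert]
      by_cases hvi : G.dist r v ≤ i
      · exact ⟨v, hvi, .inl rfl⟩
      · obtain ⟨p, hp⟩ := hG.exists_walk_length_eq_dist r v
        refine ⟨p.getVert i, (SimpleGraph.dist_le (p.take i)).trans ?_, .inr ?_⟩
        · rw [SimpleGraph.Walk.take_length]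
          omega
        · have := p.adj_getVert_succ (i := i) (by omega)
          rwa [p.getVert_of_length_le (by omega : p.length ≤ i + 1)] at this
    calc _ ≤ _ := Finset.card_le_card hsub
      _ ≤ _ := Finset.card_biUnion_le_card_mul _ _ (d + 1) fun v _ =>
        (Finset.card_insert_le _ _).trans (Nat.succ_le_succ (hd v))
      _ ≤ _ := by rw [pow_succ]; exact Nat.mul_le_mul_right _ ih

theorem exists_geodesic {d D : ℕ} (hG : G.Connected)
    (hd : ∀ v, (Finset.univ.filter (G.Adj v)).card ≤ d) (hV : (d + 1) ^ D < Fintype.card V) :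
    ∃ (r : V) (p : ℕ → V), (∀ i ≤ D, G.dist r (p i) = i) ∧ ∀ i < D, G.Adj (p i) (p (i + 1)) := by
  obtain ⟨r⟩ := hG.nonempty
  obtain ⟨v, hv⟩ : ∃ v, D < G.dist r v := by
    by_contra! h
    have := card_dist_le hG hd r D
    rw [Finset.filter_true_of_mem fun v _ => h v, Finset.card_univ] at this
    omega
  obtain ⟨p, hp⟩ := hG.exists_walk_length_eq_dist r v
  refine ⟨r, p.getVert, fun i hi => le_antisymm ?_ ?_, fun i hi => p.adj_getVert_succ (by omega)⟩
  · have := SimpleGraph.dist_le (p.take i)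
    rw [SimpleGraph.Walk.take_length] at this
    omega
  · have h1 := hG.dist_triangle (u := r) (v := p.getVert i) (w := v)
    have h2 := SimpleGraph.dist_le (p.drop i)
    rw [SimpleGraph.Walk.drop_length] at h2
    omega

theorem exists_clique_or_geodesic (k m D : ℕ) : ∃ N : ℕ, ∀ (V : Type) [Fintype V]
    (G : SimpleGraph V), G.Connected → (∀ v, ∀ I : Finset V, I.card = m → (∀ x ∈ I, G.Adj v x) →
      ∃ x ∈ I, ∃ y ∈ I, x ≠ y ∧ G.Adj x y) → N < Fintype.card V →
    (∃ K : Finset V, K.card = k ∧ ∀ v ∈ K, ∀ w ∈ K, v ≠ w → G.Adj v w) ∨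
    ∃ (r : V) (p : ℕ → V), (∀ i ≤ D, G.dist r (p i) = i) ∧ ∀ i < D, G.Adj (p i) (p (i + 1)) := by
  obtain ⟨d, hd⟩ := exists_clique_or_indep k m
  refine ⟨(d + 1) ^ D, fun V _ G hG hI hV => ?_⟩
  by_cases h : ∀ v, (Finset.univ.filter (G.Adj v)).card ≤ d
  · exact .inr (exists_geodesic hG h hV)
  · push Not at h
    obtain ⟨v, hv⟩ := h
    rcases hd V G _ hv.le with ⟨K, -, hK, hK'⟩ | ⟨I, hI1, hI2, hI3⟩
    · exact .inl ⟨K, hK, hK'⟩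
    · obtain ⟨x, hx, y, hy, hxy, h⟩ := hI v I hI2 fun x hx => (Finset.mem_filter.1 (hI1 hx)).2
      exact absurd h (hI3 x hx y hy hxy)

end Growth

section Localization

variable {V : Type} [Fintype V] {G : SimpleGraph V} {s s' : ℝ} {L N : ℕ}

/-- The form is nonnegative on all sets of at most `N` vertices; `L` is the length of a path which
brings the weight of a root close enough to `s`. -/
structure Tame (G : SimpleGraph V) (s s' : ℝ) (L N : ℕ) : Prop where
  one_lt : 1 < s
  lt : s < s'
  pow_lt : s' ^ 6 < s' ^ 2 + 1
  length : 1 / s ≤ (s' - s) * (s ^ 2) ^ L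
  good : ∀ W : Set V, W.ncard ≤ N → ¬ NegOn G (s + 1 / s) W

theorem exists_length (hs : 1 < s) (hss : s < s') : ∃ L : ℕ, 1 / s ≤ (s' - s) * (s ^ 2) ^ L := by
  obtain ⟨L, hL⟩ := pow_unbounded_of_one_lt (1 / s / (s' - s)) (by nlinarith : 1 < s ^ 2)
  refine ⟨L, ?_⟩
  rw [div_lt_iff₀ (by linarith)] at hL
  linarith

theorem Tame.not_long (h : Tame G s s' L N) (hN : L + 7 ≤ N) {n : ℕ} (hn : L + 1 ≤ n)
    {R W : Set V} : ¬ RBad G n R W := fun hb => by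
  obtain ⟨k, rfl⟩ := Nat.exists_eq_add_of_le hn
  obtain ⟨R', W', -, hb⟩ := hb.truncate
  obtain ⟨X, -, -, hX, hb⟩ := hb.exists_small
  refine h.good X (by omega) ?_
  have hs := h.one_lt
  cases hb with
  | shift a ha aR hb =>
    have ha' : a ∉ X \ R' := fun h => h.2 aR
    refine (hb.neg h.one_lt h.lt h.pow_lt (by positivity) h.length (Tail.single ha')).mono ?_
    rintro v (rfl | hv)
    · exact ha
    · exact hv.1

theorem Tame.localize (h : Tame G s s' L N) (hN : L + 7 ≤ N) {n : ℕ} {R W : Set V}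
    (hb : RBad G n R W) : ∃ X ⊆ W, X.ncard ≤ L + 6 ∧ ∃ m, RBad G m R X := by
  obtain ⟨X, hX, -, hc, hb'⟩ := hb.exists_small
  have : n ≤ L := by
    by_contra! hn
    exact h.not_long hN hn hb
  exact ⟨X, hX, by omega, n, hb'⟩

theorem Tame.pow_lt' (h : Tame G s s' L N) : s ^ 6 < s ^ 2 + 1 := by
  have h0 := h.one_lt
  have h1 := h.pow_lt
  have h2 : s ^ 2 * (s ^ 4 - 1) ≤ s' ^ 2 * (s' ^ 4 - 1) := by
    have := h.lt.le
    have h3 : 0 ≤ s ^ 4 - 1 := by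
      have := one_le_pow₀ h0.le (n := 4)
      linarith
    gcongr
  nlinarith

theorem Tame.star (h : Tame G s s' L N) (hN : 6 ≤ N) (v : V) (I : Finset V) (hI : I.card = 5)
    (hv : ∀ x ∈ I, G.Adj v x) : ∃ x ∈ I, ∃ y ∈ I, x ≠ y ∧ G.Adj x y := by
  by_contra! hadj
  have h0 := h.one_lt
  have hs := (bounds_of_pow_lt h0.le h.pow_lt').2
  have hlam : s + 1 / s < 20 / 9 := by
    have : 1 / s < 1 := by rw [div_lt_one] <;> linarith
    linarith
  have hvI : v ∉ I := fun hm => G.loopless.irrefl v (hv v hm)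
  refine h.good ↑(insert v I) ?_ ⟨fun w => (if w ∈ I then 1 else 0) +
    -2 * (Pi.single v 1 : V → ℝ) w, fun w hw => ?_, ?_⟩
  · rw [Set.ncard_coe_finset]
    exact (Finset.card_insert_le _ _).trans (by omega)
  · simp only [Finset.coe_insert, Set.mem_insert_iff, Finset.mem_coe, not_or] at hw
    simp [hw]
  · rw [qf_add_smul, qf_single]
    have h1 : ∑ w, (if w ∈ I then (1 : ℝ) else 0) * ((s + 1 / s) * (Pi.single v 1 : V → ℝ) w +
        rootSum {u | G.Adj w u} (Pi.single v 1)) = 5 := by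
      have : ∀ w, (if w ∈ I then (1 : ℝ) else 0) * ((s + 1 / s) * (Pi.single v 1 : V → ℝ) w +
          rootSum {u | G.Adj w u} (Pi.single v 1)) = if w ∈ I then 1 else 0 := fun w => by
        by_cases hw : w ∈ I
        · rw [rootSum_single]
          simp [hw, (hv w hw).symm, Pi.single_eq_of_ne (fun h : w = v => hvI (h ▸ hw))]
        · simp [hw]
      rw [Finset.sum_congr rfl fun w _ => this w]
      simp [hI]
    have h2 : qf G (s + 1 / s) (fun w => if w ∈ I then 1 else 0) = (s + 1 / s) * 5 := by
      unfold qf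
      have h3 : ∀ u w, adjMat G u w * ((if u ∈ I then (1 : ℝ) else 0) * (if w ∈ I then 1 else 0)) = 0 :=
        fun u w => by
          by_cases hu : u ∈ I <;> by_cases hw : w ∈ I
          · have : ¬ G.Adj u w := fun huw => hadj u hu w hw huw.ne huw
            simp [adjMat, this]
          all_goals simp [hu, hw]
      rw [Finset.sum_congr rfl fun u _ => Finset.sum_congr rfl fun w _ => h3 u w]
      simp [hI]
    rw [h1, h2]
    linarith

theorem Tame.clique_cases (h : Tame G s s' L N) {M : ℕ} (hM : s / (s - 1) ≤ M) (hN : M + 4 ≤ N)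
    {K : Finset V} (hK : ∀ v ∈ K, ∀ w ∈ K, v ≠ w → G.Adj v w) (hc : 2 * M ≤ K.card) (v : V) :
    (K.filter fun w => ¬ G.Adj v w).card ≤ 1 ∨ (K.filter fun w => G.Adj v w).card ≤ 2 := by
  by_contra! hv
  have hs0 := h.one_lt
  have hs6 := h.pow_lt'
  have hsum := Finset.card_filter_add_card_filter_not (s := K) (fun w => G.Adj v w)
  obtain ⟨a, ha, b, hb, hab⟩ := Finset.one_lt_card.1 hv.1
  obtain ⟨c, hc', d, hd, e, he, hcd, hce, hde⟩ := Finset.two_lt_card.1 hv.2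
  simp only [Finset.mem_filter] at ha hb hc' hd he
  have hvK : v ∉ K := fun hvK => by
    rcases eq_or_ne v a with rfl | hva
    · exact hb.2 (hK v hvK b hb.1 hab)
    · exact ha.2 (hK v hvK a ha.1 hva)
  by_cases hA : M ≤ (K.filter fun w => G.Adj v w).card
  · obtain ⟨T, hT, hTc⟩ := Finset.exists_subset_card_eq hA
    have hTm : ∀ w ∈ T, w ∈ K ∧ G.Adj v w := fun w hw => Finset.mem_filter.1 (hT hw)
    have hcore : RootCore G Set.univ {v, a, b} :=
      .c4 v a b (by simp) (by simp) (by simp) trivial trivial trivial ha.2 hb.2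
        (hK a ha.1 b hb.1 hab)
    have ht : Tail G (s + 1 / s) ↑T Set.univ {v, a, b} s := by
      refine Tail.clique hs0 ?_ (fun x hx y hy => hK x (hTm x hx).1 y (hTm y hy).1) ?_
        (by rwa [hTc])
      · rintro w hw (rfl | rfl | rfl)
        · exact hvK (hTm _ hw).1
        · exact ha.2 (hTm _ hw).2
        · exact hb.2 (hTm _ hw).2
      · rintro w (rfl | rfl | rfl) x hx
        · simpa using (hTm x hx).2.symm
        · simpa using hK x (hTm x hx).1 _ ha.1 fun h => ha.2 (h ▸ (hTm x hx).2)
        · simpa using hK x (hTm x hx).1 _ hb.1 fun h => hb.2 (h ▸ (hTm x hx).2)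
    refine h.good _ ?_ ((hcore.formBad hs0.le hs6).neg (by linarith) le_rfl ht)
    refine (Set.ncard_union_le _ _).trans ?_
    rw [Set.ncard_coe_finset, hTc]
    have := (Set.ncard_insert_le v {a, b}).trans (Nat.succ_le_succ (Set.ncard_insert_le a {b}))
    simp at this
    omega
  · have hA' : M ≤ (K.filter fun w => ¬ G.Adj v w).card := by omega
    obtain ⟨T, hT, hTc⟩ := Finset.exists_subset_card_eq hA'
    have hTm : ∀ w ∈ T, w ∈ K ∧ ¬ G.Adj v w := fun w hw => Finset.mem_filter.1 (hT hw)
    have hne : ∀ w ∈ K, G.Adj v w → w ≠ v := fun w _ h => h.ne'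
    have hcore : RootCore G {w | w ≠ v} {c, d, e, v} :=
      .triple c d e v (by simp) (by simp) (by simp) (by simp) hc'.2.ne' hd.2.ne' he.2.ne'
        (fun h => h rfl) (hK _ hc'.1 _ hd.1 hcd) (hK _ hc'.1 _ he.1 hce) (hK _ hd.1 _ he.1 hde)
        hc'.2.symm hd.2.symm he.2.symm
    have ht : Tail G (s + 1 / s) ↑T {w | w ≠ v} {c, d, e, v} s := by
      refine Tail.clique hs0 ?_ (fun x hx y hy => hK x (hTm x hx).1 y (hTm y hy).1) ?_
        (by rwa [hTc])
      · rintro w hw (rfl | rfl | rfl | rfl)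
        · exact (hTm _ hw).2 hc'.2
        · exact (hTm _ hw).2 hd.2
        · exact (hTm _ hw).2 he.2
        · exact hvK (hTm _ hw).1
      · have hq : ∀ w ∈ K, G.Adj v w → ∀ x ∈ T, (G.Adj x w ↔ w ∈ {w | w ≠ v}) := fun w hw hvw x hx =>
          iff_of_true (hK x (hTm x hx).1 w hw fun h => (hTm x hx).2 (h ▸ hvw)) hvw.ne'
        rintro w (rfl | rfl | rfl | rfl) x hx
        · exact hq _ hc'.1 hc'.2 x hx
        · exact hq _ hd.1 hd.2 x hx
        · exact hq _ he.1 he.2 x hx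
        · exact iff_of_false (fun h => (hTm x hx).2 h.symm) fun h => h rfl
    refine h.good _ ?_ ((hcore.formBad hs0.le hs6).neg (by linarith) le_rfl ht)
    refine (Set.ncard_union_le _ _).trans ?_
    rw [Set.ncard_coe_finset, hTc]
    have := (Set.ncard_insert_le c {d, e, v}).trans (Nat.succ_le_succ
      ((Set.ncard_insert_le d {e, v}).trans (Nat.succ_le_succ (Set.ncard_insert_le e {v}))))
    simp at this
    omega

theorem linked_univ {V : Type} {G : SimpleGraph V} (hG : G.Connected) {R : Set V} (hR : R.Nonempty) :
    Linked G (fun _ : Unit => R) Set.univ := by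
  intro S _ hS hcl
  obtain ⟨x, hx⟩ := hS
  obtain ⟨y, hy⟩ := hR
  refine ⟨y, ?_, (), hy⟩
  obtain ⟨p⟩ := hG.preconnected x y
  induction p with
  | nil => exact hx
  | cons h p ih => exact ih (hcl _ hx _ trivial h) hy

theorem Tame.represented_of_clique (h : Tame G s s' L N) (hG : G.Connected) {M : ℕ}
    (hM : s / (s - 1) ≤ M) (hN : M + L + 7 ≤ N) {K : Finset V}
    (hK : ∀ v ∈ K, ∀ w ∈ K, v ≠ w → G.Adj v w) (hc : 2 * M + 3 * (L + 6) ≤ K.card) :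
    ∃ R, Represented G (fun _ : Unit => R) Set.univ := by
  set R : Set V := {v | (K.filter fun w => ¬ G.Adj v w).card ≤ 1} with hR
  have hKR : ∀ v ∈ K, v ∈ R := fun v hv => by
    refine Finset.card_le_one.2 fun a ha b hb => ?_
    simp only [Finset.mem_filter] at ha hb
    by_contra hab
    rcases eq_or_ne v a with rfl | hva
    · exact hb.2 (hK v hv b hb.1 hab)
    · exact ha.2 (hK v hv a ha.1 hva)
  obtain ⟨v₀, hv₀⟩ : K.Nonempty := Finset.card_pos.1 (by omega)
  refine ⟨R, Clean.represented ⟨fun _ n hb => ?_, fun i j hij => absurd rfl hij, fun y _ i j k _ _ _ =>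
    .inl rfl⟩ (linked_univ hG ⟨v₀, hKR v₀ hv₀⟩)⟩
  obtain ⟨X, -, hX, m, hb⟩ := h.localize (by omega) hb
  set exc : V → Finset V := fun x => insert x (if x ∈ R then K.filter fun w => ¬ G.Adj x w
    else K.filter fun w => G.Adj x w) with hexc
  have hexc3 : ∀ x, (exc x).card ≤ 3 := fun x => by
    refine (Finset.card_insert_le _ _).trans (Nat.succ_le_succ ?_)
    split_ifs with hx
    · exact le_trans hx one_le_two
    · exact (h.clique_cases hM (by omega) hK (by omega) x).resolve_left hx
  have hE : (X.toFinset.biUnion exc).card ≤ (L + 6) * 3 :=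
    (Finset.card_biUnion_le_card_mul _ _ 3 fun x _ => hexc3 x).trans
      (Nat.mul_le_mul_right 3 (by rwa [← Set.ncard_eq_toFinset_card']))
  have hK' : M ≤ (K \ X.toFinset.biUnion exc).card := by
    have := Finset.le_card_sdiff (X.toFinset.biUnion exc) K
    omega
  obtain ⟨T, hT, hTc⟩ := Finset.exists_subset_card_eq hK'
  have hTm : ∀ w ∈ T, w ∈ K ∧ ∀ x ∈ X, w ∉ exc x := fun w hw => by
    simpa using hT hw
  have hs0 := h.one_lt
  have ht : Tail G (s + 1 / s) ↑T R X s := by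
    refine Tail.clique hs0 ?_ (fun x hx y hy => hK x (hTm x hx).1 y (hTm y hy).1) ?_
      (by rwa [hTc])
    · exact fun v hv hvX => (hTm v hv).2 v hvX (by simp [hexc])
    · intro w hw v hv
      have h1 := (hTm v hv).2 w hw
      simp only [hexc, Finset.mem_insert, not_or] at h1
      by_cases hwR : w ∈ R
      · simp only [hwR, if_true, Finset.mem_filter, not_and, not_not] at h1
        exact iff_of_true (h1.2 (hTm v hv).1).symm hwR
      · simp only [hwR, if_false, Finset.mem_filter, not_and] at h1
        exact iff_of_false (fun h => h1.2 (hTm v hv).1 h.symm) hwR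
  refine h.good (↑T ∪ X) ?_ (hb.neg hs0 h.lt h.pow_lt le_rfl ?_ (by simpa using ht))
  · refine (Set.ncard_union_le _ _).trans ?_
    rw [Set.ncard_coe_finset, hTc]
    omega
  · have := h.lt
    have : 0 < s' - s := by linarith
    positivity

end Localization

section Geodesics

variable {V : Type} {G : SimpleGraph V}

/-- A path along the levels of the distance from `r`. -/
structure Geodesic (G : SimpleGraph V) (r : V) (p : ℕ → V) (D : ℕ) : Prop where
  dist : ∀ i ≤ D, G.dist r (p i) = i
  adj : ∀ i < D, G.Adj (p i) (p (i + 1))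

/-- The neighbourhood of the edge from `p k` to `p (k + 1)`. -/
def link (G : SimpleGraph V) (p : ℕ → V) (k : ℕ) : Set V :=
  {y | y = p k ∨ y = p (k + 1) ∨ G.Adj y (p k) ∧ G.Adj y (p (k + 1))}

variable {r : V} {p : ℕ → V} {D : ℕ}

theorem dist_le_of_adj (hG : G.Connected) {x y : V} (h : G.Adj x y) : G.dist r y ≤ G.dist r x + 1 := by
  have := hG.dist_triangle (u := r) (v := x) (w := y)
  rwa [SimpleGraph.dist_eq_one_iff_adj.2 h] at this

theorem Geodesic.inj (h : Geodesic G r p D) {i j : ℕ} (hi : i ≤ D) (hj : j ≤ D) (hij : p i = p j) :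
    i = j := by rw [← h.dist i hi, hij, h.dist j hj]

theorem Geodesic.adj_iff (h : Geodesic G r p D) (hG : G.Connected) {i j : ℕ} (hi : i ≤ D) (hj : j ≤ D) :
    G.Adj (p i) (p j) ↔ i + 1 = j ∨ j + 1 = i := by
  constructor
  · intro ha
    have h1 := dist_le_of_adj hG (r := r) ha
    have h2 := dist_le_of_adj hG (r := r) ha.symm
    rw [h.dist i hi, h.dist j hj] at h1 h2
    have : i ≠ j := fun e => ha.ne (e ▸ rfl)
    omega
  · rintro (rfl | rfl)
    · exact h.adj i (by omega)
    · exact (h.adj j (by omega)).symm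

theorem Geodesic.rbad_shift (h : Geodesic G r p D) (hG : G.Connected) {j m : ℕ} {W : Set V}
    (hb : RBad G m {x | G.Adj (p j) x} W) (k : ℕ) (hk : j + k ≤ D)
    (hW : ∀ w ∈ W, ∀ i, j < i → i ≤ j + k → ¬ G.Adj (p i) w) :
    RBad G (m + k) {x | G.Adj (p (j + k)) x} (W ∪ {x | ∃ i, j ≤ i ∧ i < j + k ∧ x = p i}) := by
  induction k with
  | zero => exact hb.mono Set.subset_union_left
  | succ k ih =>
    have := ih (by omega) fun w hw i h1 h2 => hW w hw i h1 (by omega)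
    refine RBad.shift (p (j + k)) (.inr ⟨j + k, by omega, by omega, rfl⟩)
      (h.adj (j + k) (by omega)).symm (this.mono ?_)
    rintro x (hx | ⟨i, h1, h2, rfl⟩)
    · exact ⟨.inl hx, hW x hx _ (by omega) le_rfl⟩
    · refine ⟨.inr ⟨i, h1, by omega, rfl⟩, fun hx => ?_⟩
      have := (h.adj_iff hG (by omega) (by omega)).1 hx
      omega

variable [Fintype V]

/-- In a represented set the form at `2` is a sum of squares. -/
theorem qf_two_eq {W : Set V} {κ : Type} [Fintype κ] {ρ : V → κ → ℤ}
    (hρ : ∀ x ∈ W, ∀ y ∈ W, ∑ k, ρ x k * ρ y k = if x = y then 2 else if G.Adj x y then 1 else 0)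
    {x : V → ℝ} (hx : ∀ v ∉ W, x v = 0) : qf G 2 x = ∑ k, (∑ v, x v * ρ v k) ^ 2 := by
  have h1 : ∀ k, (∑ v, x v * (ρ v k : ℝ)) ^ 2 =
      ∑ v, ∑ w, x v * x w * ((ρ v k * ρ w k : ℤ) : ℝ) := fun k => by
    rw [sq, Finset.sum_mul_sum]
    exact Finset.sum_congr rfl fun v _ => Finset.sum_congr rfl fun w _ => by push_cast; ring
  have h2 : ∑ k, (∑ v, x v * (ρ v k : ℝ)) ^ 2 =
      ∑ v, ∑ w, x v * x w * ((∑ k, ρ v k * ρ w k : ℤ) : ℝ) := by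
    rw [Finset.sum_congr rfl fun k _ => h1 k, Finset.sum_comm]
    refine Finset.sum_congr rfl fun v _ => ?_
    rw [Finset.sum_comm]
    refine Finset.sum_congr rfl fun w _ => ?_
    push_cast
    rw [Finset.mul_sum]
  have h3 : ∀ v w, x v * x w * ((∑ k, ρ v k * ρ w k : ℤ) : ℝ) =
      (if v = w then 2 * x v ^ 2 else 0) + adjMat G v w * (x v * x w) := fun v w => by
    by_cases hv : v ∈ W
    · by_cases hw : w ∈ W
      · rw [hρ v hv w hw]
        by_cases hvw : v = w
        · subst hvw
          simp [adjMat]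
          ring
        · by_cases ha : G.Adj v w <;> simp [adjMat, hvw, ha]
      · simp [hx w hw]
        rintro rfl
        exact hx _ hw
    · simp [hx v hv]
  rw [h2, Finset.sum_congr rfl fun v _ => Finset.sum_congr rfl fun w _ => h3 v w]
  simp only [Finset.sum_add_distrib, Finset.sum_ite_eq, Finset.mem_univ, if_true]
  rw [← Finset.mul_sum]
  rfl

theorem Represented.qf_nonneg {ι : Type} {D : ι → Set V} (h : Represented G D Set.univ) (x : V → ℝ) :
    0 ≤ qf G 2 x := by
  obtain ⟨κ, _, j, ρ, -, -, hρ⟩ := h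
  rw [qf_two_eq hρ fun v hv => absurd trivial hv]
  exact Finset.sum_nonneg fun k _ => sq_nonneg _

theorem not_formBad_of_unit {R W : Set V} {κ : Type} [Fintype κ] {ρ : V → κ → ℤ}
    (hρ : ∀ x ∈ W, ∀ y ∈ W, ∑ k, ρ x k * ρ y k = if x = y then 2 else if G.Adj x y then 1 else 0)
    {u : κ → ℤ} (hu : ∑ k, u k * u k = 1) (hR : ∀ x ∈ W, ∑ k, ρ x k * u k = if x ∈ R then 1 else 0) :
    ¬ FormBad G 1 R W := by
  rintro ⟨x, hx, hn⟩
  have h1 : rootSum R x = ∑ k, (∑ v, x v * (ρ v k : ℝ)) * (u k : ℝ) := by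
    simp only [Finset.sum_mul]
    rw [Finset.sum_comm]
    refine Finset.sum_congr rfl fun v _ => ?_
    by_cases hv : v ∈ W
    · have h := congrArg (fun n : ℤ => x v * (n : ℝ)) (hR v hv)
      simp only [Int.cast_sum, Int.cast_mul, Finset.mul_sum] at h
      simp only [mul_assoc]
      rw [h]
      split_ifs <;> simp
    · simp [hx v hv]
  have h2 : ∑ k, (u k : ℝ) ^ 2 = 1 := by
    rw [← Int.cast_one, ← hu]
    push_cast
    exact Finset.sum_congr rfl fun k _ => by ring
  have h3 := Finset.sum_mul_sq_le_sq_mul_sq Finset.univ (fun k => ∑ v, x v * (ρ v k : ℝ))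
    (fun k => (u k : ℝ))
  rw [h2, ← h1, ← qf_two_eq hρ hx] at h3
  norm_num at hn
  linarith

variable {s s' : ℝ} {L N : ℕ}

theorem Tame.not_rbad (ht : Tame G s s' L N) (hN : L + 7 ≤ N) (h : Geodesic G r p D)
    (hG : G.Connected) {j m : ℕ} (hj : j + (L + 1) ≤ D) {W : Set V}
    (hW : ∀ w ∈ W, ∀ i, j < i → i ≤ j + (L + 1) → ¬ G.Adj (p i) w) :
    ¬ RBad G m {x | G.Adj (p j) x} W := fun hb =>
  ht.not_long hN (by omega) (h.rbad_shift hG hb (L + 1) hj hW)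

theorem Tame.exists_pair (ht : Tame G s s' L N) (hN : L + 7 ≤ N) (h : Geodesic G r p D)
    (hG : G.Connected) {x : V} (hx : ∀ i ≤ D, x ≠ p i) {k : ℕ} (hk : 3 ≤ k) (hkD : k + (L + 3) ≤ D)
    (hxk : G.Adj x (p k)) : ∃ i, ∀ m ≤ D, G.Adj x (p m) ↔ m = i ∨ m = i + 1 := by
  have hlev : ∀ m ≤ D, G.Adj x (p m) → m ≤ G.dist r x + 1 ∧ G.dist r x ≤ m + 1 := fun m hm hxm => by
    have h1 := dist_le_of_adj hG (r := r) hxm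
    have h2 := dist_le_of_adj hG (r := r) hxm.symm
    rw [h.dist m hm] at h1 h2
    exact ⟨h1, h2⟩
  obtain ⟨l, hl⟩ : ∃ l, G.dist r x = l + 1 := ⟨G.dist r x - 1, by have := hlev k (by omega) hxk; omega⟩
  have hkl := hlev k (by omega) hxk
  rw [hl] at hkl
  have hadj : ∀ {i j : ℕ}, i ≤ D → j ≤ D → (i + 1 = j ∨ j + 1 = i) → G.Adj (p i) (p j) :=
    fun hi hj => (h.adj_iff hG hi hj).2
  have hnadj : ∀ {i j : ℕ}, i ≤ D → j ≤ D → ¬ (i + 1 = j ∨ j + 1 = i) → ¬ G.Adj (p i) (p j) :=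
    fun hi hj hn ha => hn ((h.adj_iff hG hi hj).1 ha)
  have single : ∀ i, 2 ≤ i → i + (L + 1) ≤ D → G.Adj x (p i) →
      (∀ m ≤ D, G.Adj x (p m) → m = i) → False := fun i hi hiD hxi hm => by
    obtain ⟨i, rfl⟩ := Nat.exists_eq_add_of_le' hi
    refine ht.not_rbad hN h hG (j := i + 2) (m := 0) (W := {x, p i, p (i + 1)}) hiD ?_
      (.core (.c1 (p (i + 1)) x (p i) (by simp) (by simp) (by simp)
        (hadj (by omega) (by omega) (by omega)) hxi.symm
        (hnadj (by omega) (by omega) (by omega)) ?_ (hadj (by omega) (by omega) (by omega)) ?_))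
    · rintro w (rfl | rfl | rfl) m h1 h2
      · exact fun ha => by have := hm m (by omega) ha.symm; omega
      · exact hnadj (by omega) (by omega) (by omega)
      · exact hnadj (by omega) (by omega) (by omega)
    · exact fun ha => by have := hm _ (by omega) ha.symm; omega
    · exact fun ha => by have := hm _ (by omega) ha.symm; omega
  by_cases h0 : G.Adj x (p l) <;> by_cases h1 : G.Adj x (p (l + 1)) <;>
    by_cases h2 : G.Adj x (p (l + 2))
  · exfalso
    obtain ⟨l, rfl⟩ : ∃ l', l = l' + 1 := ⟨l - 1, by omega⟩
    refine ht.not_rbad hN h hG (j := l + 3) (m := 0) (W := {x, p l, p (l + 1), p (l + 2)})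
      (by omega) ?_ (.core (.pair x (p (l + 2)) (by simp) (by simp) h2.symm
        (hadj (by omega) (by omega) (by omega)) h1 (.c7 (p (l + 1)) (p l) ⟨by simp, ?_⟩ ⟨by simp, ?_⟩
          h0 ?_ ?_ ?_ ?_)))
    · rintro w (rfl | rfl | rfl | rfl) m h1 h2
      · exact fun ha => by have := hlev m (by omega) ha.symm; omega
      all_goals exact hnadj (by omega) (by omega) (by omega)
    · exact hnadj (by omega) (by omega) (by omega)
    · exact hnadj (by omega) (by omega) (by omega)
    · exact hadj (by omega) (by omega) (by omega)
    · exact fun ha => by have := hlev l (by omega) ha; omega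
    · exact hnadj (by omega) (by omega) (by omega)
    · exact hadj (by omega) (by omega) (by omega)
  · refine ⟨l, fun m hm => ⟨fun ha => ?_, ?_⟩⟩
    · have := hlev m hm ha
      have : m ≠ l + 2 := by rintro rfl; exact h2 ha
      omega
    · rintro (rfl | rfl) <;> assumption
  · exfalso
    refine ht.not_rbad hN h hG (j := l + 2) (m := 0) (W := {x, p l, p (l + 1)})
      (by omega) ?_ (.core (.c2 x (p (l + 1)) (p l) (by simp) (by simp) (by simp) h2.symm
        (hadj (by omega) (by omega) (by omega)) (hnadj (by omega) (by omega) (by omega))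
        (hx _ (by omega)) h1 h0.symm (hadj (by omega) (by omega) (by omega))))
    rintro w (rfl | rfl | rfl) m h1 h2
    · exact fun ha => by have := hlev m (by omega) ha.symm; omega
    all_goals exact hnadj (by omega) (by omega) (by omega)
  · refine (single l (by have : k = l ∨ k = l + 1 ∨ k = l + 2 := by omega
                         rcases this with rfl | rfl | rfl <;> first | omega | contradiction)
      (by omega) h0 fun m hm ha => ?_).elim
    have := hlev m hm ha
    have : m ≠ l + 2 := by rintro rfl; exact h2 ha
    have : m ≠ l + 1 := by rintro rfl; exact h1 ha
    omega
  · refine ⟨l + 1, fun m hm => ⟨fun ha => ?_, ?_⟩⟩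
    · have := hlev m hm ha
      have : m ≠ l := by rintro rfl; exact h0 ha
      omega
    · rintro (rfl | rfl) <;> assumption
  · refine (single (l + 1) (by omega) (by omega) h1 fun m hm ha => ?_).elim
    have := hlev m hm ha
    have : m ≠ l + 2 := by rintro rfl; exact h2 ha
    have : m ≠ l := by rintro rfl; exact h0 ha
    omega
  · refine (single (l + 2) (by omega) (by omega) h2 fun m hm ha => ?_).elim
    have := hlev m hm ha
    have : m ≠ l + 1 := by rintro rfl; exact h1 ha
    have : m ≠ l := by rintro rfl; exact h0 ha
    omega
  · have : k = l ∨ k = l + 1 ∨ k = l + 2 := by omega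
    rcases this with rfl | rfl | rfl <;> contradiction

theorem Tame.gram_eq (ht : Tame G s s' L N) (hN : L + 7 ≤ N) (h : Geodesic G r p D)
    (hG : G.Connected) {k : ℕ} (hk : 2 ≤ k) (hkD : k + (L + 4) ≤ D) (y : V) :
    (if y = p (k + 1) then 2 else if G.Adj y (p (k + 1)) then 1 else 0 : ℤ) =
      (if y ∈ link G p k then 1 else 0) + if y ∈ link G p (k + 1) then 1 else 0 := by
  by_cases hy : ∀ i ≤ D, y ≠ p i
  · have h0 := hy k (by omega)
    have h1 := hy (k + 1) (by omega)
    have h2 := hy (k + 1 + 1) (by omega)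
    by_cases hk1 : G.Adj y (p (k + 1))
    · obtain ⟨i, hi⟩ := ht.exists_pair hN h hG hy (k := k + 1) (by omega) (by omega) hk1
      have e1 := (hi (k + 1) (by omega)).1 hk1
      rcases e1 with rfl | e1
      · have e2 : ¬ G.Adj y (p k) := fun ha => by have := (hi k (by omega)).1 ha; omega
        have e3 : G.Adj y (p (k + 1 + 1)) := (hi _ (by omega)).2 (.inr rfl)
        simp [link, h0, h1, h2, hk1, e2, e3]
      · obtain rfl : k = i := by omega
        have e2 : G.Adj y (p k) := (hi k (by omega)).2 (.inl rfl)
        have e3 : ¬ G.Adj y (p (k + 1 + 1)) := fun ha => by have := (hi _ (by omega)).1 ha; omega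
        simp [link, h0, h1, h2, hk1, e2, e3]
    · simp [link, h0, h1, h2, hk1]
  · push Not at hy
    obtain ⟨i, hi, rfl⟩ := hy
    have e : ∀ m ≤ D, (p i = p m ↔ i = m) := fun m hm => ⟨h.inj hi hm, fun e => e ▸ rfl⟩
    simp only [link, Set.mem_ofPred_eq, e k (by omega), e (k + 1) (by omega), e (k + 1 + 1) (by omega),
      h.adj_iff hG hi (show k ≤ D by omega), h.adj_iff hG hi (show k + 1 ≤ D by omega),
      h.adj_iff hG hi (show k + 1 + 1 ≤ D by omega)]
    split_ifs <;> omega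

end Geodesics

section Dichotomy

variable {V : Type} [Fintype V] {G : SimpleGraph V} {r : V} {p : ℕ → V} {s s' : ℝ} {D L N : ℕ}

theorem Tame.exists_unit (ht : Tame G s s' L N) (hN : L + 7 ≤ N) (h : Geodesic G r p D)
    (hG : G.Connected) {j : ℕ} (hj : j + (L + 3) ≤ D) {W : Set V} (hpj : p (j + 1) ∉ W)
    (hjW : ∀ y ∈ W, G.Adj (p (j + 1)) y → y = p j) (hpW : ∀ i, 3 ≤ i → i ≤ j → p i ∈ W) {κ : Type}
    [Fintype κ] {ρ : V → κ → ℤ} {q : κ}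
    (hq : ∀ x ∈ W, ρ x q = if x ∈ {x | G.Adj (p (j + 1)) x} then 1 else 0)
    (hρ : ∀ x ∈ W, ∀ y ∈ W, ∑ k, ρ x k * ρ y k = if x = y then 2 else if G.Adj x y then 1 else 0)
    {k t : ℕ} (hk : 2 ≤ k) (hkt : k + t = j) : ∃ u : κ → ℤ, ∑ i, u i * u i = 1 ∧
      ∀ y ∈ W, ∑ i, ρ y i * u i = if y ∈ link G p k then 1 else 0 := by
  induction t generalizing k with
  | zero =>
    obtain rfl : k = j := hkt
    refine ⟨Pi.single q 1, by simp [Pi.single_apply], fun y hy => ?_⟩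
    have h1 : y ∈ link G p k ↔ G.Adj (p (k + 1)) y := by
      constructor
      · rintro (rfl | rfl | h1)
        · exact (h.adj k (by omega)).symm
        · exact absurd hy hpj
        · exact h1.2.symm
      · exact fun h1 => .inl (hjW y hy h1)
    simp only [h1]
    simpa [Pi.single_apply] using hq y hy
  | succ t ih =>
    obtain ⟨u, hu, huW⟩ := ih (k := k + 1) (by omega) (by omega)
    have hpk := hpW (k + 1) (by omega) (by omega)
    refine ⟨fun i => ρ (p (k + 1)) i - u i, ?_, fun y hy => ?_⟩
    · have h1 := hρ _ hpk _ hpk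
      have h2 := huW _ hpk
      rw [if_pos rfl] at h1
      rw [if_pos (.inl rfl)] at h2
      have h3 : ∀ i, (ρ (p (k + 1)) i - u i) * (ρ (p (k + 1)) i - u i) =
          ρ (p (k + 1)) i * ρ (p (k + 1)) i - 2 * (ρ (p (k + 1)) i * u i) + u i * u i := fun i => by
        ring
      simp only [h3, Finset.sum_add_distrib, Finset.sum_sub_distrib, ← Finset.mul_sum, h1, h2, hu]
      norm_num
    · have h1 := hρ _ hy _ hpk
      have h2 := huW _ hy
      rw [ht.gram_eq hN h hG hk (by omega)] at h1
      simp only [mul_sub, Finset.sum_sub_distrib, h1, h2]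
      ring

/-- A long geodesic has a long segment away from any given small set. -/
theorem Geodesic.exists_far (h : Geodesic G r p D) (hG : G.Connected) (X : Set V) (L c : ℕ)
    (hD : c + (L + 3) * (3 * X.ncard + 1) ≤ D) : ∃ j, c ≤ j ∧ j + (L + 2) ≤ D ∧
      ∀ x ∈ X, ∀ i, j ≤ i → i ≤ j + (L + 2) → x ≠ p i ∧ ¬ G.Adj (p i) x := by
  by_contra! hcon
  have : Nonempty V := ⟨r⟩
  have hbound : ∀ t ∈ Finset.range (3 * X.ncard + 1), c + (L + 3) * t + (L + 2) ≤ D := fun t ht => by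
    have : t + 1 ≤ 3 * X.ncard + 1 := Finset.mem_range.1 ht
    have := Nat.mul_le_mul_left (L + 3) this
    rw [mul_add] at this
    omega
  have hx : ∀ t ∈ Finset.range (3 * X.ncard + 1), ∃ x ∈ X, ∃ i, c + (L + 3) * t ≤ i ∧
      i ≤ c + (L + 3) * t + (L + 2) ∧ i ≤ G.dist r x + 1 ∧ G.dist r x ≤ i + 1 := fun t ht => by
    obtain ⟨x, hx, i, h1, h2, h3⟩ := hcon (c + (L + 3) * t) (by omega) (hbound t ht)
    have h4 := h.dist i (h2.trans (hbound t ht))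
    refine ⟨x, hx, i, h1, h2, ?_⟩
    by_cases hxi : x = p i
    · rw [hxi]
      omega
    · have h5 := dist_le_of_adj hG (r := r) (h3 hxi)
      have h6 := dist_le_of_adj hG (r := r) (h3 hxi).symm
      omega
  choose! x hxX i hi1 hi2 hi3 hi4 using hx
  have hmaps : ∀ t ∈ Finset.range (3 * X.ncard + 1),
      (x t, G.dist r (x t) + 1 - i t) ∈ X.toFinset ×ˢ Finset.range 3 := fun t ht => by
    simp only [Finset.mem_product, Set.mem_toFinset, Finset.mem_range]
    have := hi3 t ht
    have := hi4 t ht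
    exact ⟨hxX t ht, by omega⟩
  obtain ⟨t, ht, t', ht', hne, heq⟩ := Finset.exists_ne_map_eq_of_card_lt_of_maps_to
    (by rw [Finset.card_product, Finset.card_range, Finset.card_range,
          ← Set.ncard_eq_toFinset_card']; omega) hmaps
  rw [Prod.mk.injEq] at heq
  have h1 : i t = i t' := by
    have := hi3 t ht
    have := hi3 t' ht'
    have := hi4 t ht
    have := hi4 t' ht'
    have h5 := heq.2
    rw [heq.1] at *
    omega
  have h2 : (L + 3) * t < (L + 3) * (t' + 1) := by
    have := hi1 t ht; have := hi2 t' ht'; rw [mul_add]; omega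
  have h3 : (L + 3) * t' < (L + 3) * (t + 1) := by
    have := hi1 t' ht'; have := hi2 t ht; rw [mul_add]; omega
  have := Nat.lt_of_mul_lt_mul_left h2
  have := Nat.lt_of_mul_lt_mul_left h3
  omega

theorem Tame.represented_of_geodesic (ht : Tame G s s' L N) (hN : L + 7 ≤ N) (h : Geodesic G r p D)
    (hG : G.Connected) (hD : 4 + (L + 3) * (3 * (L + 6) + 1) ≤ D) :
    ∃ R, Represented G (fun _ : Unit => R) Set.univ := by
  refine ⟨link G p 2, Clean.represented ⟨fun _ n hb => ?_, fun i j hij => absurd rfl hij,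
    fun y _ i j k _ _ _ => .inl rfl⟩ (linked_univ hG ⟨p 2, .inl rfl⟩)⟩
  obtain ⟨X, -, hX, m, hb⟩ := ht.localize hN hb
  obtain ⟨j, hj4, hjD, hfar⟩ := h.exists_far hG X L 4 (le_trans (by gcongr) hD)
  obtain ⟨j, rfl⟩ := Nat.exists_eq_add_of_le' (show 1 ≤ j by omega)
  set U : Set V := X ∪ {x | ∃ i, 3 ≤ i ∧ i ≤ j ∧ x = p i} with hU
  set W : Set V := {w | Relation.ReflTransGen (fun a b => G.Adj a b ∧ b ∈ U) (p j) w} with hW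
  have hpjW : p j ∈ W := Relation.ReflTransGen.refl
  have hWU : ∀ w ∈ W, w ∈ U := fun w hw => by
    rcases Relation.ReflTransGen.cases_tail hw with rfl | ⟨_, -, h1⟩
    · exact .inr ⟨j, by omega, le_rfl, rfl⟩
    · exact h1.2
  have hcl : ∀ w ∈ W, ∀ u ∈ U, G.Adj w u → u ∈ W := fun w hw u hu hwu => hw.tail ⟨hwu, hu⟩
  have hpW' : ∀ t i, 3 ≤ i → i + t = j → p i ∈ W := fun t => by
    induction t with
    | zero => rintro i - rfl; exact hpjW
    | succ t ih =>
      exact fun i hi hij => hcl _ (ih (i + 1) (by omega) (by omega)) _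
        (.inr ⟨i, hi, by omega, rfl⟩) (h.adj i (by omega)).symm
  have hpW : ∀ i, 3 ≤ i → i ≤ j → p i ∈ W := fun i hi hij => hpW' (j - i) i hi (by omega)
  have hUfar : ∀ w ∈ U, ∀ i, j + 1 < i → i ≤ j + 1 + (L + 1) → ¬ G.Adj (p i) w := by
    rintro w (hw | ⟨i', h1, h2, rfl⟩) i hi1 hi2
    · exact (hfar w hw i (by omega) (by omega)).2
    · rw [h.adj_iff hG (by omega) (by omega)]
      omega
  have hpU : p (j + 1) ∉ U := by
    rintro (hw | ⟨i, h1, h2, h3⟩)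
    · exact (hfar _ hw (j + 1) (by omega) (by omega)).1 rfl
    · have := h.inj (by omega) (by omega) h3
      omega
  have hjU : ∀ y ∈ U, G.Adj (p (j + 1)) y → y = p j := by
    rintro y (hy | ⟨i, h1, h2, rfl⟩) ha
    · exact absurd ha (hfar _ hy (j + 1) (by omega) (by omega)).2
    · have := (h.adj_iff hG (by omega) (by omega)).1 ha
      obtain rfl : i = j := by omega
      rfl
  have hrep : Represented G (fun _ : Unit => {x | G.Adj (p (j + 1)) x}) W := by
    refine Clean.represented ⟨fun _ n => ht.not_rbad hN h hG (by omega) fun w hw => hUfar w (hWU w hw),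
      fun i j hij => absurd rfl hij, fun y _ i j k _ _ _ => .inl rfl⟩ ?_
    intro S hS ⟨x, hx⟩ hScl
    refine ⟨p j, ?_, (), (h.adj j (by omega)).symm⟩
    have key : ∀ w, w ∈ W → w ∈ S → p j ∈ S := fun w hw => by
      induction hw with
      | refl => exact id
      | tail hab hbc ih => exact fun hc => ih (hScl _ hc _ hab hbc.1.symm)
    exact key x (hS hx) hx
  obtain ⟨κ, _, q, ρ, -, hq, hρ⟩ := hrep
  obtain ⟨u, hu, huW⟩ := ht.exists_unit hN h hG (j := j) (by omega) (fun h => hpU (hWU _ h))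
    (fun y hy => hjU y (hWU y hy)) hpW (fun x hx => hq x hx ()) hρ (k := 2) (t := j - 2) le_rfl
    (by omega)
  refine not_formBad_of_unit hρ hu huW ((hb.closed (Z := W) ?_ fun z hz w hw => hcl z hz w (.inl hw)).formBad
    le_rfl (by norm_num))
  have h3 := hpW 3 le_rfl (by omega)
  rintro x ⟨rfl | rfl | hx, hxX⟩
  · exact hcl _ h3 _ (.inl hxX) (h.adj 2 (by omega)).symm
  · exact h3
  · exact hcl _ h3 _ (.inl hxX) hx.2.symm

/-- Large connected graphs without small obstructions are represented. -/
theorem exists_bound_or_represented (hs : 1 < s) (hss : s < s') (hs6 : s' ^ 6 < s' ^ 2 + 1) :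
    ∃ N, ∀ (V : Type) [Fintype V] (G : SimpleGraph V), G.Connected →
      (∀ W : Set V, W.ncard ≤ N → ¬ NegOn G (s + 1 / s) W) → Fintype.card V ≤ N ∨
        ∃ R, Represented G (fun _ : Unit => R) Set.univ := by
  obtain ⟨L, hL⟩ := exists_length hs hss
  obtain ⟨M, hM⟩ := exists_nat_ge (s / (s - 1))
  obtain ⟨N, hN⟩ := exists_clique_or_geodesic (2 * M + 3 * (L + 6)) 5
    (4 + (L + 3) * (3 * (L + 6) + 1))
  refine ⟨N + M + L + 7, fun V _ G hG hgood => ?_⟩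
  have ht : Tame G s s' L (N + M + L + 7) := ⟨hs, hss, hs6, hL, hgood⟩
  refine or_iff_not_imp_left.2 fun hV => ?_
  rcases hN V G hG (fun v I hI hv => ht.star (by omega) v I hI hv) (by omega) with
    ⟨K, hKc, hK⟩ | ⟨r, p, h1, h2⟩
  · exact ht.represented_of_clique hG hM (by omega) hK hKc.ge
  · exact ht.represented_of_geodesic (by omega) ⟨h1, h2⟩ hG le_rfl

end Dichotomy

section Minimal

variable {V : Type} [Fintype V] {G : SimpleGraph V} {lam : ℝ}

/-- The form is negative somewhere, but not on any vector with a zero coordinate. -/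
def MinBad (G : SimpleGraph V) (lam : ℝ) : Prop :=
  (∃ x, qf G lam x < 0) ∧ ∀ x : V → ℝ, (∃ v, x v = 0) → 0 ≤ qf G lam x

theorem qf_add_indicator (lam : ℝ) {S : Set V} (hS : ∀ v ∈ S, ∀ w, G.Adj v w → w ∈ S) (x : V → ℝ) :
    qf G lam x = qf G lam (fun v => if v ∈ S then x v else 0) +
      qf G lam (fun v => if v ∈ S then 0 else x v) := by
  unfold qf
  have h1 : ∑ v, x v ^ 2 = ∑ v, (if v ∈ S then x v else 0) ^ 2 +
      ∑ v, (if v ∈ S then 0 else x v) ^ 2 := by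
    rw [← Finset.sum_add_distrib]
    exact Finset.sum_congr rfl fun v _ => by split_ifs <;> ring
  have h2 : ∑ v, ∑ w, adjMat G v w * (x v * x w) =
      ∑ v, ∑ w, adjMat G v w * ((if v ∈ S then x v else 0) * (if w ∈ S then x w else 0)) +
      ∑ v, ∑ w, adjMat G v w * ((if v ∈ S then 0 else x v) * (if w ∈ S then 0 else x w)) := by
    simp only [← Finset.sum_add_distrib]
    refine Finset.sum_congr rfl fun v _ => Finset.sum_congr rfl fun w _ => ?_
    by_cases ha : G.Adj v w
    · have : v ∈ S ↔ w ∈ S := ⟨fun h => hS v h w ha, fun h => hS w h v ha.symm⟩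
      by_cases hw : w ∈ S <;> simp [this, hw]
    · simp [adjMat, ha]
  rw [h1, h2]
  ring

theorem MinBad.connected (h : MinBad G lam) : G.Connected := by
  obtain ⟨⟨x, hx⟩, hmin⟩ := h
  have hne : Nonempty V := by
    by_contra hV
    rw [not_nonempty_iff] at hV
    simp [qf] at hx
  refine (SimpleGraph.connected_iff _).2 ⟨fun r t => ?_, hne⟩
  by_contra hrt
  obtain ⟨S, hS⟩ : ∃ S : Set V, ∀ v, v ∈ S ↔ G.Reachable r v := ⟨_, fun _ => Iff.rfl⟩
  refine absurd hx (not_lt.2 ?_)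
  rw [qf_add_indicator lam (S := S) (fun v hv w ha => (hS w).2 (((hS v).1 hv).trans ha.reachable)) x]
  exact add_nonneg (hmin _ ⟨t, if_neg fun h => hrt ((hS t).1 h)⟩)
    (hmin _ ⟨r, if_pos ((hS r).2 (SimpleGraph.Reachable.refl _))⟩)

theorem NegOn.exists_minBad {W : Set V} (h : NegOn G lam W) :
    ∃ Z ⊆ W, NegOn G lam Z ∧ MinBad (G.induce Z) lam := by
  obtain ⟨Z, hZ, hmin⟩ := (Set.toFinite {Z : Set V | Z ⊆ W ∧ NegOn G lam Z}).exists_minimal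
    ⟨W, subset_rfl, h⟩
  refine ⟨Z, hZ.1, hZ.2, ?_, fun x ⟨v, hv⟩ => ?_⟩
  · obtain ⟨x, hx, hneg⟩ := hZ.2
    refine ⟨fun v => x v, ?_⟩
    have := qf_of_embedding (SimpleGraph.Embedding.induce (G := G) Z) lam x fun w hw => hx w fun hwZ =>
      hw ⟨⟨w, hwZ⟩, rfl⟩
    rw [this] at hneg
    exact hneg
  · by_contra! hneg
    let f : G.induce Z ↪g G := SimpleGraph.Embedding.induce Z
    have hq := qf_pushVec f lam x
    have hv' : v.1 ∉ Z \ {v.1} := by simp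
    refine hv' (@hmin (Z \ {v.1}) ⟨fun w hw => hZ.1 hw.1, pushVec f.toEmbedding x, ?_, hq ▸ hneg⟩
      (fun w hw => hw.1) _ v.2)
    intro w hw
    by_cases hwZ : w ∈ Z
    · have : w = v := by
        by_contra hne
        exact hw ⟨hwZ, hne⟩
      subst this
      exact (pushVec_apply f.toEmbedding x v).trans hv
    · refine pushVec_eq_zero _ _ ?_
      rintro ⟨u, rfl⟩
      exact hwZ u.2

theorem hasFiniteForbiddenCharacterization_of_minBad {N : ℕ}
    (h : ∀ (V : Type) [Fintype V] (G : SimpleGraph V), MinBad G lam → Fintype.card V ≤ N) :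
    HasFiniteForbiddenCharacterization
      (fun _ G => ∀ μ : ℝ, IsEigenvalue (adjMat G) μ → -lam ≤ μ) := by
  refine hasFiniteForbiddenCharacterization_of_bound N fun n G ⟨x, hx⟩ => ?_
  obtain ⟨Z, -, ⟨y, hy, hyn⟩, hZ⟩ := NegOn.exists_minBad (W := Set.univ) ⟨x, by simp, hx⟩
  refine ⟨y, hyn, ?_⟩
  have h1 := h Z _ hZ
  rw [← Nat.card_eq_fintype_card] at h1
  refine le_trans ?_ h1
  rw [Nat.card_eq_fintype_card, Fintype.card_subtype]
  refine Finset.card_le_card fun v hv => ?_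
  simp only [Finset.mem_filter, Finset.mem_univ, true_and] at hv ⊢
  exact by_contra fun hvZ => hv (hy v hvZ)

theorem MinBad.not_negOn (h : MinBad G lam) {W : Set V} (hW : W.ncard < Fintype.card V) :
    ¬ NegOn G lam W := by
  rintro ⟨x, hx, hn⟩
  obtain ⟨v, hv⟩ : ∃ v, v ∉ W := by
    by_contra! hall
    rw [Set.eq_univ_of_forall hall, Set.ncard_univ, Nat.card_eq_fintype_card] at hW
    exact hW.false
  exact absurd (h.2 x ⟨v, hx v hv⟩) (not_le.2 hn)

theorem exists_bound_minBad_or_represented {β : ℝ} (hβ : β ^ 3 = β + 1)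
    (h : lam < √β + (√β)⁻¹) :
    ∃ N, ∀ (V : Type) [Fintype V] (G : SimpleGraph V), MinBad G lam → N < Fintype.card V →
      ∃ R, Represented G (fun _ : Unit => R) Set.univ := by
  have hβ1 : 1 < β := by nlinarith [sq_nonneg (β + 1), sq_nonneg β, sq_nonneg (β - 1)]
  have hr1 : 1 < √β := by rw [Real.lt_sqrt zero_le_one]; simpa using hβ1
  have hsq : √β ^ 2 = β := Real.sq_sqrt (by linarith)
  have hcont : ContinuousAt (fun s : ℝ => s + 1 / s) (√β) :=
    continuousAt_id.add (continuousAt_const.div continuousAt_id (by positivity))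
  obtain ⟨s, hsβ, hs1, hslam⟩ : ∃ s < √β, 1 < s ∧ lam ≤ s + 1 / s := by
    have h1 : ∀ᶠ s in nhdsWithin (√β) (Set.Iio (√β)), lam < s + 1 / s :=
      nhdsWithin_le_nhds (hcont.eventually (lt_mem_nhds (by simpa using h)))
    have h2 : ∀ᶠ s in nhdsWithin (√β) (Set.Iio (√β)), 1 < s :=
      nhdsWithin_le_nhds (lt_mem_nhds hr1)
    obtain ⟨s, ⟨h1, h2⟩, h3⟩ := ((h1.and h2).and self_mem_nhdsWithin).exists
    exact ⟨s, h3, h2, h1.le⟩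
  obtain ⟨s', hss, hs'⟩ := exists_between hsβ
  have hs6 : s' ^ 6 < s' ^ 2 + 1 := by
    have ht : s' ^ 2 < β := by nlinarith
    have ht1 : 1 < s' ^ 2 := by nlinarith
    have : s' ^ 2 * ((s' ^ 2) ^ 2 - 1) < 1 := by
      have h3 : β * (β ^ 2 - 1) = 1 := by linarith
      have h4 : (s' ^ 2) ^ 2 - 1 ≤ β ^ 2 - 1 := by nlinarith
      have h5 : 0 < (s' ^ 2) ^ 2 - 1 := by nlinarith
      nlinarith
    linarith
  obtain ⟨N, hN⟩ := exists_bound_or_represented hs1 hss hs6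
  exact ⟨N, fun V _ G hG hV => (hN V G hG.connected fun W hW hn =>
    hG.not_negOn (hW.trans_lt hV) (hn.of_le hslam)).resolve_left (not_le.2 hV)⟩

end Minimal

section Order

/-- A graph with coloured vertices. -/
structure ColGraph (Λ : Type) : Type 1 where
  V : Type
  G : SimpleGraph V
  c : V → Λ

namespace ColGraph

variable {Λ : Type}

/-- Induced embeddings preserving the colours. -/
def Emb (X Y : ColGraph Λ) : Prop := ∃ f : X.G ↪g Y.G, ∀ v, Y.c (f v) = X.c v

instance : IsPreorder (ColGraph Λ) Emb where
  refl _ := ⟨SimpleGraph.Embedding.refl, fun _ => rfl⟩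
  trans _ _ _ := fun ⟨f, hf⟩ ⟨g, hg⟩ => ⟨f.trans g, fun v => (hg (f v)).trans (hf v)⟩

/-- A fibre of `π`, with a new colouring. -/
def part (X : ColGraph Λ) (col : X.V → Λ) {ι : Type} (π : X.V → ι) (i : ι) : ColGraph Λ :=
  ⟨{v // π v = i}, X.G.comap Subtype.val, fun v => col v⟩

/-- Coloured graphs of bounded shrub-depth: at each level the adjacency between different parts
is determined by the colours through `A`, and colours are updated by `g`. -/
def Shrub (A : Λ → Λ → Prop) (g : ℕ → Λ → Λ) : ℕ → ColGraph Λ → Prop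
  | 0, X => Subsingleton X.V
  | k + 1, X => Subsingleton X.V ∨ ∃ (m : ℕ) (π : X.V → Fin m) (c' : X.V → Λ),
      (∀ v, X.c v = g k (c' v)) ∧ (∀ v w, π v ≠ π w → (X.G.Adj v w ↔ A (c' v) (c' w))) ∧
      ∀ i, Shrub A g k (X.part c' π i)

theorem partiallyWellOrderedOn_subsingleton [Finite Λ] :
    {X : ColGraph Λ | Subsingleton X.V}.PartiallyWellOrderedOn Emb := by
  refine Set.partiallyWellOrderedOn_iff_exists_lt.2 fun f hf => ?_
  let o : ℕ → Option Λ := fun n => if h : Nonempty (f n).V then some ((f n).c h.some) else none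
  obtain ⟨i, j, hij, ho⟩ : ∃ i j, i < j ∧ o i = o j := by
    obtain ⟨i, j, hij, ho⟩ := Finite.exists_ne_map_eq_of_infinite o
    rcases lt_or_gt_of_ne hij with h | h
    · exact ⟨i, j, h, ho⟩
    · exact ⟨j, i, h, ho.symm⟩
  refine ⟨i, j, hij, ?_⟩
  have hi : Subsingleton (f i).V := hf i
  by_cases h : Nonempty (f i).V
  · have h' : Nonempty (f j).V := by
      by_contra h'
      simp [o, h, h'] at ho
    simp only [o, dif_pos h, dif_pos h', Option.some.injEq] at ho
    refine ⟨⟨⟨fun _ => h'.some, fun a b _ => Subsingleton.elim a b⟩, fun {a b} => ?_⟩, fun v => ?_⟩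
    · rw [Subsingleton.elim a b]
      simp
    · rw [Subsingleton.elim v h.some]
      exact ho.symm
  · rw [not_nonempty_iff] at h
    exact ⟨⟨⟨fun v => h.elim v, fun v => h.elim v⟩, fun {v} => h.elim v⟩, fun v => h.elim v⟩

theorem exists_map_of_sublistForall₂ {α : Type*} {r : α → α → Prop} {m n : ℕ} {a : Fin m → α}
    {b : Fin n → α} (h : List.SublistForall₂ r (List.ofFn a) (List.ofFn b)) :
    ∃ τ : Fin m → Fin n, Function.Injective τ ∧ ∀ i, r (a i) (b (τ i)) := by
  obtain ⟨l, h1, h2⟩ := List.sublistForall₂_iff.1 h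
  obtain ⟨e, he⟩ := List.sublist_iff_exists_fin_orderEmbedding_get_eq.1 h2
  obtain ⟨hl, hr⟩ := List.forall₂_iff_get.1 h1
  have hm : m = l.length := by simpa using hl
  refine ⟨fun i => (e (i.cast hm)).cast (by simp), fun i j hij => ?_, fun i => ?_⟩
  · simpa using hij
  · have h3 := hr i (by simp) (by omega)
    have h4 := he (i.cast hm)
    simp only [List.get_eq_getElem, List.getElem_ofFn] at h3 h4
    convert h3 using 1
    exact h4.symm

theorem emb_of_parts {A : Λ → Λ → Prop} {g : Λ → Λ} {X Y : ColGraph Λ} {m n : ℕ}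
    {π : X.V → Fin m} {c : X.V → Λ} {π' : Y.V → Fin n} {c' : Y.V → Λ}
    (hX : (∀ v, X.c v = g (c v)) ∧ ∀ v w, π v ≠ π w → (X.G.Adj v w ↔ A (c v) (c w)))
    (hY : (∀ v, Y.c v = g (c' v)) ∧ ∀ v w, π' v ≠ π' w → (Y.G.Adj v w ↔ A (c' v) (c' w)))
    {τ : Fin m → Fin n} (hτ : Function.Injective τ)
    (h : ∀ i, Emb (X.part c π i) (Y.part c' π' (τ i))) : Emb X Y := by
  choose φ hφ using h
  let F : X.V → Y.V := fun v => (φ (π v) ⟨v, rfl⟩).1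
  have hF : ∀ i v (hv : π v = i), F v = (φ i ⟨v, hv⟩).1 := by
    rintro _ v rfl
    rfl
  have hπ : ∀ v, π' (F v) = τ (π v) := fun v => (φ (π v) ⟨v, rfl⟩).2
  have hc : ∀ v, c' (F v) = c v := fun v => hφ (π v) ⟨v, rfl⟩
  refine ⟨⟨⟨F, fun v w hvw => ?_⟩, fun {v w} => ?_⟩, fun v => ?_⟩
  · have hp : π v = π w := hτ (by rw [← hπ, ← hπ, hvw])
    rw [hF _ v hp, hF _ w rfl] at hvw
    exact congrArg Subtype.val ((φ (π w)).injective (Subtype.ext hvw))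
  · by_cases hp : π v = π w
    · have := (φ (π w)).map_adj_iff (v := ⟨v, hp⟩) (w := ⟨w, rfl⟩)
      change Y.G.Adj (F v) (F w) ↔ _
      rw [hF _ v hp, hF _ w rfl]
      exact this
    · change Y.G.Adj (F v) (F w) ↔ _
      rw [hX.2 v w hp, hY.2 _ _ (by rw [hπ, hπ]; exact fun h => hp (hτ h)), hc, hc]
  · change Y.c (F v) = _
    rw [hX.1, hY.1, hc]

theorem partiallyWellOrderedOn_shrub [Finite Λ] (A : Λ → Λ → Prop) (g : ℕ → Λ → Λ) (k : ℕ) :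
    {X : ColGraph Λ | Shrub A g k X}.PartiallyWellOrderedOn Emb := by
  induction k with
  | zero => exact partiallyWellOrderedOn_subsingleton
  | succ k ih =>
    refine (partiallyWellOrderedOn_subsingleton.union (t := {X : ColGraph Λ | ∃ (m : ℕ) (π : X.V → Fin m)
      (c' : X.V → Λ), (∀ v, X.c v = g k (c' v)) ∧
      (∀ v w, π v ≠ π w → (X.G.Adj v w ↔ A (c' v) (c' w))) ∧
      ∀ i, Shrub A g k (X.part c' π i)}) ?_).mono fun X hX => hX
    refine Set.partiallyWellOrderedOn_iff_exists_lt.2 fun f hf => ?_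
    choose m π c hc hA hS using hf
    obtain ⟨i, j, hij, h⟩ := (ih.partiallyWellOrderedOn_sublistForall₂ Emb).exists_lt
      (f := fun n => List.ofFn ((f n).part (c n) (π n))) fun n x hx => by
        obtain ⟨a, rfl⟩ := (List.mem_ofFn' _ _).1 hx
        exact hS n a
    obtain ⟨τ, hτ, h⟩ := exists_map_of_sublistForall₂ h
    exact ⟨i, j, hij, emb_of_parts ⟨hc i, hA i⟩ ⟨hc j, hA j⟩ hτ h⟩

end ColGraph

end Order

section ShrubDepth

open ColGraph

/-- Adjacency read off from the coordinates at the removed units. -/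
def colAdj {K : ℕ} (c d : Fin K → ZMod 3) : Prop := ∑ i, c i * d i ≠ 0

/-- Forget the coordinate at the last removed unit. -/
def forget {K : ℕ} (k : ℕ) (c : Fin K → ZMod 3) : Fin K → ZMod 3 :=
  fun i => if i.1 + k + 1 = K then 0 else c i

theorem shrub_of_subsingleton {Λ : Type} {A : Λ → Λ → Prop} {g : ℕ → Λ → Λ} {X : ColGraph Λ}
    (h : Subsingleton X.V) : ∀ k, Shrub A g k X
  | 0 => h
  | _ + 1 => .inl h

variable {V : Type} [Fintype V] {G : SimpleGraph V} {κ : Type} [Fintype κ] {ρ : V → κ → ℤ}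

/-- The vertices `v` and `w` share a unit not among `u 0, …, u (n - 1)`. -/
def Share (ρ : V → κ → ℤ) (u : ℕ → κ) (n : ℕ) (v w : V) : Prop :=
  ∃ q, (∀ i < n, q ≠ u i) ∧ ρ v q ≠ 0 ∧ ρ w q ≠ 0

/-- An integral combination of `n` vertices, represented by `± u n - u 0`. -/
def Chain (ρ : V → κ → ℤ) (u : ℕ → κ) (n : ℕ) : Prop :=
  ∃ (a : V → ℤ) (β : ℤ), β ^ 2 = 1 ∧ ∑ v, a v ^ 2 = n ∧
    (∀ v, a v ≠ 0 → ∀ q, ρ v q ≠ 0 → ∃ i ≤ n, q = u i) ∧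
    ∀ q, ∑ v, a v * ρ v q = (if q = u n then β else 0) - if q = u 0 then 1 else 0

theorem sq_eq_one_of_sum_sq {f : κ → ℤ} (h : ∑ k, f k ^ 2 = 2) {p q : κ} (hpq : p ≠ q)
    (hp : f p ≠ 0) (hq : f q ≠ 0) : f p ^ 2 = 1 ∧ f q ^ 2 = 1 ∧ ∀ k, f k ≠ 0 → k = p ∨ k = q := by
  have hp1 : 0 < f p ^ 2 := by positivity
  have hq1 : 0 < f q ^ 2 := by positivity
  have hsub : ∀ s : Finset κ, ∑ k ∈ s, f k ^ 2 ≤ 2 := fun s => h ▸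
    Finset.sum_le_sum_of_subset_of_nonneg (Finset.subset_univ s) fun k _ _ => sq_nonneg (f k)
  have h2 := hsub {p, q}
  rw [Finset.sum_pair hpq] at h2
  refine ⟨by omega, by omega, fun k hk => ?_⟩
  by_contra! hne
  have h3 := hsub {k, p, q}
  rw [Finset.sum_insert (by simp [hne.1, hne.2]), Finset.sum_pair hpq] at h3
  have hk1 : 0 < f k ^ 2 := by positivity
  omega

theorem Chain.extend {u : ℕ → κ} {n : ℕ} (h : Chain ρ u n) {z : V} {q : κ}
    (hz2 : ∑ k, ρ z k ^ 2 = 2) (hz : ρ z (u n) ≠ 0) (hq : ρ z q ≠ 0) (hqu : ∀ i ≤ n, q ≠ u i) :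
    Chain ρ (Function.update u (n + 1) q) (n + 1) := by
  obtain ⟨a, β, hβ, ha, hs, hsum⟩ := h
  obtain ⟨h1, h2, h3⟩ := sq_eq_one_of_sum_sq hz2 (hqu n le_rfl).symm hz hq
  have haz : a z = 0 := by
    by_contra h0
    obtain ⟨i, hi, rfl⟩ := hs z h0 q hq
    exact hqu i hi rfl
  have hu : ∀ i ≤ n, Function.update u (n + 1) q i = u i := fun i hi =>
    Function.update_of_ne (by omega) _ _
  refine ⟨fun v => a v + if v = z then -β * ρ z (u n) else 0, -β * ρ z (u n) * ρ z q, ?_, ?_, ?_, ?_⟩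
  · rw [mul_pow, mul_pow, neg_sq, hβ, h1, h2]
    norm_num
  · have : ∀ v, (a v + if v = z then -β * ρ z (u n) else 0) ^ 2 =
        a v ^ 2 + if v = z then 1 else 0 := fun v => by
      split_ifs with hv
      · rw [hv, haz, zero_add, mul_pow, neg_sq, hβ, h1]
        norm_num
      · ring
    simp only [this, Finset.sum_add_distrib, ha, Finset.sum_ite_eq', Finset.mem_univ, if_true]
    push_cast
    rfl
  · intro v hv p hp
    by_cases hvz : v = z
    · subst hvz
      rcases h3 p hp with rfl | rfl
      · exact ⟨n, by omega, (hu n le_rfl).symm⟩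
      · exact ⟨n + 1, le_rfl, by simp⟩
    · obtain ⟨i, hi, rfl⟩ := hs v (by simpa [hvz] using hv) p hp
      exact ⟨i, by omega, (hu i hi).symm⟩
  · intro p
    have h4 : ∑ v, (if v = z then -β * ρ z (u n) else 0) * ρ v p = -β * ρ z (u n) * ρ z p := by
      simp [ite_mul]
    simp only [add_mul, Finset.sum_add_distrib, hsum, h4, Function.update_self, hu 0 (Nat.zero_le n)]
    by_cases hp : p = u n
    · subst hp
      have : u n ≠ q := (hqu n le_rfl).symm
      simp only [if_true, this, if_false]
      linear_combination -β * h1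
    · by_cases hpq : p = q
      · subst hpq
        simp only [if_neg hp, if_true]
        ring
      · have : ρ z p = 0 := by
          by_contra h0
          exact (h3 p h0).elim hp hpq
        simp [hp, hpq, this]

theorem not_chain {lam : ℝ} {K : ℕ} {u : ℕ → κ}
    (hρ : ∀ x y, ∑ k, ρ x k * ρ y k = if x = y then 2 else if G.Adj x y then 1 else 0)
    (hK : 4 < (2 - lam) * K)
    (hpos : ∀ a : V → ℤ, ∑ v, a v ^ 2 ≤ K → 0 ≤ qf G lam fun v => a v) : ¬ Chain ρ u K := by
  rintro ⟨a, β, hβ, ha, -, hsum⟩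
  have h1 := hpos a ha.le
  have h2 := qf_two_eq (G := G) (W := Set.univ) (ρ := ρ) (fun x _ y _ => hρ x y)
    (x := fun v => (a v : ℝ)) (fun v hv => absurd trivial hv)
  have h3 := qf_add_lam G lam (2 - lam) (fun v => (a v : ℝ))
  have h4 : ∑ v, (a v : ℝ) ^ 2 = K := by exact_mod_cast ha
  have h5 : ∑ k, (∑ v, (a v : ℝ) * ρ v k) ^ 2 ≤ 4 := by
    have h6 : ∑ k, (∑ v, a v * ρ v k) ^ 2 ≤ 4 := by
      calc ∑ k, (∑ v, a v * ρ v k) ^ 2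
          ≤ ∑ k, (2 * (if k = u K then 1 else 0) + 2 * if k = u 0 then 1 else 0) := by
            refine Finset.sum_le_sum fun k _ => ?_
            rw [hsum]
            split_ifs <;> nlinarith [sq_nonneg (β + 1)]
        _ = 4 := by
            simp [Finset.sum_add_distrib]
    exact_mod_cast h6
  rw [add_sub_cancel, h2, h4] at h3
  linarith

theorem shrub_of_chain {lam : ℝ} {K : ℕ}
    (hρ : ∀ x y, ∑ k, ρ x k * ρ y k = if x = y then 2 else if G.Adj x y then 1 else 0)
    (hK : 4 < (2 - lam) * K)
    (hpos : ∀ a : V → ℤ, ∑ v, a v ^ 2 ≤ K → 0 ≤ qf G lam fun v => a v) (k : ℕ) :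
    ∀ (n : ℕ) (_ : n + k = K) (u : ℕ → κ) (X : ColGraph (Fin K → ZMod 3)) (e : X.V → V),
      Function.Injective e → (∀ v w, X.G.Adj v w ↔ G.Adj (e v) (e w)) →
      (∀ v (i : Fin K), X.c v i = if i.1 < n then (ρ (e v) (u i) : ZMod 3) else 0) →
      (∀ T : Set X.V, T.Nonempty → (∀ v ∈ T, ∀ w, Share ρ u n (e v) (e w) → w ∈ T) →
        T = Set.univ) →
      (∀ i ≤ n, ∀ j ≤ n, u i = u j → i = j) → (∃ z, ρ (e z) (u n) ≠ 0) → Chain ρ u n →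
      Shrub colAdj forget k X := by
  induction k with
  | zero =>
    rintro n rfl u X e - - - - - - hch
    exact absurd hch (not_chain hρ hK hpos)
  | succ k ih =>
    rintro n hn u X e he hadj hcol hconn hu ⟨z, hz⟩ hch
    have hfin : Finite X.V := Finite.of_injective e he
    let r : X.V → X.V → Prop := fun v w => Share ρ u (n + 1) (e v) (e w)
    let Q := Quotient (Relation.EqvGen.setoid r)
    obtain ⟨m, ⟨E⟩⟩ := Finite.exists_equiv_fin Q
    let π : X.V → Fin m := fun v => E (Quotient.mk _ v)
    have hπ : ∀ v w, π v = π w ↔ Relation.EqvGen r v w := fun v w => by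
      simp only [π, E.injective.eq_iff]
      exact Quotient.eq
    let c' : X.V → Fin K → ZMod 3 := fun v i => if i.1 < n + 1 then (ρ (e v) (u i) : ZMod 3) else 0
    refine .inr ⟨m, π, c', fun v => funext fun i => ?_, fun v w hvw => ?_, fun i => ?_⟩
    · rw [hcol]
      simp only [forget, c']
      split_ifs <;> first | rfl | omega
    · have hne : e v ≠ e w := fun h => hvw (by rw [he h])
      have hns : ∀ q, (∀ i < n + 1, q ≠ u i) → ρ (e v) q * ρ (e w) q = 0 := fun q hq => by
        by_contra h0
        exact hvw ((hπ v w).2 (.rel _ _ ⟨q, hq, left_ne_zero_of_mul h0, right_ne_zero_of_mul h0⟩))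
      have h1 : ∑ i : Fin K, c' v i * c' w i =
          ((∑ k, ρ (e v) k * ρ (e w) k : ℤ) : ZMod 3) := by
        have h2 : ∑ k, ρ (e v) k * ρ (e w) k =
            ∑ i ∈ Finset.range (n + 1), ρ (e v) (u i) * ρ (e w) (u i) := by
          rw [← Finset.sum_image (s := Finset.range (n + 1)) (g := u)
            (f := fun q => ρ (e v) q * ρ (e w) q)]
          · refine (Finset.sum_subset (Finset.subset_univ _) fun q _ hq => hns q fun i hi h => ?_).symm
            exact hq (Finset.mem_image.2 ⟨i, Finset.mem_range.2 hi, h.symm⟩)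
          · intro i hi j hj hij
            simp only [Finset.coe_range, Set.mem_Iio] at hi hj
            exact hu i (by omega) j (by omega) hij
        rw [h2, Int.cast_sum, Fin.sum_univ_eq_sum_range (fun i =>
          (if i < n + 1 then (ρ (e v) (u i) : ZMod 3) else 0) *
            (if i < n + 1 then (ρ (e w) (u i) : ZMod 3) else 0)) K]
        refine (Finset.sum_subset_zero_on_sdiff (Finset.range_subset_range.2 (by omega))
          (fun i hi => ?_) fun i hi => ?_).symm
        · simp only [Finset.mem_sdiff, Finset.mem_range] at hi
          simp [hi.2]
        · simp only [Finset.mem_range] at hi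
          simp [hi]
      rw [colAdj, h1, hρ, if_neg hne, hadj]
      split_ifs with h <;> simp [h]
    · have hconn' : ∀ T : Set {v // π v = i}, T.Nonempty →
          (∀ v ∈ T, ∀ w, r v.1 w.1 → w ∈ T) → T = Set.univ := by
        rintro T ⟨t, ht⟩ hT
        have hr : ∀ x y, r x y → r y x := fun x y ⟨q, h1, h2, h3⟩ => ⟨q, h1, h3, h2⟩
        have hstep : ∀ x y, r x y → x ∈ Subtype.val '' T → y ∈ Subtype.val '' T := by
          rintro _ y hxy ⟨x, hx, rfl⟩
          have hy : π y = i := ((hπ _ _).2 (.rel _ _ hxy)).symm.trans x.2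
          exact ⟨⟨y, hy⟩, hT x hx ⟨y, hy⟩ hxy, rfl⟩
        have key : ∀ x y, Relation.EqvGen r x y →
            (x ∈ Subtype.val '' T ↔ y ∈ Subtype.val '' T) := fun x y h => by
          induction h with
          | rel x y h => exact ⟨hstep x y h, hstep y x (hr x y h)⟩
          | refl x => exact Iff.rfl
          | symm x y _ ih => exact ih.symm
          | trans x y z _ _ h1 h2 => exact h1.trans h2
        refine Set.eq_univ_of_forall fun w => ?_
        obtain ⟨w', hw', h⟩ := (key t w ((hπ _ _).1 (t.2.trans w.2.symm))).1 ⟨t, ht, rfl⟩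
        rwa [Subtype.ext h] at hw'
      by_cases hsub : Subsingleton {v // π v = i}
      · exact shrub_of_subsingleton hsub k
      obtain ⟨v₀, v₁, hv⟩ := not_subsingleton_iff_nontrivial.1 hsub
      obtain ⟨z', hz'i, hz'⟩ : ∃ z', π z' = i ∧ ρ (e z') (u n) ≠ 0 := by
        by_contra! hno
        have := hconn {v | π v = i} ⟨v₀, v₀.2⟩ fun v hv w ⟨q, hq, h1, h2⟩ => by
          refine ((hπ w v).2 (.symm _ _ (.rel _ _ ⟨q, fun j hj => ?_, h1, h2⟩))).trans hv
          rcases Nat.lt_succ_iff_lt_or_eq.1 hj with hj | rfl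
          · exact hq j hj
          · rintro rfl
            exact h1 (hno v hv)
        exact hz (hno z (this ▸ Set.mem_univ z : z ∈ {v | π v = i}))
      obtain ⟨q, hq, hqz⟩ : ∃ q, (∀ j < n + 1, q ≠ u j) ∧ ρ (e z') q ≠ 0 := by
        by_contra! hno
        have := hconn' {⟨z', hz'i⟩} ⟨_, rfl⟩ (by
          rintro _ rfl w ⟨q, hq, h1, -⟩
          exact absurd (hno q hq) h1)
        have h0 : ∀ w : {v // π v = i}, w = ⟨z', hz'i⟩ := fun w =>
          (this ▸ Set.mem_univ w : w ∈ ({⟨z', hz'i⟩} : Set _))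
        exact hv ((h0 v₀).trans (h0 v₁).symm)
      have hup : ∀ j < n + 1, Function.update u (n + 1) q j = u j := fun j hj =>
        Function.update_of_ne (by omega) _ _
      have hz2 : ∑ k, ρ (e z') k ^ 2 = 2 := by
        simpa [sq] using hρ (e z') (e z')
      refine ih (n + 1) (by omega) (Function.update u (n + 1) q) (X.part c' π i) (fun v => e v.1)
        (he.comp Subtype.val_injective) (fun v w => hadj v.1 w.1) (fun v j => ?_)
        (fun T hT hcl => hconn' T hT fun v hv w ⟨p, hp, h⟩ => hcl v hv w
          ⟨p, fun j hj => by rw [hup j hj]; exact hp j hj, h⟩) ?_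
        ⟨⟨z', hz'i⟩, by simpa using hqz⟩
        (hch.extend hz2 hz' hqz fun j hj => hq j (by omega))
      · change (if j.1 < n + 1 then (ρ (e v.1) (u j) : ZMod 3) else 0) = _
        split_ifs with hj
        · rw [hup _ hj]
        · rfl
      · intro j hj l hl h
        rcases Nat.lt_or_eq_of_le hj with hj | rfl <;> rcases Nat.lt_or_eq_of_le hl with hl | rfl
        · rw [hup j hj, hup l hl] at h
          exact hu j (by omega) l (by omega) h
        · rw [hup j hj, Function.update_self] at h
          exact absurd h.symm (hq j hj)
        · rw [hup l hl, Function.update_self] at h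
          exact absurd h (hq l hl)
        · rfl

theorem MinBad.shrub {lam : ℝ} (h : MinBad G lam) {K : ℕ} (hK : 4 < (2 - lam) * K)
    (hV : K < Fintype.card V) {R : Set V} (hR : Represented G (fun _ : Unit => R) Set.univ) :
    Shrub colAdj forget K (⟨V, G, fun _ _ => 0⟩ : ColGraph (Fin K → ZMod 3)) := by
  obtain ⟨κ, _, -, ρ, -, -, hρ⟩ := hR
  have hρ' := fun x y => hρ x trivial y trivial
  have hG := h.connected
  obtain ⟨r⟩ := hG.nonempty
  obtain ⟨q, hq⟩ : ∃ q, ρ r q ≠ 0 := by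
    by_contra! h0
    simpa [h0] using hρ' r r
  refine shrub_of_chain (u := fun _ => q) (n := 0) (e := id) hρ' hK (fun a ha => ?_) K (Nat.zero_add K)
    (X := ⟨V, G, fun _ _ => 0⟩) Function.injective_id (fun _ _ => Iff.rfl) (fun v i => by simp)
    (fun T ⟨t, ht⟩ hT => Set.eq_univ_of_forall fun w => ?_) (fun i hi j hj _ => by omega) ⟨r, hq⟩
    ⟨0, 1, by simp, by simp, by simp, fun p => by simp⟩
  · refine h.2 _ (by_contra fun hno => ?_)
    push Not at hno
    have h1 : ∑ v : V, (1 : ℤ) ≤ ∑ v, a v ^ 2 := Finset.sum_le_sum fun v _ => by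
      have : a v ≠ 0 := by exact_mod_cast hno v
      have : 0 < a v ^ 2 := by positivity
      omega
    simp only [Finset.sum_const, Finset.card_univ, nsmul_eq_mul, mul_one] at h1
    omega
  · obtain ⟨p⟩ := hG.preconnected t w
    induction p with
    | nil => exact ht
    | cons hab p ih =>
      rename_i x y _
      refine ih (hT x ht y ?_)
      have h1 := hρ' x y
      rw [if_neg hab.ne, if_pos hab] at h1
      obtain ⟨q', -, hq'⟩ := Finset.exists_ne_zero_of_sum_ne_zero (h1.trans_ne one_ne_zero)
      exact ⟨q', fun i hi => absurd hi (Nat.not_lt_zero i), left_ne_zero_of_mul hq',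
        right_ne_zero_of_mul hq'⟩

theorem exists_bound_of_lt_two {lam : ℝ} (hlam : lam < 2) {N : ℕ}
    (hN : ∀ (V : Type) [Fintype V] (G : SimpleGraph V), MinBad G lam → N < Fintype.card V →
      ∃ R, Represented G (fun _ : Unit => R) Set.univ) :
    ∃ M, ∀ (V : Type) [Fintype V] (G : SimpleGraph V), MinBad G lam → Fintype.card V ≤ M := by
  obtain ⟨K, hK⟩ := exists_nat_gt (4 / (2 - lam))
  rw [div_lt_iff₀ (by linarith), mul_comm] at hK
  by_contra! hno
  have hX : ∀ M, ∃ X : ColGraph (Fin K → ZMod 3), M < Nat.card X.V ∧ Shrub colAdj forget K X ∧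
      ∃ _ : Fintype X.V, MinBad X.G lam := fun M => by
    obtain ⟨V, _, G, hG, hV⟩ := hno (N + K + M)
    obtain ⟨R, hR⟩ := hN V G hG (by omega)
    refine ⟨⟨V, G, fun _ _ => 0⟩, ?_, hG.shrub hK (by omega) hR, _, hG⟩
    change M < Nat.card V
    rw [Nat.card_eq_fintype_card]
    omega
  choose X hc hS hmin using hX
  let t : ℕ → ℕ := fun n => n.rec 0 fun _ m => Nat.card (X m).V
  have hmono : StrictMono fun n => Nat.card (X (t n)).V := strictMono_nat_of_lt_succ fun n =>
    hc (t (n + 1))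
  obtain ⟨i, j, hij, f, -⟩ := (partiallyWellOrderedOn_shrub colAdj forget K).exists_lt
    (f := fun n => X (t n)) fun n => hS _
  obtain ⟨_, ⟨x, hx⟩, -⟩ := hmin (t i)
  obtain ⟨_, -, hj⟩ := hmin (t j)
  rw [← qf_pushVec f] at hx
  obtain ⟨w, hw⟩ : ∃ w, w ∉ Set.range f := by
    by_contra! hall
    exact (hmono hij).not_ge (Nat.card_le_card_of_surjective f hall)
  exact absurd (hj _ ⟨w, pushVec_eq_zero f.toEmbedding x hw⟩) (not_le.2 hx)

end ShrubDepth

/-- **Theorem (Jiang–Polyanskii).** The family of graphs whose smallest eigenvalue is at least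
`-λ` has a finite forbidden subgraph characterization iff `λ < λ*`, where
`λ* = β^(1/2) + β^(-1/2)` and `β` is the unique real root of `x³ = x + 1`. -/
theorem forbidden_characterization_iff_lt_lamStar
    (βs lamStar : ℝ) (hβs : βs ^ 3 = βs + 1)
    (hstar : lamStar = Real.sqrt βs + (Real.sqrt βs)⁻¹) (lam : ℝ) :
    HasFiniteForbiddenCharacterization
      (fun _ G => ∀ μ : ℝ, IsEigenvalue (adjMat G) μ → -lam ≤ μ) ↔ lam < lamStar := by
  have hβ1 : 1 < βs := by nlinarith [sq_nonneg (βs + 1), sq_nonneg βs, sq_nonneg (βs - 1)]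
  have hr1 : 1 < √βs := by rw [Real.lt_sqrt zero_le_one]; simpa using hβ1
  have hsq : √βs ^ 2 = βs := Real.sq_sqrt (by linarith)
  refine ⟨fun h => lt_of_not_ge fun hle => ?_, fun h => ?_⟩
  · obtain ⟨s, hs, hlam⟩ : ∃ s, √βs ≤ s ∧ lam = s + 1 / s := by
      have hc : ContinuousOn (fun s : ℝ => s + 1 / s) (Set.Icc (√βs) (√βs + lam)) :=
        continuousOn_id.add (continuousOn_const.div continuousOn_id fun s hs => by
          have := hs.1
          change s ≠ 0
          linarith)
      have hl : 0 < lam := by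
        have : 0 < (√βs)⁻¹ := by positivity
        linarith
      obtain ⟨s, hs, h⟩ := intermediate_value_Icc (by linarith) hc (show lam ∈ _ from
        ⟨by simpa [hstar] using hle, by
          have : 0 < 1 / (√βs + lam) := by positivity
          linarith⟩)
      exact ⟨s, hs.1, h.symm⟩
    refine not_hasFiniteForbiddenCharacterization (hr1.trans_le hs) ?_ hlam h
    have ht : βs ≤ s ^ 2 := by nlinarith
    have h1 : βs * (βs ^ 2 - 1) = 1 := by linarith
    have h2 : βs ^ 2 - 1 ≤ (s ^ 2) ^ 2 - 1 := by nlinarith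
    have h3 : 0 < βs ^ 2 - 1 := by nlinarith
    have := mul_le_mul ht h2 h3.le (sq_nonneg s)
    linarith
  · obtain ⟨N, hN⟩ := exists_bound_minBad_or_represented hβs (hstar ▸ h)
    rcases lt_or_ge lam 2 with hl | hl
    · obtain ⟨M, hM⟩ := exists_bound_of_lt_two hl hN
      exact hasFiniteForbiddenCharacterization_of_minBad hM
    · refine hasFiniteForbiddenCharacterization_of_minBad (N := N) fun V _ G hG => ?_
      by_contra! hV
      obtain ⟨R, hR⟩ := hN V G hG hV
      obtain ⟨x, hx⟩ := hG.1
      exact absurd ((hR.qf_nonneg x).trans (qf_mono hl x)) (not_le.2 hx)
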